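/- Let A be a representation-finite tree algebra with exactly one zero-relation α_m⋯α_1 (m ≥ 2) with s(α_1) = a, e(α_m) = b. If there exists a sectional path in Γ_A from a direct summand of rad P_a to a direct summand of I_b/soc I_b, then no indecomposable A-module is simultaneously a successor of P_a and a predecessor of I_b (i.e. 𝒜 ∩ 𝒞 = ∅). -/

import Mathlib

open CategoryTheory
open scoped Classical

/-! ## Quiver combinatorics -/

/-- Paths in a quiver given by source and target maps. -/
inductive QPath {V E : Type} (src tgt : E → V) : V → V → Type
  | nil (a : V) : QPath src tgt a a
  | cons {a b : V} (p : QPath src tgt a b) (α : E) (h : src α = b) : QPath src tgt a (tgt α)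

namespace QPath

variable {V E : Type} {src tgt : E → V}

def length : ∀ {a b : V}, QPath src tgt a b → ℕ
  | _, _, .nil _ => 0
  | _, _, .cons p _ _ => p.length + 1

def comp : ∀ {a b c : V}, QPath src tgt a b → QPath src tgt b c → QPath src tgt a c
  | _, _, _, p, .nil _ => p
  | _, _, _, p, .cons q α h => .cons (p.comp q) α h

/-- The list of vertices visited by a path, in order. -/
def verts : ∀ {a b : V}, QPath src tgt a b → List V
  | a, _, .nil _ => [a]
  | _, _, .cons p α _ => p.verts ++ [tgt α]

/-- The interior (intermediate) vertices of a path. -/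
def interior {a b : V} (p : QPath src tgt a b) : List V :=
  (p.verts.dropLast).drop 1

/-- The list of arrows of a path, in walk order. -/
def arrows : ∀ {a b : V}, QPath src tgt a b → List E
  | _, _, .nil _ => []
  | _, _, .cons p α _ => p.arrows ++ [α]

end QPath

/-- A presentation of the algebra `A` by the (ordinary) quiver with vertex set `V`
and arrow set `E` : a complete family of orthogonal primitive idempotents indexed by
the vertices together with generators indexed by the arrows. -/
structure QuiverPresentation (k A V E : Type) [Field k] [Ring A] [Algebra k A]
    [Fintype V] [Fintype E] where
  src : E → V
  tgt : E → V
  idem : V → A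
  arrow : E → A
  idem_idem : ∀ a : V, idem a * idem a = idem a
  idem_orth : ∀ a b : V, a ≠ b → idem a * idem b = 0
  sum_idem : ∑ a : V, idem a = 1
  idem_ne : ∀ a : V, idem a ≠ 0
  idem_primitive : ∀ (v : V) (f g : A), f * f = f → g * g = g → f * g = 0 → g * f = 0 →
    f + g = idem v → f = 0 ∨ g = 0
  arrow_mem : ∀ α : E, idem (tgt α) * arrow α * idem (src α) = arrow α
  arrow_ne : ∀ α : E, arrow α ≠ 0
  generates : Algebra.adjoin k (Set.range idem ∪ Set.range arrow) = ⊤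

namespace QuiverPresentation

variable {k A V E : Type} [Field k] [Ring A] [Algebra k A] [Fintype V] [Fintype E]

/-- The product in `A` of the arrows along a path (paths are written right to left). -/
def qprod (P : QuiverPresentation k A V E) :
    ∀ {a b : V}, QPath P.src P.tgt a b → A
  | _, _, .nil a => P.idem a
  | _, _, .cons p α _ => P.arrow α * P.qprod p

/-- The ideal of relations is admissible: all sufficiently long paths vanish. -/
def Admissible (P : QuiverPresentation k A V E) : Prop :=
  ∃ N : ℕ, ∀ (a b : V) (p : QPath P.src P.tgt a b), N ≤ p.length → P.qprod p = 0

/-- The presentation is minimal: the idempotents and the arrows are linearly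
independent modulo the span of the products of paths of length at least two,
so that `(V, E)` really is the ordinary quiver of `A`. -/
def Minimal (P : QuiverPresentation k A V E) : Prop :=
  ∀ (c : V → k) (d : E → k),
    ((∑ a : V, c a • P.idem a) + ∑ α : E, d α • P.arrow α) ∈
      Submodule.span k {x : A | ∃ (a b : V) (p : QPath P.src P.tgt a b),
        2 ≤ p.length ∧ P.qprod p = x} →
    (∀ a, c a = 0) ∧ (∀ α, d α = 0)

/-- The algebra is monomial: the ideal of relations is generated by paths; equivalently,
the images of the paths which do not vanish are linearly independent. -/
def Monomial (P : QuiverPresentation k A V E) : Prop :=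
  LinearIndependent k
    (fun q : {q : Σ a : V, Σ b : V, QPath P.src P.tgt a b // P.qprod q.2.2 ≠ 0} =>
      P.qprod q.1.2.2)

/-- A (minimal) zero-relation: a path of length at least two whose product vanishes
while the product along every proper subpath does not. -/
def IsZeroRel (P : QuiverPresentation k A V E) {a b : V} (p : QPath P.src P.tgt a b) : Prop :=
  P.qprod p = 0 ∧ 2 ≤ p.length ∧
  ∀ (x y : V) (q : QPath P.src P.tgt x y) (p₁ : QPath P.src P.tgt a x)
    (p₂ : QPath P.src P.tgt y b),
      p = p₁.comp (q.comp p₂) → q.length < p.length → P.qprod q ≠ 0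

/-- A vertex `u` is involved in a zero-relation `α_m ⋯ α_1` if `u = s(α_i)`
for some `i = 2, …, m`, i.e. `u` is an interior vertex of the relation. -/
def InvolvedInZeroRel (P : QuiverPresentation k A V E) (u : V) : Prop :=
  ∃ (a b : V) (p : QPath P.src P.tgt a b), P.IsZeroRel p ∧ u ∈ p.interior

/-! ### Walks (for strings and for connectivity) -/

/-- The starting vertex of a step (an arrow traversed forwards or backwards). -/
def stepSrc (P : QuiverPresentation k A V E) (s : E × Bool) : V :=
  if s.2 then P.src s.1 else P.tgt s.1

/-- The ending vertex of a step. -/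
def stepTgt (P : QuiverPresentation k A V E) (s : E × Bool) : V :=
  if s.2 then P.tgt s.1 else P.src s.1

/-- `l` is a walk from `a` to `b` in the underlying graph of the quiver. -/
def IsWalkFrom (P : QuiverPresentation k A V E) : V → List (E × Bool) → V → Prop
  | a, [], b => a = b
  | a, s :: l, b => P.stepSrc s = a ∧ P.IsWalkFrom (P.stepTgt s) l b

/-- The product in `A` of a list of arrows (listed in walk order). -/
def wprod (P : QuiverPresentation k A V E) (l : List E) : A :=
  ((l.map P.arrow).reverse).prod

/-- A reduced walk: no step is immediately followed by its inverse. -/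
def Reduced (l : List (E × Bool)) : Prop :=
  ¬ ∃ (l₁ : List (E × Bool)) (s : E × Bool) (l₂ : List (E × Bool)),
      l = l₁ ++ s :: (s.1, !s.2) :: l₂

/-- No direct subwalk of `l` nor the inverse of such lies in the ideal of relations. -/
def NoZeroSub (P : QuiverPresentation k A V E) (l : List (E × Bool)) : Prop :=
  ∀ (l₁ : List (E × Bool)) (r : List E) (l₂ : List (E × Bool)),
    (l = l₁ ++ (r.map (fun e => (e, true))) ++ l₂ → P.wprod r ≠ 0) ∧
    (l = l₁ ++ (r.map (fun e => (e, false))) ++ l₂ → P.wprod r.reverse ≠ 0)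

/-- A string from `a` to `b`. -/
def IsStringWalk (P : QuiverPresentation k A V E) (a : V) (l : List (E × Bool)) (b : V) : Prop :=
  P.IsWalkFrom a l b ∧ Reduced l ∧ P.NoZeroSub l

/-- `(Q_u^s)_0` : the strings starting at `u` that are trivial or start with an arrow. -/
def QSset (P : QuiverPresentation k A V E) (u : V) : Set (List (E × Bool)) :=
  {l | ∃ b : V, P.IsStringWalk u l b ∧ (l = [] ∨ ∃ (α : E) (l' : List (E × Bool)),
    l = (α, true) :: l')}

/-- `(Q_u^e)_0` : the strings ending at `u` that are trivial or end with an arrow. -/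
def QEset (P : QuiverPresentation k A V E) (u : V) : Set (List (E × Bool)) :=
  {l | ∃ a : V, P.IsStringWalk a l u ∧ (l = [] ∨ ∃ (α : E) (l' : List (E × Bool)),
    l = l' ++ [(α, true)])}

/-- `S_γ` : the strings starting with the arrow `γ`. -/
def Sarr (P : QuiverPresentation k A V E) (γ : E) : Set (List (E × Bool)) :=
  {l | ∃ b : V, P.IsStringWalk (P.src γ) l b ∧ ∃ l' : List (E × Bool), l = (γ, true) :: l'}

/-- `E_γ` : the strings ending with the arrow `γ`. -/
def Earr (P : QuiverPresentation k A V E) (γ : E) : Set (List (E × Bool)) :=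
  {l | ∃ a : V, P.IsStringWalk a l (P.tgt γ) ∧ ∃ l' : List (E × Bool), l = l' ++ [(γ, true)]}

/-- The defining conditions of a string algebra. -/
def IsStringAlgebra (P : QuiverPresentation k A V E) : Prop :=
  P.Monomial ∧
  (∀ v : V, Nat.card {α : E // P.src α = v} ≤ 2) ∧
  (∀ v : V, Nat.card {α : E // P.tgt α = v} ≤ 2) ∧
  (∀ γ : E, Nat.card {β : E // P.src β = P.tgt γ ∧ P.arrow β * P.arrow γ ≠ 0} ≤ 1) ∧
  (∀ β : E, Nat.card {γ : E // P.src β = P.tgt γ ∧ P.arrow β * P.arrow γ ≠ 0} ≤ 1)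

/-- Connectivity in the underlying graph, avoiding a given set of arrows. -/
def ConnAvoid (P : QuiverPresentation k A V E) (avoid : Set E) (a b : V) : Prop :=
  ∃ l : List (E × Bool), P.IsWalkFrom a l b ∧ ∀ s ∈ l, s.1 ∉ avoid

def Connected (P : QuiverPresentation k A V E) : Prop := ∀ a b : V, P.ConnAvoid ∅ a b

/-- The underlying graph of the quiver is a tree. -/
def IsTreeQuiver (P : QuiverPresentation k A V E) : Prop :=
  P.Connected ∧ Fintype.card E + 1 = Fintype.card V

/-- The underlying (undirected) graph of the quiver is given by the edge-endpoint
specification `ends` on `nV` vertices and `nE` edges. -/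
def GraphSpec (P : QuiverPresentation k A V E) (nV nE : ℕ) (ends : Fin nE → ℕ × ℕ) : Prop :=
  ∃ (v : Fin nV ≃ V) (ar : Fin nE ≃ E), ∀ i : Fin nE, ∃ a b : Fin nV,
    (a : ℕ) = (ends i).1 ∧ (b : ℕ) = (ends i).2 ∧
    ((P.src (ar i) = v a ∧ P.tgt (ar i) = v b) ∨ (P.src (ar i) = v b ∧ P.tgt (ar i) = v a))

/-- The directed quiver is given by the arrow specification `ends`. -/
def DirGraphSpec (P : QuiverPresentation k A V E) (nV nE : ℕ) (ends : Fin nE → ℕ × ℕ) : Prop :=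
  ∃ (v : Fin nV ≃ V) (ar : Fin nE ≃ E), ∀ i : Fin nE, ∃ a b : Fin nV,
    (a : ℕ) = (ends i).1 ∧ (b : ℕ) = (ends i).2 ∧
    P.src (ar i) = v a ∧ P.tgt (ar i) = v b

/-- The underlying graph of the full subquiver on vertices `S` and arrows `T`. -/
def SubGraphSpec (P : QuiverPresentation k A V E) (S : Set V) (T : Set E)
    (nV nE : ℕ) (ends : Fin nE → ℕ × ℕ) : Prop :=
  ∃ (v : Fin nV ≃ S) (ar : Fin nE ≃ T), ∀ i : Fin nE, ∃ a b : Fin nV,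
    (a : ℕ) = (ends i).1 ∧ (b : ℕ) = (ends i).2 ∧
    ((P.src (ar i) = v a ∧ P.tgt (ar i) = v b) ∨ (P.src (ar i) = v b ∧ P.tgt (ar i) = v a))

end QuiverPresentation

/-- Edge endpoints of the Dynkin graph `A_n`. -/
def typeAEnds (n : ℕ) : Fin (n - 1) → ℕ × ℕ := fun i => ((i : ℕ), (i : ℕ) + 1)

/-- Edge endpoints of the Dynkin graph `D_n`. -/
def typeDEnds (n : ℕ) : Fin (n - 1) → ℕ × ℕ := fun i =>
  if (i : ℕ) = 0 then (0, 2) else if (i : ℕ) = 1 then (1, 2) else ((i : ℕ), (i : ℕ) + 1)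

/-- Edge endpoints of the Dynkin graph `E_m` for `m = 6, 7, 8`. -/
def typeEEnds (m : ℕ) : Fin (m - 1) → ℕ × ℕ := fun i =>
  if (i : ℕ) = m - 2 then (2, m - 1) else ((i : ℕ), (i : ℕ) + 1)

/-! ## The module category, its radical and the nilpotency index -/

section ModuleSide

variable (A : Type) [Ring A]

/-- An indecomposable module: non-zero, with no non-trivial idempotent endomorphism. -/
def Indec (M : ModuleCat.{0} A) : Prop :=
  Nontrivial M ∧ ∀ f : M ⟶ M, f ≫ f = f → f = 0 ∨ f = 𝟙 M

/-- A finitely generated indecomposable module. -/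
def FinIndec (M : ModuleCat.{0} A) : Prop := Module.Finite A M ∧ Indec A M

/-- `A` is representation-finite: finitely many finitely generated indecomposables
up to isomorphism. -/
def RepFinite : Prop :=
  ∃ (n : ℕ) (T : Fin n → ModuleCat.{0} A),
    ∀ M : ModuleCat.{0} A, FinIndec A M → ∃ i, Nonempty (M ≅ T i)

/-- `A` is (left) hereditary. -/
def Hereditary : Prop := ∀ I : Submodule A A, Module.Projective A I

/-- An irreducible morphism: it does not split, and in any factorization one of
the factors splits. -/
def IrredMor {X Y : ModuleCat.{0} A} (f : X ⟶ Y) : Prop :=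
  (¬ ∃ g : Y ⟶ X, f ≫ g = 𝟙 X) ∧ (¬ ∃ g : Y ⟶ X, g ≫ f = 𝟙 Y) ∧
  ∀ (Z : ModuleCat.{0} A), Module.Finite A Z → ∀ (u : X ⟶ Z) (v : Z ⟶ Y), f = u ≫ v →
    (∃ r : Z ⟶ X, u ≫ r = 𝟙 X) ∨ (∃ s : Y ⟶ Z, s ≫ v = 𝟙 Y)

/-- The radical of `Hom(X, Y)`. -/
def radSet (X Y : ModuleCat.{0} A) : Set (X ⟶ Y) :=
  {f | ∀ M : ModuleCat.{0} A, FinIndec A M →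
    ∀ (h : M ⟶ X) (h' : Y ⟶ M), ¬ IsIso (h ≫ f ≫ h')}

/-- Compositions of `n` radical morphisms. -/
def radPowSet : ℕ → ∀ (X Y : ModuleCat.{0} A), Set (X ⟶ Y)
  | 0, _, _ => Set.univ
  | n + 1, X, Y => {f | ∃ (M : ModuleCat.{0} A) (g : X ⟶ M) (h : M ⟶ Y),
      Module.Finite A M ∧ g ∈ radSet A X M ∧ h ∈ radPowSet n M Y ∧ f = g ≫ h}

/-- The `n`-th power of the radical of `mod A` vanishes. -/
def RadVanishes (n : ℕ) : Prop :=
  ∀ X Y : ModuleCat.{0} A, Module.Finite A X → Module.Finite A Y →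
    ∀ f ∈ radPowSet A n X Y, f = 0

/-- `m` is the nilpotency index of the radical of `mod A`. -/
def NilpotencyIndex (m : ℕ) : Prop :=
  1 ≤ m ∧ RadVanishes A m ∧ ∀ l : ℕ, RadVanishes A l → m ≤ l

/-- A path of irreducible morphisms between (f.g.) indecomposable modules,
together with its composite morphism and its length. -/
inductive IrrPath : ∀ (M N : ModuleCat.{0} A), (M ⟶ N) → ℕ → Prop
  | nil (M : ModuleCat.{0} A) : FinIndec A M → IrrPath M M (𝟙 M) 0
  | cons {M X N : ModuleCat.{0} A} (f : M ⟶ X) (g : X ⟶ N) (n : ℕ) :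
      FinIndec A M → IrredMor A f → IrrPath X N g n → IrrPath M N (f ≫ g) (n + 1)

/-- The Auslander–Reiten quiver of `A` is a component with length : parallel paths
of irreducible morphisms have the same length. -/
def WithLength : Prop :=
  ∀ (M N : ModuleCat.{0} A) (n m : ℕ),
    (∃ f : M ⟶ N, IrrPath A M N f n) → (∃ g : M ⟶ N, IrrPath A M N g m) → n = m

/-- `N` is a successor of `M` (a path of non-zero morphisms between f.g.
indecomposables from `M` to `N`). -/
inductive Reach : ModuleCat.{0} A → ModuleCat.{0} A → Prop
  | refl (M : ModuleCat.{0} A) : FinIndec A M → Reach M M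
  | cons {M X N : ModuleCat.{0} A} : FinIndec A M → FinIndec A X →
      (∃ f : M ⟶ X, f ≠ 0) → Reach X N → Reach M N

/-- `N` is a direct summand of `M`. -/
def IsSummand (N M : ModuleCat.{0} A) : Prop :=
  ∃ (i : N ⟶ M) (p : M ⟶ N), i ≫ p = 𝟙 N

/-- The radical of a module (intersection of the maximal submodules). -/
def radOf (M : ModuleCat.{0} A) : Submodule A M := sInf {N | IsCoatom N}

/-- The socle of a module (sum of the simple submodules). -/
def socOf (M : ModuleCat.{0} A) : Submodule A M := sSup {N | IsAtom N}

/-- `0 → X → E → Y → 0` is an almost split (Auslander–Reiten) sequence. -/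
def IsAlmostSplit {X E Y : ModuleCat.{0} A} (f : X ⟶ E) (g : E ⟶ Y) : Prop :=
  FinIndec A X ∧ FinIndec A Y ∧ Module.Finite A E ∧
  Function.Injective f ∧ Function.Surjective g ∧
  (∀ x : X, g (f x) = 0) ∧ (∀ e : E, g e = 0 → ∃ x : X, f x = e) ∧
  (¬ ∃ s : Y ⟶ E, s ≫ g = 𝟙 Y) ∧
  (∀ (M : ModuleCat.{0} A) (h : X ⟶ M), (¬ ∃ r : M ⟶ X, h ≫ r = 𝟙 X) →
    ∃ t : E ⟶ M, f ≫ t = h) ∧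
  (∀ (M : ModuleCat.{0} A) (h : M ⟶ Y), (¬ ∃ s : Y ⟶ M, s ≫ h = 𝟙 Y) →
    ∃ t : M ⟶ E, t ≫ g = h)

/-- `X = τ Y` : there is an almost split sequence `0 → X → E → Y → 0`. -/
def IsTauOf (X Y : ModuleCat.{0} A) : Prop :=
  ∃ (E : ModuleCat.{0} A) (f : X ⟶ E) (g : E ⟶ Y), IsAlmostSplit A f g

/-- A sectional path of irreducible morphisms of length `n` from `M` to `N`. -/
def SectionalPath (M N : ModuleCat.{0} A) (n : ℕ) : Prop :=
  ∃ Y : Fin (n + 1) → ModuleCat.{0} A,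
    Y 0 = M ∧ Y (Fin.last n) = N ∧ (∀ i, FinIndec A (Y i)) ∧
    (∀ i : Fin n, ∃ f : Y i.castSucc ⟶ Y i.succ, IrredMor A f) ∧
    ∀ (i : ℕ) (h : i + 2 ≤ n),
      ¬ IsTauOf A (Y ⟨i, by omega⟩) (Y ⟨i + 2, by omega⟩)

end ModuleSide

/-! ## Modules attached to vertices -/

section Vertices

variable {k A V E : Type} [Field k] [Ring A] [Algebra k A] [Fintype V] [Fintype E]

/-- `S` is the simple module at the vertex `a`. -/
def IsSimpleAt (P : QuiverPresentation k A V E) (a : V) (S : ModuleCat.{0} A) : Prop :=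
  IsSimpleModule A S ∧ ∃ x : S, P.idem a • x ≠ 0

/-- `Pm` is the indecomposable projective at the vertex `a`. -/
def IsProjAt (P : QuiverPresentation k A V E) (a : V) (Pm : ModuleCat.{0} A) : Prop :=
  Module.Projective A Pm ∧ FinIndec A Pm ∧
  ∃ (S : ModuleCat.{0} A) (f : Pm ⟶ S), IsSimpleAt P a S ∧ Function.Surjective f

/-- `Im` is the indecomposable injective at the vertex `a`. -/
def IsInjAt (P : QuiverPresentation k A V E) (a : V) (Im : ModuleCat.{0} A) : Prop :=
  Module.Injective A Im ∧ FinIndec A Im ∧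
  ∃ (S : ModuleCat.{0} A) (f : S ⟶ Im), IsSimpleAt P a S ∧ Function.Injective f

/-- `RVal P a n` : `n` is the length of a non-zero path of irreducible morphisms
between indecomposable modules from `P_a` to `I_a` going through `S_a`. -/
def RVal (P : QuiverPresentation k A V E) (a : V) (n : ℕ) : Prop :=
  ∃ (Pm S Im : ModuleCat.{0} A) (f : Pm ⟶ S) (g : S ⟶ Im) (n₁ n₂ : ℕ),
    IsProjAt P a Pm ∧ IsSimpleAt P a S ∧ IsInjAt P a Im ∧
    IrrPath A Pm S f n₁ ∧ IrrPath A S Im g n₂ ∧ f ≫ g ≠ 0 ∧ n = n₁ + n₂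

end Vertices

/-! ## Fitting's lemma and local endomorphism rings -/

section Fitting

variable {A : Type} [Ring A]

theorem FinIndec.eq_bot_or_eq_top {M : ModuleCat.{0} A} (hM : FinIndec A M)
    {p q : Submodule A M} (h : IsCompl p q) : p = ⊤ ∨ p = ⊥ := by
  have hid := hM.2.2 (ModuleCat.ofHom (p.projection q h)) (by
    ext x
    simp)
  rcases hid with h0 | h1
  · right
    rw [eq_bot_iff]
    intro x hx
    have := congrArg (fun f : M ⟶ M => f.hom x) h0
    simpa [Submodule.projection_apply_of_mem_left h hx] using this
  · left
    rw [eq_top_iff]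
    intro x _
    have := congrArg (fun f : M ⟶ M => f.hom x) h1
    simp at this
    exact this

theorem FinIndec.bijective_or_nilpotent [IsArtinianRing A] {M : ModuleCat.{0} A}
    (hM : FinIndec A M) (f : M →ₗ[A] M) : Function.Bijective f ∨ IsNilpotent f := by
  have := hM.1
  obtain ⟨n, hn⟩ := (LinearMap.eventually_isCompl_ker_pow_range_pow f).exists_forall_of_atTop
  have hc := hn (n + 1) (by omega)
  rcases hM.eq_bot_or_eq_top hc with h | h
  · right
    exact ⟨n + 1, LinearMap.ker_eq_top.1 h⟩
  · left
    have hinj : Function.Injective f := by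
      have : Function.Injective (f ^ (n + 1)) := LinearMap.ker_eq_bot.1 h
      rw [pow_succ] at this
      exact Function.Injective.of_comp (f := f ^ n) this
    exact IsArtinian.bijective_of_injective_endomorphism f hinj

theorem isIso_of_bijective {M N : ModuleCat.{0} A} (f : M ⟶ N)
    (h : Function.Bijective f.hom) : IsIso f :=
  (ConcreteCategory.isIso_iff_bijective f).2 h

theorem bijective_of_isIso {M N : ModuleCat.{0} A} (f : M ⟶ N) [IsIso f] :
    Function.Bijective f.hom :=
  (ConcreteCategory.isIso_iff_bijective f).1 inferInstance

theorem FinIndec.isIso_or_isIso_sub [IsArtinianRing A] {M : ModuleCat.{0} A}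
    (hM : FinIndec A M) (f : M ⟶ M) : IsIso f ∨ IsIso (𝟙 M - f) := by
  rcases hM.bijective_or_nilpotent f.hom with h | h
  · exact Or.inl (isIso_of_bijective f h)
  · right
    apply isIso_of_bijective
    have hu : IsUnit (1 - f.hom : Module.End A M) := h.isUnit_one_sub
    exact (Module.End.isUnit_iff _).1 hu

/-- If a sum of endomorphisms of an indecomposable is invertible, one summand is. -/
theorem FinIndec.isIso_or_of_add [IsArtinianRing A] {M : ModuleCat.{0} A}
    (hM : FinIndec A M) (f g : M ⟶ M) (h : IsIso (f + g)) : IsIso f ∨ IsIso g := by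
  rcases hM.isIso_or_isIso_sub (f ≫ inv (f + g)) with h1 | h1
  · left
    have : f = (f ≫ inv (f + g)) ≫ (f + g) := by
      simp only [Category.assoc, IsIso.inv_hom_id, Category.comp_id]
    rw [this]; infer_instance
  · right
    have : g = (𝟙 M - f ≫ inv (f + g)) ≫ (f + g) := by
      simp only [Preadditive.sub_comp, Category.assoc, IsIso.inv_hom_id, Category.comp_id,
        Category.id_comp, add_sub_cancel_left]
    rw [this]; infer_instance

end Fitting

/-! ## Right almost split maps -/

section AlmostSplit

/-- A right almost split map with finitely generated source. -/
structure RightAlmostSplit {A : Type} [Ring A] {E Y : ModuleCat.{0} A} (e : E ⟶ Y) : Prop where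
  finite : Module.Finite A E
  not_section : ¬ ∃ s : Y ⟶ E, s ≫ e = 𝟙 Y
  lift : ∀ (M : ModuleCat.{0} A) (h : M ⟶ Y), (¬ ∃ s : Y ⟶ M, s ≫ h = 𝟙 Y) →
    ∃ t : M ⟶ E, t ≫ e = h

variable (k A : Type) [Field k] [Ring A] [Algebra k A]

/-- The `k`-dual of the right regular module. -/
def CoregularModule : Type := A →ₗ[k] k

namespace CoregularModule

noncomputable instance : AddCommGroup (CoregularModule k A) :=
  inferInstanceAs (AddCommGroup (A →ₗ[k] k))

noncomputable instance : Module k (CoregularModule k A) :=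
  inferInstanceAs (Module k (A →ₗ[k] k))

instance [FiniteDimensional k A] : FiniteDimensional k (CoregularModule k A) :=
  inferInstanceAs (FiniteDimensional k (A →ₗ[k] k))

variable {k A}

/-- Evaluation of a functional. -/
def eval (ψ : CoregularModule k A) : A →ₗ[k] k := ψ

theorem ext' {ψ φ : CoregularModule k A} (h : ∀ x, ψ.eval x = φ.eval x) : ψ = φ :=
  LinearMap.ext h

noncomputable instance : Module A (CoregularModule k A) where
  smul a ψ := LinearMap.comp ψ.eval (LinearMap.mulRight k a)
  one_smul ψ := ext' fun x => congrArg ψ.eval (mul_one x)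
  mul_smul a b ψ := ext' fun x => congrArg ψ.eval (mul_assoc x a b).symm
  smul_zero _ := rfl
  smul_add _ _ _ := rfl
  add_smul a b ψ := ext' fun x =>
    (congrArg ψ.eval (mul_add x a b)).trans (map_add ψ.eval _ _)
  zero_smul ψ := ext' fun x => (congrArg ψ.eval (mul_zero x)).trans (map_zero ψ.eval)

@[simp] theorem eval_smul (a : A) (ψ : CoregularModule k A) (x : A) :
    (a • ψ).eval x = ψ.eval (x * a) := rfl

@[simp] theorem eval_add (ψ φ : CoregularModule k A) (x : A) :
    (ψ + φ).eval x = ψ.eval x + φ.eval x := rfl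

@[simp] theorem eval_zero (x : A) : (0 : CoregularModule k A).eval x = 0 := rfl

instance : IsScalarTower k A (CoregularModule k A) where
  smul_assoc c a ψ := ext' fun x => by
    change ψ.eval (x * c • a) = c • ψ.eval (x * a)
    rw [mul_smul_comm, map_smul]

end CoregularModule

variable {k A}

/-- The middle term of an almost split sequence ending at `Y`, built from a presentation
`r` of `Y` on generators `y` and a functional `l` detecting automorphisms. -/
noncomputable def almostSplitMiddle {Y : Type} [AddCommGroup Y] [Module k Y] [Module A Y]
    {n m : ℕ} (l : (Fin n → Y) →ₗ[k] k) (r : Fin m → Fin n → A) :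
    Submodule A (Y × (Fin m → CoregularModule k A)) where
  carrier := {p | ∀ (i : Fin n) (x : A),
    l (Pi.single i (x • p.1)) = ∑ j, (p.2 j).eval (r j i * x)}
  add_mem' {p q} hp hq i x := by
    simp only [Prod.fst_add, smul_add, Pi.single_add, map_add, Prod.snd_add, Pi.add_apply,
      CoregularModule.eval_add, Finset.sum_add_distrib, hp i x, hq i x]
  zero_mem' i x := by simp
  smul_mem' a p hp i x := by
    have := hp i (x * a)
    simpa [mul_smul, mul_assoc] using this

theorem almostSplitMiddle_no_section {Y : Type} [AddCommGroup Y] [Module k Y] [Module A Y]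
    {n m : ℕ} (l : (Fin n → Y) →ₗ[k] k) (r : Fin m → Fin n → A) (y : Fin n → Y)
    (hr : ∀ j, ∑ i, r j i • y i = 0) (s : Y →ₗ[A] almostSplitMiddle l r)
    (hs : ∀ x, (s x).1.1 = x) : l y = 0 := by
  have h1 : ∀ i, l (Pi.single i (y i)) = ∑ j, ((r j i • (s (y i)).1).2 j).eval 1 := by
    intro i
    have := (s (y i)).2 i 1
    rw [one_smul, hs] at this
    rw [this]
    simp
  have h2 : y = ∑ i, Pi.single i (y i) := (Finset.univ_sum_single y).symm
  rw [h2, map_sum]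
  simp only [h1]
  rw [Finset.sum_comm]
  refine Finset.sum_eq_zero fun j _ => ?_
  have h3 : ∑ i, (r j i • (s (y i)).1) = 0 := by
    have : s (∑ i, r j i • y i) = 0 := by rw [hr j, map_zero]
    simp only [map_sum, map_smul] at this
    simpa using congrArg Subtype.val this
  have h4 : ∑ i, (r j i • (s (y i)).1).2 j = 0 := by
    have := congrArg (fun p : Y × (Fin m → CoregularModule k A) => p.2 j) h3
    simpa [Prod.snd_sum] using this
  let ev : CoregularModule k A →+ k :=
    ⟨⟨fun ψ => ψ.eval 1, CoregularModule.eval_zero 1⟩, fun ψ φ => CoregularModule.eval_add ψ φ 1⟩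
  have := congrArg ev h4
  rw [map_sum, map_zero] at this
  exact this

theorem almostSplitMiddle_lift {Y M : Type} [AddCommGroup Y] [Module k Y] [Module A Y]
    [AddCommGroup M] [Module k M] [Module A M] [IsScalarTower k A M] [IsScalarTower k A Y]
    {n m : ℕ} (l : (Fin n → Y) →ₗ[k] k) (r : Fin m → Fin n → A) (y : Fin n → Y)
    (hr : ∀ (z : Fin n → M), (∀ j, ∑ i, r j i • z i = 0) → ∃ φ : Y →ₗ[A] M, ∀ i, φ (y i) = z i)
    (h : M →ₗ[A] Y) (hl : ∀ φ : Y →ₗ[A] M, l (fun i => h (φ (y i))) = 0) :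
    ∃ t : M →ₗ[A] almostSplitMiddle l r, ∀ x, (t x).1.1 = h x := by
  let d : (Fin n → M) →ₗ[k] (Fin m → M) :=
    { toFun := fun z j => ∑ i, r j i • z i
      map_add' := fun z w => by
        ext j
        simp [smul_add, Finset.sum_add_distrib]
      map_smul' := fun c z => by
        ext j
        simp [Finset.smul_sum, smul_algebra_smul_comm] }
  let L : (Fin n → M) →ₗ[k] k :=
    l ∘ₗ (LinearMap.pi fun i => (h.restrictScalars k) ∘ₗ LinearMap.proj i)
  have hL : LinearMap.ker d ≤ LinearMap.ker L := by
    intro z hz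
    obtain ⟨φ, hφ⟩ := hr z (fun j => congrFun (LinearMap.mem_ker.1 hz) j)
    have := hl φ
    rw [LinearMap.mem_ker, ← this]
    change l (fun i => h (z i)) = _
    simp only [hφ]
  obtain ⟨μ, hμ⟩ : ∃ μ : (Fin m → M) →ₗ[k] k, μ ∘ₗ d = L := by
    have := (LinearMap.range_dualMap_eq_dualAnnihilator_ker d)
    have hmem : L ∈ LinearMap.range d.dualMap := by
      rw [this, Submodule.mem_dualAnnihilator]
      exact fun w hw => hL hw
    obtain ⟨μ, hμ⟩ := hmem
    exact ⟨μ, hμ⟩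
  let ψ : M → Fin m → CoregularModule k A := fun x j =>
    (μ ∘ₗ LinearMap.single k (fun _ => M) j ∘ₗ (LinearMap.toSpanSingleton A M x).restrictScalars k
      : A →ₗ[k] k)
  have hψ : ∀ x j z, (ψ x j).eval z = μ (Pi.single j (z • x)) := fun x j z => rfl
  refine ⟨LinearMap.codRestrict _
    { toFun := fun x => (h x, ψ x)
      map_add' := fun x x' => by
        ext1
        · simp
        · funext j
          refine CoregularModule.ext' fun z => ?_
          simp [hψ, Pi.single_add]
      map_smul' := fun c x => by
        ext1
        · simp
        · funext j
          refine CoregularModule.ext' fun z => ?_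
          simp [hψ, mul_smul] } ?_, fun x => rfl⟩
  intro x i z
  have := LinearMap.congr_fun hμ (Pi.single i (z • x))
  have e1 : L (Pi.single i (z • x)) = l (Pi.single i (z • h x)) := by
    change l (fun i' => h (Pi.single (M := fun _ => M) i (z • x) i')) = _
    congr 1
    funext i'
    rcases eq_or_ne i' i with rfl | hne
    · simp
    · simp [hne]
  change l (Pi.single i (z • h x)) = ∑ j, μ (Pi.single j ((r j i * z) • x))
  rw [← e1, ← this, ← map_sum]
  change μ (d _) = _
  congr 1
  rw [Finset.univ_sum_single (fun j => (r j i * z) • x)]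
  funext j
  change ∑ i', r j i' • Pi.single (M := fun _ => M) i (z • x) i' = _
  rw [Finset.sum_eq_single i]
  · simp [mul_smul]
  · intro i' _ hne
    simp [hne]
  · simp

end AlmostSplit

section AlmostSplit

open scoped ModuleCat in
theorem FinIndec.exists_rightAlmostSplit (k : Type) {A : Type} [Field k] [Ring A] [Algebra k A]
    [FiniteDimensional k A] {Y : ModuleCat.{0} A} (hY : FinIndec A Y) :
    ∃ (E : ModuleCat.{0} A) (e : E ⟶ Y), RightAlmostSplit e := by
  have : IsArtinianRing A := IsArtinianRing.of_finite k A
  have := hY.1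
  let : Module k Y := ModuleCat.moduleOfAlgebraModule Y
  have : IsScalarTower k A Y := ModuleCat.isScalarTower_of_algebra_moduleCat Y
  obtain ⟨n, f, hf⟩ := Module.Finite.exists_fin' A Y
  obtain ⟨m, r, hr⟩ := Submodule.fg_iff_exists_fin_generating_family.1
    (IsNoetherian.noetherian (LinearMap.ker f))
  have hfy : ∀ x : Fin n → A, f x = ∑ i, x i • f (Pi.single i 1) := by
    intro x
    conv_lhs => rw [← Finset.univ_sum_single x, map_sum]
    refine Finset.sum_congr rfl fun i _ => ?_
    rw [← map_smul, ← Pi.single_smul, smul_eq_mul, mul_one]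
  set y : Fin n → Y := fun i => f (Pi.single i 1) with hy
  have hext : ∀ φ ψ : Y →ₗ[A] Y, (∀ i, φ (y i) = ψ (y i)) → φ = ψ := by
    intro φ ψ h
    ext x
    obtain ⟨x, rfl⟩ := hf x
    rw [hfy, map_sum, map_sum]
    exact Finset.sum_congr rfl fun i _ => by rw [map_smul, map_smul]; exact congrArg _ (h i)
  let W : Submodule k (Fin n → Y) :=
    { carrier := {z | ∃ φ : Y →ₗ[A] Y, ¬ Function.Bijective φ ∧ z = fun i => φ (y i)}
      add_mem' := by
        rintro _ _ ⟨φ, hφ, rfl⟩ ⟨ψ, hψ, rfl⟩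
        refine ⟨φ + ψ, fun hb => ?_, rfl⟩
        rcases hY.isIso_or_of_add (ModuleCat.ofHom φ) (ModuleCat.ofHom ψ)
          (isIso_of_bijective _ hb) with h | h
        · exact hφ (bijective_of_isIso (ModuleCat.ofHom φ))
        · exact hψ (bijective_of_isIso (ModuleCat.ofHom ψ))
      zero_mem' := ⟨0, fun hb => by
        have := hY.2.1
        obtain ⟨x, hx⟩ := exists_ne (0 : Y)
        exact hx (hb.1 rfl), rfl⟩
      smul_mem' := by
        rintro c _ ⟨φ, hφ, rfl⟩
        rcases eq_or_ne c 0 with rfl | hc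
        · refine ⟨0, fun hb => ?_, by simp; rfl⟩
          have := hY.2.1
          obtain ⟨x, hx⟩ := exists_ne (0 : Y)
          exact hx (hb.1 rfl)
        · let φ' : Y →ₗ[A] Y :=
            { toFun := fun x => c • φ x
              map_add' := by simp
              map_smul' := fun a x => by simp [smul_algebra_smul_comm] }
          refine ⟨φ', fun hb => hφ ⟨fun u v huv => hb.1 (congrArg (c • ·) huv), fun u => ?_⟩, rfl⟩
          obtain ⟨v, hv⟩ := hb.2 (c • u)
          exact ⟨v, smul_right_injective Y hc hv⟩ }
  have hyW : y ∉ W := by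
    rintro ⟨φ, hφ, h⟩
    refine hφ ?_
    rw [hext φ LinearMap.id fun i => (congrFun h i).symm]
    exact Function.bijective_id
  obtain ⟨l, hl1, hl2⟩ := Submodule.exists_dual_map_eq_bot_of_notMem hyW inferInstance
  have hlW : ∀ w ∈ W, l w = 0 := fun w hw => by
    have : l w ∈ W.map l := ⟨w, hw, rfl⟩
    rwa [hl2, Submodule.mem_bot] at this
  have : Module.Finite k Y := Module.Finite.trans A Y
  refine ⟨ModuleCat.of A (almostSplitMiddle l r),
    ModuleCat.ofHom ((LinearMap.fst A _ _).comp (almostSplitMiddle l r).subtype), ?_, ?_, ?_⟩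
  · have : Module.Finite k (almostSplitMiddle l r) :=
      inferInstanceAs (Module.Finite k ((almostSplitMiddle l r).restrictScalars k))
    exact Module.Finite.of_restrictScalars_finite k A _
  · rintro ⟨s, hs⟩
    refine hl1 (almostSplitMiddle_no_section l r y (fun j => ?_) s.hom fun x => ?_)
    · rw [← hfy]
      have : r j ∈ LinearMap.ker f := hr ▸ Submodule.subset_span ⟨j, rfl⟩
      exact this
    · exact congrArg (fun g : Y ⟶ Y => g.hom x) hs
  · intro M h hh
    let : Module k M := ModuleCat.moduleOfAlgebraModule M
    have : IsScalarTower k A M := ModuleCat.isScalarTower_of_algebra_moduleCat M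
    have h1 : ∀ z : Fin n → M, (∀ j, ∑ i, r j i • z i = 0) →
        ∃ φ : Y →ₗ[A] M, ∀ i, φ (y i) = z i := by
      intro z hz
      let F : (Fin n → A) →ₗ[A] M := Fintype.linearCombination A z
      have hF : LinearMap.ker f ≤ LinearMap.ker F := by
        rw [← hr, Submodule.span_le]
        rintro _ ⟨j, rfl⟩
        exact hz j
      refine ⟨((LinearMap.ker f).liftQ F hF).comp (f.quotKerEquivOfSurjective hf).symm.toLinearMap,
        fun i => ?_⟩
      have : (f.quotKerEquivOfSurjective hf).symm (y i) =
          Submodule.Quotient.mk (Pi.single i 1) := by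
        rw [LinearEquiv.symm_apply_eq]; rfl
      simp [this, F, Fintype.linearCombination_apply, Pi.single_apply]
    have h2 : ∀ φ : Y →ₗ[A] M, l (fun i => h.hom (φ (y i))) = 0 := by
      intro φ
      refine hlW _ ⟨h.hom.comp φ, fun hb => hh ?_, rfl⟩
      have := isIso_of_bijective (ModuleCat.ofHom φ ≫ h) hb
      exact ⟨inv (ModuleCat.ofHom φ ≫ h) ≫ ModuleCat.ofHom φ, by
        rw [Category.assoc, IsIso.inv_hom_id]⟩
    obtain ⟨t, ht⟩ := almostSplitMiddle_lift (M := M) l r y h1 h.hom h2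
    exact ⟨ModuleCat.ofHom t, by ext x; exact ht x⟩

end AlmostSplit

section AlmostSplit

variable {A : Type} [Ring A]

theorem exists_lift_of_mem_range {M X E : ModuleCat.{0} A} (κ : X ⟶ E)
    (hκ : Function.Injective κ) (f : M ⟶ E) (h : ∀ m, ∃ x, κ x = f m) :
    ∃ g : M ⟶ X, g ≫ κ = f := by
  have hr : LinearMap.range f.hom ≤ LinearMap.range κ.hom := by
    rintro _ ⟨m, rfl⟩
    exact h m
  let eq := LinearEquiv.ofInjective κ.hom hκ
  refine ⟨ModuleCat.ofHom (eq.symm.toLinearMap.comp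
    (f.hom.codRestrict (LinearMap.range κ.hom) fun m => h m)), ?_⟩
  ext m
  have := eq.apply_symm_apply (f.hom.codRestrict (LinearMap.range κ.hom) (fun m => h m) m)
  exact congrArg Subtype.val this

theorem exists_desc_of_ker {E Y M : ModuleCat.{0} A} (e : E ⟶ Y)
    (he : Function.Surjective e) (f : E ⟶ M) (h : ∀ x, e x = 0 → f x = 0) :
    ∃ g : Y ⟶ M, e ≫ g = f := by
  refine ⟨ModuleCat.ofHom (((LinearMap.ker e.hom).liftQ f.hom fun x hx => h x hx).comp
    (e.hom.quotKerEquivOfSurjective he).symm.toLinearMap), ?_⟩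
  ext x
  have : (e.hom.quotKerEquivOfSurjective he).symm (e.hom x) = Submodule.Quotient.mk x := by
    rw [LinearEquiv.symm_apply_eq]; rfl
  change (LinearMap.ker e.hom).liftQ f.hom (fun x hx => h x hx)
    ((e.hom.quotKerEquivOfSurjective he).symm (e.hom x)) = _
  rw [this]
  rfl

/-- A split monomorphism onto the kernel of an epimorphism forces the latter to split. -/
theorem exists_section_of_retraction {X E Y : ModuleCat.{0} A} (κ : X ⟶ E) (e : E ⟶ Y)
    (he : Function.Surjective e) (hex : ∀ x, e x = 0 → ∃ z, κ z = x) (hκe : κ ≫ e = 0)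
    (r : E ⟶ X) (hr : κ ≫ r = 𝟙 X) : ∃ s : Y ⟶ E, s ≫ e = 𝟙 Y := by
  obtain ⟨s, hs⟩ := exists_desc_of_ker e he (𝟙 E - r ≫ κ) fun x hx => by
    obtain ⟨z, rfl⟩ := hex x hx
    have : κ ≫ (𝟙 E - r ≫ κ) = 0 := by
      rw [Preadditive.comp_sub, Category.comp_id, reassoc_of% hr, sub_self]
    exact congrArg (fun g : X ⟶ E => g z) this
  have : Epi e := (ModuleCat.epi_iff_surjective e).2 he
  refine ⟨s, ?_⟩
  rw [← cancel_epi e, reassoc_of% hs, Preadditive.sub_comp, Category.assoc, hκe]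
  simp

theorem RightAlmostSplit.restrict [IsNoetherianRing A] {E Y E' : ModuleCat.{0} A} {e : E ⟶ Y}
    (he : RightAlmostSplit e) (c : E ⟶ E') [Module.Finite A E'] (e' : E' ⟶ Y) (h : c ≫ e' = e)
    (h' : ¬ ∃ s : Y ⟶ E', s ≫ e' = 𝟙 Y) : RightAlmostSplit e' :=
  ⟨inferInstance, h', fun M g hg => by
    obtain ⟨t, rfl⟩ := he.lift M g hg
    exact ⟨t ≫ c, by rw [Category.assoc, h]⟩⟩

theorem RightAlmostSplit.exists_minimal [IsArtinianRing A] {E₀ Y : ModuleCat.{0} A} {e₀ : E₀ ⟶ Y}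
    (he₀ : RightAlmostSplit e₀) : ∃ (E : ModuleCat.{0} A) (e : E ⟶ Y), RightAlmostSplit e ∧
      ∀ c : E ⟶ E, c ≫ e = e → IsIso c := by
  have := he₀.finite
  let S : Set (Submodule A E₀) := {N | RightAlmostSplit (ModuleCat.ofHom (e₀.hom.comp N.subtype))}
  have hS : S.Nonempty := by
    refine ⟨⊤, ?_⟩
    refine he₀.restrict (ModuleCat.ofHom Submodule.topEquiv.symm.toLinearMap) _ (by ext; rfl) ?_
    rintro ⟨s, hs⟩
    exact he₀.not_section ⟨s ≫ ModuleCat.ofHom (Submodule.subtype _), by rw [← hs]; ext; rfl⟩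
  obtain ⟨N, hN, hmin⟩ := IsArtinian.set_has_minimal S hS
  refine ⟨_, _, hN, fun c hc => ?_⟩
  have hcx : ∀ x : N, e₀.hom (c x).1 = e₀.hom x.1 := fun x =>
    congrArg (fun g : ModuleCat.of A N ⟶ Y => g x) hc
  have hle : (LinearMap.range c.hom).map N.subtype ∈ S := by
    set N' := (LinearMap.range c.hom).map N.subtype
    let c' : ModuleCat.of A N ⟶ ModuleCat.of A N' :=
      ModuleCat.ofHom (LinearMap.codRestrict N' (N.subtype.comp c.hom)
        fun x => ⟨c x, ⟨x, rfl⟩, rfl⟩)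
    refine hN.restrict c' _ ?_ ?_
    · ext x
      exact hcx x
    · rintro ⟨s, hs⟩
      have hle : N' ≤ N := Submodule.map_subtype_le N _
      exact hN.not_section ⟨s ≫ ModuleCat.ofHom (Submodule.inclusion hle), by rw [← hs]; ext; rfl⟩
  have hsurj : Function.Surjective c := by
    have h1 : ¬ (LinearMap.range c.hom).map N.subtype < N := hmin _ hle
    have h2 : (LinearMap.range c.hom).map N.subtype = N :=
      (Submodule.map_subtype_le N _).eq_of_not_lt h1
    intro x
    have hx : x.1 ∈ (LinearMap.range c.hom).map N.subtype := h2.symm ▸ x.2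
    obtain ⟨_, ⟨z, rfl⟩, hz⟩ := hx
    exact ⟨z, Subtype.ext hz⟩
  refine isIso_of_bijective c (IsNoetherian.bijective_of_surjective_endomorphism c.hom hsurj)

/-- A map out of the kernel of a right minimal almost split epimorphism extends to
the middle term, unless it is a split monomorphism. -/
theorem RightAlmostSplit.extend [IsArtinianRing A] {E Y X : ModuleCat.{0} A} {e : E ⟶ Y}
    (he : RightAlmostSplit e) (hmin : ∀ c : E ⟶ E, c ≫ e = e → IsIso c)
    (κ : X ⟶ E) (hκ : Function.Injective κ) (hκe : κ ≫ e = 0)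
    (hex : ∀ x, e x = 0 → ∃ z, κ z = x) (M : ModuleCat.{0} A) (h : X ⟶ M) :
    (∃ t : E ⟶ M, κ ≫ t = h) ∨ ∃ r : M ⟶ X, h ≫ r = 𝟙 X := by
  have := he.finite
  have : Module.Finite A X := Module.Finite.of_injective κ.hom hκ
  let N : Submodule A (M × E) := LinearMap.range (h.hom.prod (-κ.hom))
  let E' := ModuleCat.of A ((M × E) ⧸ N)
  let i : M ⟶ E' := ModuleCat.ofHom (N.mkQ.comp (LinearMap.inl A M E))
  let j : E ⟶ E' := ModuleCat.ofHom (N.mkQ.comp (LinearMap.inr A M E))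
  have hκz : ∀ z, e.hom (κ.hom z) = 0 := fun z => congrArg (fun g : X ⟶ Y => g z) hκe
  let g' : E' ⟶ Y := ModuleCat.ofHom (N.liftQ (e.hom.comp (LinearMap.snd A M E)) (by
    rintro _ ⟨z, rfl⟩
    simp [hκz]))
  have hig : i ≫ g' = 0 := by
    ext m
    change e.hom 0 = 0
    simp
  have hjg : j ≫ g' = e := by
    ext x
    rfl
  have hij : κ ≫ j = h ≫ i := by
    ext z
    change N.mkQ (0, κ z) = N.mkQ (h z, 0)
    rw [← sub_eq_zero, ← map_sub, Submodule.mkQ_apply, Submodule.Quotient.mk_eq_zero]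
    exact ⟨-z, by simp⟩
  have hiinj : Function.Injective i := by
    rw [injective_iff_map_eq_zero]
    intro m hm
    have : ((m, 0) : M × E) ∈ N := (Submodule.Quotient.mk_eq_zero N).1 hm
    obtain ⟨z, hz⟩ := this
    have h1 : h.hom z = m := congrArg Prod.fst hz
    have h2 : -κ.hom z = 0 := congrArg Prod.snd hz
    have : z = 0 := hκ (by rw [map_zero]; exact neg_eq_zero.1 h2)
    rw [← h1, this, map_zero]
  have hker : ∀ w, g' w = 0 → ∃ m, i m = w := by
    intro w hw
    obtain ⟨⟨m, x⟩, rfl⟩ := N.mkQ_surjective w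
    obtain ⟨z, rfl⟩ := hex x hw
    refine ⟨m + h z, ?_⟩
    change N.mkQ (m + h z, 0) = N.mkQ (m, κ z)
    rw [← sub_eq_zero, ← map_sub, Submodule.mkQ_apply, Submodule.Quotient.mk_eq_zero]
    exact ⟨z, by simp⟩
  by_cases hs : ∃ s : Y ⟶ E', s ≫ g' = 𝟙 Y
  · left
    obtain ⟨s, hs⟩ := hs
    obtain ⟨r, hr⟩ := exists_lift_of_mem_range i hiinj (𝟙 E' - g' ≫ s) fun w => hker _ (by
      have : (𝟙 E' - g' ≫ s) ≫ g' = 0 := by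
        rw [Preadditive.sub_comp, Category.assoc, hs]; simp
      exact congrArg (fun g : E' ⟶ Y => g w) this)
    have hir : i ≫ r = 𝟙 M := by
      have : Mono i := (ModuleCat.mono_iff_injective i).2 hiinj
      rw [← cancel_mono i, Category.assoc, hr, Preadditive.comp_sub, reassoc_of% hig]
      simp
    exact ⟨j ≫ r, by rw [reassoc_of% hij, hir, Category.comp_id]⟩
  · right
    obtain ⟨c', hc'⟩ := he.lift E' g' hs
    have hc := hmin (j ≫ c') (by rw [Category.assoc, hc', hjg])
    obtain ⟨r, hr⟩ := exists_lift_of_mem_range κ hκ (i ≫ c') fun m => hex _ (by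
      have : (i ≫ c') ≫ e = 0 := by rw [Category.assoc, hc', hig]
      exact congrArg (fun g : M ⟶ Y => g m) this)
    have hcomp : (h ≫ r) ≫ κ = κ ≫ (j ≫ c') := by
      rw [Category.assoc, hr, reassoc_of% hij]
    have hinj : Function.Injective (h ≫ r).hom := by
      have h1 : Function.Injective (κ ≫ (j ≫ c')).hom :=
        (bijective_of_isIso (j ≫ c')).1.comp hκ
      rw [← hcomp] at h1
      exact Function.Injective.of_comp (f := κ) h1
    have := isIso_of_bijective _ (IsArtinian.bijective_of_injective_endomorphism _ hinj)
    exact ⟨r ≫ inv (h ≫ r), by rw [← Category.assoc, IsIso.hom_inv_id]⟩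

theorem RightAlmostSplit.isAlmostSplit [IsArtinianRing A] {E Y X : ModuleCat.{0} A} {e : E ⟶ Y}
    (hY : FinIndec A Y) (he : RightAlmostSplit e) (hmin : ∀ c : E ⟶ E, c ≫ e = e → IsIso c)
    (hsurj : Function.Surjective e) (κ : X ⟶ E) (hκ : Function.Injective κ) (hκe : κ ≫ e = 0)
    (hex : ∀ x, e x = 0 → ∃ z, κ z = x) : IsAlmostSplit A κ e := by
  have := he.finite
  have hext := he.extend hmin κ hκ hκe hex
  have hnr : ∀ r : E ⟶ X, κ ≫ r ≠ 𝟙 X := fun r hr =>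
    he.not_section (exists_section_of_retraction κ e hsurj hex hκe r hr)
  have hid : ∀ ε : X ⟶ X, ε ≫ ε = ε → ∀ r, ε ≫ r = 𝟙 X → ε = 𝟙 X := by
    intro ε hε r hr
    have := congrArg (· ≫ r) hε
    simpa [hr] using this
  refine ⟨⟨Module.Finite.of_injective κ.hom hκ, ?_, fun ε hε => ?_⟩, hY, he.finite, hκ, hsurj,
    fun x => congrArg (fun g : X ⟶ Y => g x) hκe, hex, he.not_section, ?_, he.lift⟩
  · by_contra hX
    rw [not_nontrivial_iff_subsingleton] at hX
    exact hnr 0 (by ext x; exact Subsingleton.elim _ _)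
  · rcases hext X ε with ⟨t, ht⟩ | ⟨r, hr⟩
    · rcases hext X (𝟙 X - ε) with ⟨t', ht'⟩ | ⟨r, hr⟩
      · exact absurd (by rw [Preadditive.comp_add, ht, ht']; simp) (hnr (t + t'))
      · left
        have := hid (𝟙 X - ε) (by
          simp [Preadditive.sub_comp, Preadditive.comp_sub, hε]) r hr
        exact sub_eq_self.1 this
    · exact Or.inr (hid ε hε r hr)
  · intro M h hh
    exact (hext M h).resolve_right hh

/-- Over a finite dimensional algebra, every indecomposable `Y` is the target of a right almost
split map which is injective or the end of an almost split sequence. -/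
theorem FinIndec.exists_almostSplit (k : Type) {A : Type} [Field k] [Ring A] [Algebra k A]
    [FiniteDimensional k A] {Y : ModuleCat.{0} A} (hY : FinIndec A Y) :
    ∃ (E : ModuleCat.{0} A) (e : E ⟶ Y), RightAlmostSplit e ∧
      (Function.Injective e ∨ ∃ (X : ModuleCat.{0} A) (κ : X ⟶ E), IsAlmostSplit A κ e) := by
  have : IsArtinianRing A := IsArtinianRing.of_finite k A
  obtain ⟨E₀, e₀, he₀⟩ := hY.exists_rightAlmostSplit k
  obtain ⟨E, e, he, hmin⟩ := he₀.exists_minimal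
  have := he.finite
  by_cases hs : Function.Surjective e
  · exact ⟨E, e, he, Or.inr ⟨_, ModuleCat.ofHom (LinearMap.ker e.hom).subtype,
      he.isAlmostSplit hY hmin hs _ Subtype.val_injective (by ext x; exact x.2)
      fun x hx => ⟨⟨x, hx⟩, rfl⟩⟩⟩
  · refine ⟨ModuleCat.of A (LinearMap.range e.hom),
      ModuleCat.ofHom (LinearMap.range e.hom).subtype,
      he.restrict (ModuleCat.ofHom e.hom.rangeRestrict) _ (by ext; rfl) ?_,
      Or.inl Subtype.val_injective⟩
    rintro ⟨s, hs'⟩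
    refine hs fun y => ?_
    obtain ⟨x, hx⟩ := (s y).2
    exact ⟨x, hx.trans (congrArg (fun g : Y ⟶ Y => g y) hs')⟩

end AlmostSplit

section Sectional

variable {A : Type} [Ring A]

theorem FinIndec.isIso_of_retract {K X : ModuleCat.{0} A} (hK : FinIndec A K) (hX : FinIndec A X)
    (i : K ⟶ X) (p : X ⟶ K) (h : IsIso (i ≫ p)) : IsIso i := by
  have hc : i ≫ p ≫ inv (i ≫ p) = 𝟙 K := by
    rw [← Category.assoc, IsIso.hom_inv_id]
  rcases hX.2.2 (p ≫ inv (i ≫ p) ≫ i) (by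
    have : i ≫ p ≫ inv (i ≫ p) ≫ i = i := by
      have := congrArg (· ≫ i) hc
      simpa only [Category.assoc, Category.id_comp] using this
    simp only [Category.assoc]
    rw [this]) with h0 | h1
  · exfalso
    have h2 : 𝟙 K = 0 := by
      have := congrArg (fun g => i ≫ g ≫ p ≫ inv (i ≫ p)) h0
      simpa only [Category.assoc, Limits.zero_comp, Limits.comp_zero, reassoc_of% hc, hc] using this
    obtain ⟨x, hx⟩ := @exists_ne K hK.2.1 0
    exact hx (congrArg (fun g : K ⟶ K => g x) h2)
  · exact ⟨p ≫ inv (i ≫ p), hc, by simpa only [Category.assoc] using h1⟩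

theorem IsAlmostSplit.not_retraction {X E Y : ModuleCat.{0} A} {κ : X ⟶ E} {e : E ⟶ Y}
    (h : IsAlmostSplit A κ e) (r : E ⟶ X) : κ ≫ r ≠ 𝟙 X := by
  obtain ⟨_, _, _, _, hs, h0, hex, hn, _, _⟩ := h
  exact fun hr => hn (exists_section_of_retraction κ e hs hex (by ext x; exact h0 x) r hr)

theorem IsAlmostSplit.isTauOf_of_iso {X X' E Y : ModuleCat.{0} A} {κ : X ⟶ E} {e : E ⟶ Y}
    (h : IsAlmostSplit A κ e) (hX' : FinIndec A X') (φ : X' ≅ X) : IsTauOf A X' Y := by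
  obtain ⟨_, hY, hE, hi, hs, h0, hex, hn, hl, hr⟩ := h
  refine ⟨E, φ.hom ≫ κ, e, hX', hY, hE, hi.comp (bijective_of_isIso φ.hom).1, hs,
    fun x => h0 (φ.hom x), fun w hw => ?_, hn, fun M h hh => ?_, hr⟩
  · obtain ⟨x, rfl⟩ := hex w hw
    obtain ⟨x', rfl⟩ := (bijective_of_isIso φ.hom).2 x
    exact ⟨x', rfl⟩
  · obtain ⟨t, ht⟩ := hl M (φ.inv ≫ h) (by
      rintro ⟨r, hr⟩
      refine hh ⟨r ≫ φ.inv, ?_⟩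
      rw [← cancel_epi φ.inv, ← cancel_mono φ.hom]
      simpa using hr)
    exact ⟨t, by rw [Category.assoc, ht, Iso.hom_inv_id_assoc]⟩

theorem FinIndec.exists_retraction_killing [IsArtinianRing A] {X K E : ModuleCat.{0} A}
    (hX : FinIndec A X) (hK : FinIndec A K) (hne : IsEmpty (X ≅ K)) (s : X ⟶ E) (ρ₀ : E ⟶ X)
    (hs : s ≫ ρ₀ = 𝟙 X) (s' : K ⟶ E) (ρ' : E ⟶ K) (hs' : s' ≫ ρ' = 𝟙 K) :
    ∃ ρ : E ⟶ X, s ≫ ρ = 𝟙 X ∧ s' ≫ ρ = 0 := by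
  have hiso : IsIso (𝟙 K - (s' ≫ ρ₀) ≫ (s ≫ ρ')) := by
    refine (hK.isIso_or_isIso_sub _).resolve_left fun h => ?_
    have := hK.isIso_of_retract hX _ _ h
    exact hne.false (asIso (s' ≫ ρ₀)).symm
  let ρ'' : E ⟶ K := ρ' - ρ₀ ≫ s ≫ ρ'
  have h1 : s ≫ ρ'' = 0 := by
    simp only [ρ'', Preadditive.comp_sub, reassoc_of% hs, sub_self]
  have h2 : s' ≫ ρ'' = 𝟙 K - (s' ≫ ρ₀) ≫ (s ≫ ρ') := by
    simp only [ρ'', Preadditive.comp_sub, hs', Category.assoc]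
  rw [← h2] at hiso
  refine ⟨ρ₀ - ρ'' ≫ inv (s' ≫ ρ'') ≫ s' ≫ ρ₀, ?_, ?_⟩
  · rw [Preadditive.comp_sub, reassoc_of% h1, hs]
    simp
  · rw [Preadditive.comp_sub, ← Category.assoc s' ρ'', IsIso.hom_inv_id_assoc, sub_self]

/-- Composites of the first maps of a sequence. -/
def composite {Y : ℕ → ModuleCat.{0} A} (f : ∀ i, Y i ⟶ Y (i + 1)) : ∀ i, Y 0 ⟶ Y i
  | 0 => 𝟙 _
  | i + 1 => composite f i ≫ f i

theorem exists_composite_comp {Y : ℕ → ModuleCat.{0} A} (f : ∀ i, Y i ⟶ Y (i + 1))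
    {i j : ℕ} (h : i ≤ j) : ∃ g : Y i ⟶ Y j, composite f i ≫ g = composite f j := by
  induction j, h using Nat.le_induction with
  | base => exact ⟨𝟙 _, Category.comp_id _⟩
  | succ j _ ih =>
    obtain ⟨g, hg⟩ := ih
    exact ⟨g ≫ f j, by rw [← Category.assoc, hg]; rfl⟩

theorem RightAlmostSplit.descend {X Y' Z N : ModuleCat.{0} A} {E : ModuleCat.{0} A}
    {e : E ⟶ Y'} (he : RightAlmostSplit e)
    (hd : Function.Injective e ∨ ∃ (X : ModuleCat.{0} A) (κ : X ⟶ E), IsAlmostSplit A κ e)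
    {W : ModuleCat.{0} A} (s : X ⟶ E) (ρ : E ⟶ X) (hρ : s ≫ ρ = 𝟙 X)
    (c : W ⟶ X) (x : W ⟶ N) (y : N ⟶ E) (hy : y ≫ ρ = 0) (p : W ⟶ Z) (q : Z ⟶ Y')
    (hq : ¬ ∃ r : Y' ⟶ Z, r ≫ q = 𝟙 Y') (h : c ≫ s ≫ e = x ≫ y ≫ e + p ≫ q) :
    (∃ q' : Z ⟶ X, c = p ≫ q') ∨ ∃ (K : ModuleCat.{0} A) (κ : K ⟶ E) (t : W ⟶ K) (q' : Z ⟶ X),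
      IsAlmostSplit A κ e ∧ c = t ≫ κ ≫ ρ + p ≫ q' := by
  obtain ⟨q', rfl⟩ := he.lift Z q hq
  have h0 : (c ≫ s - x ≫ y - p ≫ q') ≫ e = 0 := by
    simp only [Preadditive.sub_comp, Category.assoc, h]
    abel
  have h1 : (c ≫ s - x ≫ y - p ≫ q') ≫ ρ = c - p ≫ q' ≫ ρ := by
    simp only [Preadditive.sub_comp, Category.assoc, hρ, hy, Limits.comp_zero, Category.comp_id,
      sub_zero]
  rcases hd with hinj | ⟨K, κ, hK⟩
  · left
    have : Mono e := (ModuleCat.mono_iff_injective e).2 hinj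
    have h2 : c ≫ s - x ≫ y - p ≫ q' = 0 := by
      rw [← cancel_mono e, h0, Limits.zero_comp]
    rw [h2, Limits.zero_comp] at h1
    exact ⟨q' ≫ ρ, (sub_eq_zero.1 h1.symm)⟩
  · right
    obtain ⟨t, ht⟩ := exists_lift_of_mem_range κ hK.2.2.2.1 (c ≫ s - x ≫ y - p ≫ q') fun w =>
      hK.2.2.2.2.2.2.1 _ (congrArg (fun g : W ⟶ Y' => g w) h0)
    refine ⟨K, κ, t, q' ≫ ρ, hK, ?_⟩
    rw [← ht, Category.assoc] at h1
    rw [h1]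
    abel

/-- The key induction: along a sectional path, composites do not become expressible through
a module `Z` containing none of the modules of the path, even modulo maps that avoid
the path. -/
theorem composite_ne_add (k : Type) [Field k] [Algebra k A] [FiniteDimensional k A]
    {Y : ℕ → ModuleCat.{0} A} (f : ∀ i, Y i ⟶ Y (i + 1)) (n : ℕ)
    (hY : ∀ i ≤ n, FinIndec A (Y i)) (hf : ∀ i < n, IrredMor A (f i))
    (hτ : ∀ i, i + 2 ≤ n → ¬ IsTauOf A (Y i) (Y (i + 2)))
    (Z : ModuleCat.{0} A) (hZ : ∀ i ≤ n, ∀ (s : Y i ⟶ Z) (r : Z ⟶ Y i), s ≫ r ≠ 𝟙 _)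
    (p : Y 0 ⟶ Z) (i : ℕ) (hi : i < n) : ∀ (E : ModuleCat.{0} A) (e : E ⟶ Y (i + 1)),
      RightAlmostSplit e →
      (Function.Injective e ∨ ∃ (X : ModuleCat.{0} A) (κ : X ⟶ E), IsAlmostSplit A κ e) →
      ∀ s : Y i ⟶ E, s ≫ e = f i →
      ∀ (N : ModuleCat.{0} A) (x : Y 0 ⟶ N) (y : N ⟶ E) (ρ : E ⟶ Y i), s ≫ ρ = 𝟙 _ → y ≫ ρ = 0 →
      ∀ q : Z ⟶ Y (i + 1), composite f (i + 1) ≠ x ≫ y ≫ e + p ≫ q := by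
  have : IsArtinianRing A := IsArtinianRing.of_finite k A
  have hnot : ∀ {i : ℕ} (_ : i < n) {E K : ModuleCat.{0} A} {e : E ⟶ Y (i + 1)} {κ : K ⟶ E}
      (_ : IsAlmostSplit A κ e) (ρ : E ⟶ Y i) (σ : Y i ⟶ K), ¬ IsIso (σ ≫ κ ≫ ρ) := by
    intro i hi E K e κ hK ρ σ h
    have h1 := (hY i (by omega)).isIso_of_retract hK.1 σ (κ ≫ ρ) h
    have h2 : IsIso (κ ≫ ρ) := by
      have : κ ≫ ρ = inv σ ≫ (σ ≫ κ ≫ ρ) := by simp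
      rw [this]; infer_instance
    exact hK.not_retraction (ρ ≫ inv (κ ≫ ρ)) (by rw [← Category.assoc, IsIso.hom_inv_id])
  induction i with
  | zero =>
    intro E e he hd s hs N x y ρ hρ hyρ q hq
    have hcomp : composite f (0 + 1) = 𝟙 _ ≫ s ≫ e := by rw [hs]; rfl
    rcases he.descend hd s ρ hρ (𝟙 _) x y hyρ p q (fun ⟨s, hs⟩ => hZ 1 hi s q hs)
      (hcomp ▸ hq) with ⟨q', h⟩ | ⟨K, κ, t, q', hK, h⟩
    · exact hZ 0 (by omega) p q' h.symm
    · have h2 := (hY 0 (by omega)).isIso_or_of_add (t ≫ κ ≫ ρ) (p ≫ q') (h ▸ inferInstance)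
      have h3 := h2.resolve_left (hnot hi hK ρ t)
      exact hZ 0 (by omega) p (q' ≫ inv (p ≫ q')) (by
        rw [← Category.assoc, IsIso.hom_inv_id])
  | succ j ih =>
    intro E e he hd s hs N x y ρ hρ hyρ q hq
    have hcomp : composite f (j + 1 + 1) = composite f (j + 1) ≫ s ≫ e := by rw [hs]; rfl
    obtain ⟨E₁, e₁, he₁, hd₁⟩ := (hY (j + 1) (by omega)).exists_almostSplit k
    obtain ⟨s₁, hs₁⟩ := he₁.lift (Y j) (f j) (hf j (by omega)).2.1
    obtain ⟨ρ₁, hρ₁⟩ := ((hf j (by omega)).2.2 E₁ he₁.finite s₁ e₁ hs₁.symm).resolve_right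
      he₁.not_section
    rcases he.descend hd s ρ hρ (composite f (j + 1)) x y hyρ p q
      (fun ⟨s, hs⟩ => hZ (j + 1 + 1) hi s q hs) (hcomp ▸ hq) with ⟨q', h⟩ | ⟨K, κ, t, q', hK, h⟩
    · exact ih (by omega) E₁ e₁ he₁ hd₁ s₁ hs₁ N 0 0 ρ₁ hρ₁ (by simp) q' (by simpa using h)
    · obtain ⟨s', hs'⟩ := he₁.lift K (κ ≫ ρ) fun ⟨σ, hσ⟩ => hnot hi hK ρ σ (hσ ▸ inferInstance)
      have hsplit : ∃ ρ' : E₁ ⟶ K, s' ≫ ρ' = 𝟙 K := by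
        by_contra hns
        obtain ⟨r, hr⟩ := hK.2.2.2.2.2.2.2.2.1 E₁ s' hns
        obtain ⟨v, hv⟩ := exists_desc_of_ker e hK.2.2.2.2.1 (ρ - r ≫ e₁) fun w hw => by
          obtain ⟨z, rfl⟩ := hK.2.2.2.2.2.2.1 w hw
          have : κ ≫ (ρ - r ≫ e₁) = 0 := by
            rw [Preadditive.comp_sub, ← hs', ← hr, Category.assoc, sub_self]
          exact congrArg (fun g : K ⟶ _ => g z) this
        have h1 : 𝟙 _ = f (j + 1) ≫ v + s ≫ r ≫ e₁ := by
          rw [← hs, Category.assoc, hv, Preadditive.comp_sub, hρ]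
          abel
        rcases (hY (j + 1) (by omega)).isIso_or_of_add (f (j + 1) ≫ v) (s ≫ r ≫ e₁)
          (h1 ▸ inferInstance) with h2 | h2
        · exact (hf (j + 1) hi).1 ⟨v ≫ inv (f (j + 1) ≫ v), by
            rw [← Category.assoc, IsIso.hom_inv_id]⟩
        · exact he₁.not_section ⟨inv (s ≫ r ≫ e₁) ≫ s ≫ r, by
            rw [Category.assoc, Category.assoc, IsIso.inv_hom_id]⟩
      obtain ⟨ρ', hρ'⟩ := hsplit
      have hne : IsEmpty (Y j ≅ K) :=
        ⟨fun φ => hτ j (by omega) (hK.isTauOf_of_iso (hY j (by omega)) φ)⟩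
      obtain ⟨ρ₂, h2, h3⟩ := (hY j (by omega)).exists_retraction_killing hK.1 hne
        s₁ ρ₁ hρ₁ s' ρ' hρ'
      exact ih (by omega) E₁ e₁ he₁ hd₁ s₁ hs₁ K t s' ρ₂ h2 h3 q' (by rw [hs']; exact h)

theorem exists_retract_of_composite_eq (k : Type) [Field k] [Algebra k A] [FiniteDimensional k A]
    {Y : ℕ → ModuleCat.{0} A} (f : ∀ i, Y i ⟶ Y (i + 1)) (n : ℕ)
    (hY : ∀ i ≤ n, FinIndec A (Y i)) (hf : ∀ i < n, IrredMor A (f i))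
    (hτ : ∀ i, i + 2 ≤ n → ¬ IsTauOf A (Y i) (Y (i + 2)))
    (Z : ModuleCat.{0} A) (p : Y 0 ⟶ Z) (q : Z ⟶ Y n) (hpq : p ≫ q = composite f n) :
    ∃ i ≤ n, ∃ (s : Y i ⟶ Z) (r : Z ⟶ Y i), s ≫ r = 𝟙 _ := by
  by_contra! hZ
  rcases n with _ | j
  · exact hZ 0 le_rfl p q hpq
  · obtain ⟨E₁, e₁, he₁, hd₁⟩ := (hY (j + 1) (by omega)).exists_almostSplit k
    obtain ⟨s₁, hs₁⟩ := he₁.lift (Y j) (f j) (hf j (by omega)).2.1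
    obtain ⟨ρ₁, hρ₁⟩ := ((hf j (by omega)).2.2 E₁ he₁.finite s₁ e₁ hs₁.symm).resolve_right
      he₁.not_section
    exact composite_ne_add k f (j + 1) hY hf hτ Z hZ p j (by omega) E₁ e₁ he₁ hd₁ s₁ hs₁ E₁ 0 0 ρ₁
      hρ₁ (by simp) q (by rw [hpq]; simp)

/-- A sectional path has a nonzero composite `f`, and any two modules through which `f` factors
are comparable along `f`. -/
theorem SectionalPath.exists_map (k : Type) [Field k] [Algebra k A] [FiniteDimensional k A]
    {R J : ModuleCat.{0} A} {n : ℕ} (hsec : SectionalPath A R J n) :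
    ∃ f : R ⟶ J, f ≠ 0 ∧ ∀ (Z Z' : ModuleCat.{0} A) (p : R ⟶ Z) (q : Z ⟶ J) (p' : R ⟶ Z')
      (q' : Z' ⟶ J), p ≫ q = f → p' ≫ q' = f →
      (∃ (p : R ⟶ Z) (g : Z ⟶ Z') (q : Z' ⟶ J), p ≫ g ≫ q = f) ∨
      ∃ (p : R ⟶ Z') (g : Z' ⟶ Z) (q : Z ⟶ J), p ≫ g ≫ q = f := by
  obtain ⟨Y₀, rfl, rfl, hY₀, hf₀, hτ₀⟩ := hsec
  let Y : ℕ → ModuleCat.{0} A := fun i => Y₀ ⟨min i n, by omega⟩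
  have hYeq : ∀ (i : ℕ) (h : i < n + 1), Y i = Y₀ ⟨i, h⟩ := fun i h =>
    congrArg Y₀ (Fin.ext (min_eq_left (by omega)))
  have hex : ∀ i, ∃ f : Y i ⟶ Y (i + 1), i < n → IrredMor A f := by
    intro i
    by_cases hi : i < n
    · have h1 := hYeq i (by omega)
      have h2 := hYeq (i + 1) (by omega)
      rw [h1, h2]
      obtain ⟨f, hf⟩ := hf₀ ⟨i, hi⟩
      exact ⟨f, fun _ => hf⟩
    · exact ⟨0, fun h => absurd h hi⟩
  choose f hf using hex
  have hY : ∀ i ≤ n, FinIndec A (Y i) := fun i _ => hY₀ _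
  have hτ : ∀ i, i + 2 ≤ n → ¬ IsTauOf A (Y i) (Y (i + 2)) := by
    intro i hi
    rw [hYeq i (by omega), hYeq (i + 2) (by omega)]
    exact hτ₀ i hi
  have key : ∀ (Z : ModuleCat.{0} A) (p : Y 0 ⟶ Z) (q : Z ⟶ Y n), p ≫ q = composite f n →
    ∃ i ≤ n, ∃ (s : Y i ⟶ Z) (r : Z ⟶ Y i), s ≫ r = 𝟙 _ :=
    exists_retract_of_composite_eq k f n hY hf hτ
  have cmp : ∀ (i j : ℕ) (Z Z' : ModuleCat.{0} A) (s : Y i ⟶ Z) (r : Z ⟶ Y i) (s' : Y j ⟶ Z')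
      (r' : Z' ⟶ Y j), s ≫ r = 𝟙 _ → s' ≫ r' = 𝟙 _ → i ≤ j → j ≤ n →
      ∃ (p : Y 0 ⟶ Z) (g : Z ⟶ Z') (q : Z' ⟶ Y n), p ≫ g ≫ q = composite f n := by
    intro i j Z Z' s r s' r' h h' hij hj
    obtain ⟨g₁, hg₁⟩ := exists_composite_comp f hij
    obtain ⟨g₂, hg₂⟩ := exists_composite_comp f hj
    refine ⟨composite f i ≫ s, r ≫ g₁ ≫ s', r' ≫ g₂, ?_⟩
    simp only [Category.assoc, reassoc_of% h, reassoc_of% h', ← hg₂, ← hg₁]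
  have hY0 : Y 0 = Y₀ 0 := hYeq 0 (by omega)
  have hYn : Y n = Y₀ (Fin.last n) := hYeq n (by omega)
  rw [← hY0, ← hYn]
  refine ⟨composite f n, fun h0 => ?_, fun Z Z' p q p' q' hpq hpq' => ?_⟩
  · obtain ⟨i, hi, s, r, hsr⟩ := key (ModuleCat.of A PUnit) 0 0 (by rw [h0]; simp)
    obtain ⟨x, hx⟩ := @exists_ne (Y i) (hY i hi).2.1 0
    refine hx ?_
    have h1 : x = r (s x) := (congrArg (fun g : Y i ⟶ Y i => g x) hsr).symm
    rw [h1, Subsingleton.elim (s x) 0, map_zero]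
  · obtain ⟨i, hi, s, r, hsr⟩ := key Z p q hpq
    obtain ⟨j, hj, s', r', hsr'⟩ := key Z' p' q' hpq'
    rcases le_total i j with hij | hij
    · exact Or.inl (cmp i j Z Z' s r s' r' hsr hsr' hij hj)
    · exact Or.inr (cmp j i Z' Z s' r' s r hsr' hsr hij hi)

end Sectional

/-! ## Paths and their values -/

namespace QPath

variable {V E : Type} {src tgt : E → V}

/-- The path of length one given by an arrow. -/
def single (src tgt : E → V) (α : E) : QPath src tgt (src α) (tgt α) := .cons (.nil _) α rfl

theorem exists_eq_single_comp {a b : V} (p : QPath src tgt a b) (h : p.length ≠ 0) :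
    ∃ (α : E) (hα : src α = a) (q : QPath src tgt (tgt α) b),
      p = hα ▸ (single src tgt α).comp q := by
  induction p with
  | nil => simp [length] at h
  | cons p β hβ ih =>
    by_cases hp : p.length = 0
    · cases p with
      | nil =>
        subst hβ
        exact ⟨β, rfl, .nil _, by simp only [single, comp]⟩
      | cons => simp [length] at hp
    · obtain ⟨α, hα, q, rfl⟩ := ih hp
      subst hα
      exact ⟨α, rfl, q.cons β hβ, by simp only [comp]⟩

/-- The product, in a ring, of the values of the arrows along a path. -/
def val {R : Type} [Ring R] (ι : V → R) (f : E → R) : ∀ {a b : V}, QPath src tgt a b → R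
  | _, _, .nil a => ι a
  | _, _, .cons p α _ => f α * val ι f p

section Val

variable {R : Type} [Ring R] {ι : V → R} {f : E → R}

theorem val_mul_left (hι : ∀ v, ι v * ι v = ι v) (hf : ∀ α, ι (tgt α) * f α = f α) {a b : V}
    (p : QPath src tgt a b) : ι b * p.val ι f = p.val ι f := by
  cases p with
  | nil => simpa only [val] using hι _
  | cons p α h => rw [val, ← mul_assoc, hf]

theorem val_mul_right (hι : ∀ v, ι v * ι v = ι v) {a b : V}
    (p : QPath src tgt a b) : p.val ι f * ι a = p.val ι f := by
  induction p with
  | nil => simpa only [val] using hι _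
  | cons p α h ih => rw [val, mul_assoc, ih]

theorem val_comp (hι : ∀ v, ι v * ι v = ι v) (hf : ∀ α, ι (tgt α) * f α = f α) {a b c : V}
    (p : QPath src tgt a b) (q : QPath src tgt b c) :
    (p.comp q).val ι f = q.val ι f * p.val ι f := by
  induction q with
  | nil => simpa only [comp, val] using (val_mul_left hι hf p).symm
  | cons q α h ih => simp only [comp, val, ih, mul_assoc]

end Val

end QPath

namespace QuiverPresentation

variable {k A V E : Type} [Field k] [Ring A] [Algebra k A] [Fintype V] [Fintype E]
  (P : QuiverPresentation k A V E)

theorem idem_mul_arrow (α : E) : P.idem (P.tgt α) * P.arrow α = P.arrow α := by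
  conv_lhs => rw [← P.arrow_mem α]
  rw [← mul_assoc, ← mul_assoc, P.idem_idem, P.arrow_mem]

theorem arrow_mul_idem (α : E) : P.arrow α * P.idem (P.src α) = P.arrow α := by
  conv_lhs => rw [← P.arrow_mem α]
  rw [mul_assoc, P.idem_idem, P.arrow_mem]

theorem qprod_eq_val {a b : V} (p : QPath P.src P.tgt a b) :
    P.qprod p = p.val P.idem P.arrow := by
  induction p with
  | nil => rw [qprod, QPath.val]
  | cons p α h ih => rw [qprod, QPath.val, ih]

theorem qprod_comp {a b c : V} (p : QPath P.src P.tgt a b) (q : QPath P.src P.tgt b c) :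
    P.qprod (p.comp q) = P.qprod q * P.qprod p := by
  simp only [qprod_eq_val]
  exact QPath.val_comp P.idem_idem P.idem_mul_arrow p q

theorem idem_mul_qprod {a b : V} (p : QPath P.src P.tgt a b) :
    P.idem b * P.qprod p = P.qprod p := by
  rw [qprod_eq_val]
  exact QPath.val_mul_left P.idem_idem P.idem_mul_arrow p

theorem qprod_mul_idem {a b : V} (p : QPath P.src P.tgt a b) :
    P.qprod p * P.idem a = P.qprod p := by
  rw [qprod_eq_val]
  exact QPath.val_mul_right P.idem_idem p

theorem qprod_single (α : E) : P.qprod (QPath.single P.src P.tgt α) = P.arrow α := by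
  simpa only [QPath.single, qprod] using P.arrow_mul_idem α

theorem qprod_mul_qprod_of_ne {a b c d : V} (p : QPath P.src P.tgt a b)
    (q : QPath P.src P.tgt c d) (h : c ≠ b) : P.qprod q * P.qprod p = 0 := by
  rw [← P.qprod_mul_idem q, ← P.idem_mul_qprod p, mul_assoc, ← mul_assoc (P.idem c),
    P.idem_orth c b h, zero_mul, mul_zero]

theorem span_qprod : Submodule.span k {x : A | ∃ (a b : V) (p : QPath P.src P.tgt a b),
    P.qprod p = x} = ⊤ := by
  set S : Set A := {x : A | ∃ (a b : V) (p : QPath P.src P.tgt a b), P.qprod p = x}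
  have hmul : ∀ x ∈ Submodule.span k S, ∀ y ∈ Submodule.span k S, x * y ∈ Submodule.span k S := by
    intro x hx y hy
    have := Submodule.mul_mem_mul hx hy
    rw [Submodule.span_mul_span] at this
    refine Submodule.span_le.2 ?_ this
    rintro _ ⟨_, ⟨c, d, q, rfl⟩, _, ⟨a, b, p, rfl⟩, rfl⟩
    by_cases h : c = b
    · subst h
      exact Submodule.subset_span ⟨a, d, p.comp q, P.qprod_comp p q⟩
    · change P.qprod q * P.qprod p ∈ _
      rw [P.qprod_mul_qprod_of_ne p q h]
      exact zero_mem _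
  have hone : (1 : A) ∈ Submodule.span k S := by
    rw [← P.sum_idem]
    exact Submodule.sum_mem _ fun v _ => Submodule.subset_span ⟨v, v, .nil v, by rw [qprod]⟩
  rw [eq_top_iff]
  intro x _
  have hx : x ∈ Algebra.adjoin k (Set.range P.idem ∪ Set.range P.arrow) := by
    rw [P.generates]; trivial
  induction hx using Algebra.adjoin_induction with
  | mem x hx =>
    rcases hx with ⟨v, rfl⟩ | ⟨α, rfl⟩
    · exact Submodule.subset_span ⟨v, v, .nil v, by rw [qprod]⟩
    · exact Submodule.subset_span ⟨_, _, _, P.qprod_single α⟩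
  | algebraMap c =>
    rw [Algebra.algebraMap_eq_smul_one]
    exact Submodule.smul_mem _ _ hone
  | add x y _ _ hx hy => exact add_mem (hx trivial) (hy trivial)
  | mul x y _ _ hx hy => exact hmul _ (hx trivial) _ (hy trivial)

theorem qprod_ne_zero_of_length_lt_two {a b : V} (p : QPath P.src P.tgt a b)
    (h : p.length < 2) : P.qprod p ≠ 0 := by
  cases p with
  | nil => rw [qprod]; exact P.idem_ne _
  | cons p α hα =>
    cases p with
    | nil =>
      subst hα
      rw [qprod, qprod, P.arrow_mul_idem]
      exact P.arrow_ne α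
    | cons p β hβ => simp [QPath.length] at h

/-- A path whose product vanishes contains the unique zero-relation. -/
theorem val_eq_zero_of_qprod_eq_zero {a b : V} {ρ : QPath P.src P.tgt a b}
    (huniq : ∀ (x y : V) (q : QPath P.src P.tgt x y), P.IsZeroRel q →
      x = a ∧ y = b ∧ HEq q ρ)
    {R : Type} [Ring R] {ι : V → R} {f : E → R}
    (hι : ∀ v, ι v * ι v = ι v) (hf : ∀ α, ι (P.tgt α) * f α = f α) (hρ : ρ.val ι f = 0) :
    ∀ (n : ℕ) (x y : V) (p : QPath P.src P.tgt x y), p.length = n → P.qprod p = 0 →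
      p.val ι f = 0 := by
  intro n
  induction n using Nat.strong_induction_on with
  | _ n ih =>
    intro x y p hn hp
    by_cases hz : P.IsZeroRel p
    · obtain ⟨rfl, rfl, h⟩ := huniq x y p hz
      rw [eq_of_heq h, hρ]
    · have h2 : 2 ≤ p.length := by
        by_contra h
        exact P.qprod_ne_zero_of_length_lt_two p (by omega) hp
      simp only [IsZeroRel, hp, h2, true_and, not_forall] at hz
      obtain ⟨u, w, q, p₁, p₂, rfl, hlt, hq⟩ := hz
      rw [QPath.val_comp hι hf, QPath.val_comp hι hf,
        ih q.length (hn ▸ hlt) u w q rfl (not_not.1 hq), mul_zero, zero_mul]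

/-- The universal property of the algebra of a quiver with a unique zero-relation. -/
theorem exists_algHom (hmono : P.Monomial) {a b : V} {ρ : QPath P.src P.tgt a b}
    (huniq : ∀ (x y : V) (q : QPath P.src P.tgt x y), P.IsZeroRel q →
      x = a ∧ y = b ∧ HEq q ρ)
    {R : Type} [Ring R] [Algebra k R] (ι : V → R) (f : E → R)
    (hι : ∀ v, ι v * ι v = ι v) (hort : ∀ v w, v ≠ w → ι v * ι w = 0) (hsum : ∑ v, ι v = 1)
    (hl : ∀ α, ι (P.tgt α) * f α = f α) (hr : ∀ α, f α * ι (P.src α) = f α)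
    (hρ : ρ.val ι f = 0) :
    ∃ Φ : A →ₐ[k] R, (∀ v, Φ (P.idem v) = ι v) ∧ ∀ α, Φ (P.arrow α) = f α := by
  have hspan : ⊤ ≤ Submodule.span k (Set.range
      (fun q : {q : Σ a : V, Σ b : V, QPath P.src P.tgt a b // P.qprod q.2.2 ≠ 0} =>
        P.qprod q.1.2.2)) := by
    rw [← P.span_qprod, Submodule.span_le]
    rintro _ ⟨x, y, p, rfl⟩
    by_cases h : P.qprod p = 0
    · rw [h]; exact zero_mem _
    · exact Submodule.subset_span ⟨⟨⟨x, y, p⟩, h⟩, rfl⟩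
  have hli : LinearIndependent k
      (fun q : {q : Σ a : V, Σ b : V, QPath P.src P.tgt a b // P.qprod q.2.2 ≠ 0} =>
        P.qprod q.1.2.2) := hmono
  let B := Module.Basis.mk hli hspan
  have hB : ∀ q, B q = P.qprod q.1.2.2 := Module.Basis.mk_apply hli hspan
  let φ : A →ₗ[k] R := B.constr k fun q => q.1.2.2.val ι f
  have hφ : ∀ {x y : V} (p : QPath P.src P.tgt x y), φ (P.qprod p) = p.val ι f := by
    intro x y p
    by_cases h : P.qprod p = 0
    · rw [h, map_zero, P.val_eq_zero_of_qprod_eq_zero huniq hι hl hρ _ x y p rfl h]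
    · have h1 : B ⟨⟨x, y, p⟩, h⟩ = P.qprod p := hB _
      rw [← h1]
      simp only [φ, Module.Basis.constr_basis]
  have hid : ∀ v, φ (P.idem v) = ι v := fun v => by
    simpa only [qprod, QPath.val] using hφ (.nil v)
  have hone : φ 1 = 1 := by
    rw [← P.sum_idem, map_sum, ← hsum]
    exact Finset.sum_congr rfl fun v _ => hid v
  have hmul : ∀ x y, φ (x * y) = φ x * φ y := by
    have h1 : (LinearMap.mul k A).compr₂ φ = (LinearMap.mul k R).compl₁₂ φ φ := by
      refine B.ext fun q => B.ext fun p => ?_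
      obtain ⟨⟨c, d, q⟩, hq⟩ := q
      obtain ⟨⟨x, y, p⟩, hp⟩ := p
      simp only [hB, LinearMap.compr₂_apply, LinearMap.mul_apply',
        LinearMap.compl₁₂_apply, hφ]
      by_cases h : c = y
      · subst h
        rw [← P.qprod_comp, hφ, QPath.val_comp hι hl]
      · rw [P.qprod_mul_qprod_of_ne p q h, map_zero, ← QPath.val_mul_right hι q,
          ← QPath.val_mul_left hι hl p, mul_assoc, ← mul_assoc (ι c), hort c y h,
            zero_mul, mul_zero]
    intro x y
    exact LinearMap.congr_fun (LinearMap.congr_fun h1 x) y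
  refine ⟨AlgHom.ofLinearMap φ hone hmul, hid, fun α => ?_⟩
  change φ (P.arrow α) = f α
  rw [← P.qprod_single, hφ]
  simpa only [QPath.single, QPath.val] using hr α

/-- A map commuting with scalars, idempotents and arrows is linear over the algebra. -/
theorem map_smul_of_commute {M N : Type} [AddCommGroup M] [Module A M] [AddCommGroup N]
    [Module A N] (f : M →+ N)
    (hk : ∀ (c : k) m, f (algebraMap k A c • m) = algebraMap k A c • f m)
    (hi : ∀ v m, f (P.idem v • m) = P.idem v • f m)
    (ha : ∀ α m, f (P.arrow α • m) = P.arrow α • f m) (x : A) (m : M) :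
    f (x • m) = x • f m := by
  have hx : x ∈ Algebra.adjoin k (Set.range P.idem ∪ Set.range P.arrow) := by
    rw [P.generates]; trivial
  induction hx using Algebra.adjoin_induction generalizing m with
  | mem x hx =>
    rcases hx with ⟨v, rfl⟩ | ⟨α, rfl⟩
    · exact hi v m
    · exact ha α m
  | algebraMap c => exact hk c m
  | add x y _ _ hx hy => rw [add_smul, add_smul, map_add, hx, hy]
  | mul x y _ _ hx hy => rw [mul_smul, mul_smul, hx, hy]

theorem smul_mem_of_stable {M : Type} [AddCommGroup M] [Module A M] (S : AddSubgroup M)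
    (hk : ∀ (c : k), ∀ m ∈ S, algebraMap k A c • m ∈ S)
    (hi : ∀ v, ∀ m ∈ S, P.idem v • m ∈ S)
    (ha : ∀ α, ∀ m ∈ S, P.arrow α • m ∈ S) (x : A) (m : M) (hm : m ∈ S) : x • m ∈ S := by
  have hx : x ∈ Algebra.adjoin k (Set.range P.idem ∪ Set.range P.arrow) := by
    rw [P.generates]; trivial
  induction hx using Algebra.adjoin_induction generalizing m with
  | mem x hx =>
    rcases hx with ⟨v, rfl⟩ | ⟨α, rfl⟩
    · exact hi v m hm
    · exact ha α m hm
  | algebraMap c => exact hk c m hm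
  | add x y _ _ hx hy => rw [add_smul]; exact add_mem (hx m hm) (hy m hm)
  | mul x y _ _ hx hy => rw [mul_smul]; exact hx _ (hy m hm)

end QuiverPresentation

/-! ## Tree quivers -/

namespace TreeQuiver

variable {V E : Type}

/-- A quiver whose underlying graph is a tree: it is connected and each arrow
separates its two endpoints. -/
structure IsTree (src tgt : E → V) : Prop where
  cut : ∀ γ, ∃ c : V → Prop, ¬ c (src γ) ∧ c (tgt γ) ∧ ∀ δ, δ ≠ γ → (c (src δ) ↔ c (tgt δ))
  conn : ∀ S : V → Prop, (∀ δ, S (src δ) ↔ S (tgt δ)) → ∀ v w, S v → S w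

theorem IsTree.op {src tgt : E → V} (h : IsTree src tgt) : IsTree tgt src where
  cut γ := by
    obtain ⟨c, h1, h2, h3⟩ := h.cut γ
    exact ⟨fun v => ¬ c v, not_not.2 h2, h1, fun δ hδ => not_congr (h3 δ hδ).symm⟩
  conn S hS := h.conn S fun δ => (hS δ).symm

/-- A directed path, given by the list of its arrows. -/
def IsRoute (src tgt : E → V) : V → List E → V → Prop
  | a, [], b => a = b
  | a, e :: l, b => src e = a ∧ IsRoute src tgt (tgt e) l b

/-- A walk in the underlying graph. -/
def IsWalk (src tgt : E → V) : V → List (E × Bool) → V → Prop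
  | a, [], b => a = b
  | a, (e, true) :: l, b => src e = a ∧ IsWalk src tgt (tgt e) l b
  | a, (e, false) :: l, b => tgt e = a ∧ IsWalk src tgt (src e) l b

section

variable {src tgt : E → V}

theorem isRoute_append {a c : V} {l l' : List E} :
    IsRoute src tgt a (l ++ l') c ↔ ∃ b, IsRoute src tgt a l b ∧ IsRoute src tgt b l' c := by
  induction l generalizing a with
  | nil => simp [IsRoute]
  | cons e l ih => simp [IsRoute, ih, and_assoc]

theorem isRoute_reverse {a b : V} {l : List E} (h : IsRoute src tgt a l b) :
    IsRoute tgt src b l.reverse a := by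
  induction l generalizing a with
  | nil => exact h.symm
  | cons e l ih =>
    rw [List.reverse_cons, isRoute_append]
    exact ⟨tgt e, ih h.2, rfl, h.1⟩

theorem isWalk_append {a c : V} {l l' : List (E × Bool)} :
    IsWalk src tgt a (l ++ l') c ↔ ∃ b, IsWalk src tgt a l b ∧ IsWalk src tgt b l' c := by
  induction l generalizing a with
  | nil => simp [IsWalk]
  | cons s l ih =>
    obtain ⟨e, _ | _⟩ := s <;> simp [IsWalk, ih, and_assoc]

theorem IsRoute.isWalk {a b : V} {l : List E} (h : IsRoute src tgt a l b) :
    IsWalk src tgt a (l.map fun e => (e, true)) b := by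
  induction l generalizing a with
  | nil => exact h
  | cons e l ih => exact ⟨h.1, ih h.2⟩

theorem IsWalk.op {a b : V} {l : List (E × Bool)} (h : IsWalk src tgt a l b) :
    IsWalk tgt src a (l.map fun s => (s.1, !s.2)) b := by
  induction l generalizing a with
  | nil => exact h
  | cons s l ih => obtain ⟨e, _ | _⟩ := s <;> exact ⟨h.1, ih h.2⟩

theorem IsRoute.mono {c : V → Prop} {a b : V} {l : List E} (h : IsRoute src tgt a l b)
    (hc : ∀ e ∈ l, c (src e) → c (tgt e)) (ha : c a) : c b := by
  induction l generalizing a with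
  | nil => exact h ▸ ha
  | cons e l ih =>
    exact ih h.2 (fun e he => hc e (List.mem_cons_of_mem _ he))
      (hc e List.mem_cons_self (h.1 ▸ ha))

theorem IsTree.not_mem_of_isRoute (hT : IsTree src tgt) {γ : E} {b : V} {l : List E}
    (h : IsRoute src tgt (tgt γ) l b) : γ ∉ l := by
  obtain ⟨c, h1, h2, h3⟩ := hT.cut γ
  intro hγ
  obtain ⟨l₁, l₂, rfl⟩ := List.append_of_mem hγ
  obtain ⟨u, hu, hu'⟩ := isRoute_append.1 h
  refine h1 (hu'.1 ▸ hu.mono (fun e _ he => ?_) h2)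
  by_cases heq : e = γ
  · exact heq ▸ h2
  · exact (h3 e heq).1 he

theorem IsTree.not_isRoute_src (hT : IsTree src tgt) {γ : E} {l : List E} :
    ¬ IsRoute src tgt (tgt γ) l (src γ) := fun h =>
  hT.not_mem_of_isRoute (l := l ++ [γ]) (isRoute_append.2 ⟨_, h, rfl, rfl⟩) (by simp)

theorem IsTree.nodup_of_isRoute (hT : IsTree src tgt) {a b : V} {l : List E}
    (h : IsRoute src tgt a l b) : l.Nodup := by
  induction l generalizing a with
  | nil => exact List.nodup_nil
  | cons e l ih => exact List.nodup_cons.2 ⟨hT.not_mem_of_isRoute h.2, ih h.2⟩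

/-- The vertices in `T` are connected to each other through the arrows in `S`. -/
def ConnBy (src tgt : E → V) (S : Set E) (T : Set V) : Prop :=
  ∀ c : V → Prop, (∀ δ ∈ S, c (src δ) ↔ c (tgt δ)) → ∀ u ∈ T, ∀ v ∈ T, c u → c v

theorem ConnBy.insert_tgt {S : Set E} {T : Set V} (h : ConnBy src tgt S T) {e : E}
    (he : src e ∈ T) : ConnBy src tgt (insert e S) (insert (tgt e) T) := by
  intro c hc
  have h1 := h c fun δ hδ => hc δ (Set.mem_insert_of_mem _ hδ)
  have h2 := hc e (Set.mem_insert _ _)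
  rintro u (rfl | hu) v (rfl | hv) hcu
  · exact hcu
  · exact h1 _ he _ hv (h2.2 hcu)
  · exact h2.1 (h1 _ hu _ he hcu)
  · exact h1 _ hu _ hv hcu

theorem ConnBy.op {S : Set E} {T : Set V} (h : ConnBy src tgt S T) : ConnBy tgt src S T :=
  fun c hc => h c fun δ hδ => (hc δ hδ).symm

theorem ConnBy.insert_src {S : Set E} {T : Set V} (h : ConnBy src tgt S T) {e : E}
    (he : tgt e ∈ T) : ConnBy src tgt (insert e S) (insert (src e) T) :=
  (h.op.insert_tgt he).op

theorem connBy_singleton (S : Set E) (v : V) : ConnBy src tgt S {v} := by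
  rintro c _ u rfl w rfl h
  exact h

theorem IsTree.tgt_notMem (hT : IsTree src tgt) {S : Set E} {T : Set V}
    (h : ConnBy src tgt S T) {e : E} (he : e ∉ S) (hs : src e ∈ T) : tgt e ∉ T := by
  obtain ⟨c, h1, h2, h3⟩ := hT.cut e
  intro ht
  exact h1 (h c (fun δ hδ => h3 δ fun hh => he (hh ▸ hδ)) _ ht _ hs h2)

theorem IsTree.src_notMem (hT : IsTree src tgt) {S : Set E} {T : Set V}
    (h : ConnBy src tgt S T) {e : E} (he : e ∉ S) (ht : tgt e ∈ T) : src e ∉ T :=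
  fun hs => hT.tgt_notMem h he hs ht

/-- A walk in the underlying graph, each of whose steps leads to a new vertex. -/
def IsArm (src tgt : E → V) : Set V → V → List (E × Bool) → Prop
  | _, _, [] => True
  | T, v, (e, true) :: l =>
    src e = v ∧ tgt e ∉ T ∧ IsArm src tgt (insert (tgt e) T) (tgt e) l
  | T, v, (e, false) :: l =>
    tgt e = v ∧ src e ∉ T ∧ IsArm src tgt (insert (src e) T) (src e) l

theorem IsTree.isArm (hT : IsTree src tgt) {v w : V} {l : List (E × Bool)}
    (hl : IsWalk src tgt v l w) (hn : (l.map Prod.fst).Nodup) {S : Set E} {T : Set V}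
    (hS : ∀ s ∈ l, s.1 ∉ S) (h : ConnBy src tgt S T) (hv : v ∈ T) : IsArm src tgt T v l := by
  induction l generalizing v S T with
  | nil => trivial
  | cons s l ih =>
    obtain ⟨hn1, hn2⟩ := List.nodup_cons.1 hn
    have hS' : ∀ s' ∈ l, s'.1 ∉ insert s.1 S := by
      rintro s' hs' (h' | h')
      · exact hn1 (h' ▸ List.mem_map_of_mem hs')
      · exact hS s' (List.mem_cons_of_mem _ hs') h'
    have he := hS s List.mem_cons_self
    obtain ⟨e, _ | _⟩ := s
    · obtain ⟨rfl, hl⟩ := hl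
      exact ⟨rfl, hT.src_notMem h he hv,
        ih hl hn2 hS' (h.insert_src hv) (Set.mem_insert _ _)⟩
    · obtain ⟨rfl, hl⟩ := hl
      exact ⟨rfl, hT.tgt_notMem h he hv,
        ih hl hn2 hS' (h.insert_tgt hv) (Set.mem_insert _ _)⟩

end

end TreeQuiver

/-! ## Paths in tree quivers -/

namespace QPath

open TreeQuiver

variable {V E : Type} {src tgt : E → V}

theorem isRoute_arrows {a b : V} (p : QPath src tgt a b) : IsRoute src tgt a p.arrows b := by
  induction p with
  | nil => simp [arrows, IsRoute]
  | cons p α h ih =>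
    rw [arrows, isRoute_append]
    exact ⟨_, ih, h, rfl⟩

theorem length_eq_zero_of_eq (hT : IsTree src tgt) {a b : V} (p : QPath src tgt a b)
    (h : a = b) : p.length = 0 := by
  cases p with
  | nil => simp only [length]
  | cons p α hα =>
    subst h
    subst hα
    exact absurd p.isRoute_arrows hT.not_isRoute_src

theorem exists_of_cut {c : V → Prop} {α : E}
    (hc : ∀ δ, δ ≠ α → (c (src δ) ↔ c (tgt δ))) {a b : V} (p : QPath src tgt a b) (ha : ¬ c a)
    (hb : c b) : Nonempty (QPath src tgt (tgt α) b) := by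
  induction p with
  | nil => exact absurd hb ha
  | cons p β hβ ih =>
    by_cases h : β = α
    · subst h; exact ⟨.nil _⟩
    · obtain ⟨q⟩ := ih (hβ ▸ (hc β h).2 hb)
      exact ⟨q.cons β hβ⟩

theorem heq_of_isTree (hT : IsTree src tgt) {a b : V} (p : QPath src tgt a b) :
    ∀ {b' : V} (q : QPath src tgt a b'), b = b' → HEq p q := by
  induction p with
  | nil =>
    intro b' q h
    cases q with
    | nil => rfl
    | cons q β hβ =>
      exact absurd (length_eq_zero_of_eq hT (q.cons β hβ) h) (by simp [length])
  | cons p α hα ih =>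
    intro b' q h
    cases q with
    | nil => exact absurd (length_eq_zero_of_eq hT (p.cons α hα) h.symm) (by simp [length])
    | cons q β hβ =>
      by_cases hβα : β = α
      · subst hβα
        subst hα
        subst hβ
        rw [eq_of_heq (ih q rfl)]
      · exfalso
        obtain ⟨c, h1, h2, h3⟩ := hT.cut α
        have hmono : ∀ (l : List E), ∀ e ∈ l, c (src e) → c (tgt e) := fun _ e _ he => by
          by_cases heq : e = α
          · exact heq ▸ h2
          · exact (h3 e heq).1 he
        obtain ⟨r⟩ := exists_of_cut h3 q
          (fun ha => h1 (hα ▸ p.isRoute_arrows.mono (hmono _) ha))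
          (hβ ▸ (h3 β hβα).2 (h ▸ h2))
        · exact hT.not_isRoute_src (γ := β) (l := r.arrows)
            (by rw [← h, hβ]; exact r.isRoute_arrows)

theorem subsingleton_of_isTree (hT : IsTree src tgt) (a b : V) :
    Subsingleton (QPath src tgt a b) :=
  ⟨fun p q => eq_of_heq (heq_of_isTree hT p q rfl)⟩

end QPath

namespace QuiverPresentation

open TreeQuiver

variable {k A V E : Type} [Field k] [Ring A] [Algebra k A] [Fintype V] [Fintype E]
  {P : QuiverPresentation k A V E}

theorem IsTreeQuiver.isTree (h : P.IsTreeQuiver) : IsTree P.src P.tgt := by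
  have hconn : ∀ S : V → Prop, (∀ δ, S (P.src δ) ↔ S (P.tgt δ)) → ∀ v w, S v → S w := by
    intro S hS v w hv
    obtain ⟨l, hl, -⟩ := h.1 v w
    induction l generalizing v with
    | nil => exact hl ▸ hv
    | cons s l ih =>
      obtain ⟨rfl, hl⟩ := hl
      refine ih _ ?_ hl
      obtain ⟨e, _ | _⟩ := s
      · exact (hS e).2 hv
      · exact (hS e).1 hv
  refine ⟨fun γ => ?_, hconn⟩
  let d : (V → ℚ) →ₗ[ℚ] (E → ℚ) :=
    { toFun := fun f e => f (P.tgt e) - f (P.src e)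
      map_add' := fun f g => by ext e; simp only [Pi.add_apply]; ring
      map_smul' := fun c f => by
        ext e; simp only [Pi.smul_apply, smul_eq_mul, RingHom.id_apply]; ring }
  have hker : d.ker ≤ Submodule.span ℚ {fun _ => (1 : ℚ)} := by
    intro f hf
    have hf' : ∀ e, f (P.tgt e) = f (P.src e) := fun e => sub_eq_zero.1 (congrFun hf e)
    refine Submodule.mem_span_singleton.2 ⟨f (P.src γ), funext fun v => ?_⟩
    have := hconn (fun w => f w = f (P.src γ)) (fun δ => by simp only [hf'])
      (P.src γ) v rfl
    simp [this]
  have hrank := d.finrank_range_add_finrank_ker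
  have hk1 : Module.finrank ℚ d.ker ≤ 1 :=
    (Submodule.finrank_mono hker).trans ((finrank_span_le_card _).trans (by simp))
  rw [Module.finrank_fintype_fun_eq_card, ← h.2] at hrank
  have htop : d.range = ⊤ := by
    refine Submodule.eq_top_of_finrank_eq (le_antisymm (Submodule.finrank_le _) ?_)
    rw [Module.finrank_fintype_fun_eq_card]
    omega
  obtain ⟨f, hf⟩ := LinearMap.range_eq_top.1 htop (Pi.single γ 1)
  have hf' : ∀ e, f (P.tgt e) - f (P.src e) = (Pi.single γ 1 : E → ℚ) e := congrFun hf
  refine ⟨fun v => f v = f (P.tgt γ), fun h0 => ?_, rfl, fun δ hδ => ?_⟩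
  · have := hf' γ
    rw [Pi.single_eq_same] at this
    simp only at h0
    rw [h0] at this
    simp at this
  · have := hf' δ
    rw [Pi.single_eq_of_ne hδ] at this
    simp only [sub_eq_zero.1 this]

end QuiverPresentation

/-! ## Tree quivers with comparable representations -/

namespace TreeQuiver

variable {V E k : Type} [Field k] {src tgt : E → V}

/-- The product of the matrices along a directed path. -/
def routeProd {n : ℕ} (F : E → Matrix (Fin n) (Fin n) k) : List E → Matrix (Fin n) (Fin n) k
  | [] => 1
  | e :: l => routeProd F l * F e

theorem routeProd_append {n : ℕ} (F : E → Matrix (Fin n) (Fin n) k) (l l' : List E) :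
    routeProd F (l ++ l') = routeProd F l' * routeProd F l := by
  induction l with
  | nil => simp [routeProd]
  | cons e l ih => simp [routeProd, ih, mul_assoc]

theorem routeProd_reverse {n : ℕ} (F : E → Matrix (Fin n) (Fin n) k) (l : List E) :
    routeProd F l.reverse = (routeProd (fun e => (F e).transpose) l).transpose := by
  induction l with
  | nil => simp [routeProd]
  | cons e l ih => simp [routeProd, routeProd_append, ih]

theorem routeProd_eq_one {n : ℕ} {F : E → Matrix (Fin n) (Fin n) k} {l : List E}
    (h : ∀ e ∈ l, F e = 1) : routeProd F l = 1 := by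
  induction l with
  | nil => rfl
  | cons e l ih =>
    rw [routeProd, ih fun e he => h e (List.mem_cons_of_mem _ he), h e List.mem_cons_self, one_mul]

theorem routeProd_mul {n n' : ℕ} {F : E → Matrix (Fin n) (Fin n) k}
    {F' : E → Matrix (Fin n') (Fin n') k} {g : V → Matrix (Fin n') (Fin n) k}
    (hg : ∀ e, g (tgt e) * F e = F' e * g (src e)) {a b : V} {l : List E}
    (h : IsRoute src tgt a l b) : routeProd F' l * g a = g b * routeProd F l := by
  induction l generalizing a with
  | nil => obtain rfl : a = b := h; simp [routeProd]
  | cons e l ih =>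
    rw [routeProd, routeProd, Matrix.mul_assoc, ← h.1, ← hg, ← Matrix.mul_assoc, ih h.2,
      Matrix.mul_assoc]

/-- Any two representations with constant dimension which do not vanish along the path `π`
are comparable through a morphism which does not vanish along `π`. -/
def Comparable (k : Type) [Field k] (src tgt : E → V) (x : V) (π : List E) : Prop :=
  ∀ (n n' : ℕ) (F : E → Matrix (Fin n) (Fin n) k) (F' : E → Matrix (Fin n') (Fin n') k),
    routeProd F π ≠ 0 → routeProd F' π ≠ 0 →
    (∃ g : V → Matrix (Fin n') (Fin n) k, (∀ e, g (tgt e) * F e = F' e * g (src e)) ∧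
      routeProd F' π * g x ≠ 0) ∨
    ∃ g : V → Matrix (Fin n) (Fin n') k, (∀ e, g (tgt e) * F' e = F e * g (src e)) ∧
      routeProd F π * g x ≠ 0

theorem Comparable.op {x y : V} {π : List E} (h : Comparable k src tgt x π)
    (hπ : IsRoute src tgt x π y) : Comparable k tgt src y π.reverse := by
  have key : ∀ (n n' : ℕ) (F : E → Matrix (Fin n) (Fin n) k)
      (F' : E → Matrix (Fin n') (Fin n') k) (g : V → Matrix (Fin n) (Fin n') k),
      (∀ e, g (tgt e) * (F' e).transpose = (F e).transpose * g (src e)) →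
      routeProd (fun e => (F e).transpose) π * g x ≠ 0 →
      ∃ g : V → Matrix (Fin n') (Fin n) k, (∀ e, g (src e) * F e = F' e * g (tgt e)) ∧
        routeProd F' π.reverse * g y ≠ 0 := by
    intro n n' F F' g hg h0
    refine ⟨fun v => (g v).transpose, fun e => ?_, fun h1 => h0 ?_⟩
    · have := congrArg Matrix.transpose (hg e)
      simpa using this.symm
    · rw [routeProd_mul hg hπ]
      have := congrArg Matrix.transpose h1
      rw [routeProd_reverse] at this
      simpa using this
  intro n n' F F' h1 h2
  rw [routeProd_reverse, Ne, Matrix.transpose_eq_zero] at h1 h2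
  rcases h n n' _ _ h1 h2 with ⟨g, hg, h0⟩ | ⟨g, hg, h0⟩
  · exact .inr (key _ _ _ _ g hg h0)
  · exact .inl (key _ _ _ _ g hg h0)

section OneDim

/-- The one-dimensional representation in which the arrows in `B` act as the identity and
the other ones as zero. -/
noncomputable def thin (k : Type) [Field k] (B : Set E) (e : E) : Matrix (Fin 1) (Fin 1) k :=
  if e ∈ B then 1 else 0

theorem eq_zero_of_thin {S B B' : Set E} {T : Set V} (h : ConnBy src tgt S T) (hB : S ⊆ B)
    (hB' : S ⊆ B') {g : V → Matrix (Fin 1) (Fin 1) k}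
    (hg : ∀ e, g (tgt e) * thin k B e = thin k B' e * g (src e)) {x : V} (hx : x ∈ T)
    (he : (∃ e, e ∈ B ∧ e ∉ B' ∧ tgt e ∈ T) ∨ ∃ e, e ∉ B ∧ e ∈ B' ∧ src e ∈ T) : g x = 0 := by
  have hc : ∀ δ ∈ S, g (src δ) = 0 ↔ g (tgt δ) = 0 := fun δ hδ => by
    have := hg δ
    simp only [thin, hB hδ, hB' hδ, if_true, mul_one, one_mul] at this
    rw [this]
  rcases he with ⟨e, h1, h2, h3⟩ | ⟨e, h1, h2, h3⟩ <;> have := hg e <;>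
    simp only [thin, h1, h2, if_true, if_false, mul_one, one_mul, mul_zero, zero_mul] at this
  · exact h (fun v => g v = 0) hc _ h3 _ hx this
  · exact h (fun v => g v = 0) hc _ h3 _ hx this.symm

theorem Comparable.false_of_two_arrows {x : V} {π : List E} (hC : Comparable k src tgt x π)
    {S : Set E} {T : Set V} (h : ConnBy src tgt S T) (hx : x ∈ T) (hπ : ∀ e ∈ π, e ∈ S)
    {e e' : E} (hne : e ≠ e') (heS : e ∉ S) (heS' : e' ∉ S) (he : src e ∈ T ∨ tgt e ∈ T)
    (he' : src e' ∈ T ∨ tgt e' ∈ T) : False := by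
  have key : ∀ B B' : Set E, S ⊆ B → S ⊆ B' →
      ((∃ e, e ∈ B ∧ e ∉ B' ∧ tgt e ∈ T) ∨ ∃ e, e ∉ B ∧ e ∈ B' ∧ src e ∈ T) →
      ((∃ e, e ∈ B' ∧ e ∉ B ∧ tgt e ∈ T) ∨ ∃ e, e ∉ B' ∧ e ∈ B ∧ src e ∈ T) → False := by
    intro B B' hB hB' h1 h2
    have h0 : ∀ B : Set E, S ⊆ B → routeProd (thin k B) π ≠ 0 := fun B hB => by
      rw [routeProd_eq_one (F := thin k B) fun e he => if_pos (hB (hπ e he))]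
      exact one_ne_zero
    rcases hC 1 1 (thin k B) (thin k B') (h0 B hB) (h0 B' hB') with ⟨g, hg, hne⟩ | ⟨g, hg, hne⟩
    · exact hne (by rw [eq_zero_of_thin h hB hB' hg hx h1, mul_zero])
    · exact hne (by rw [eq_zero_of_thin h hB' hB hg hx h2, mul_zero])
  have hs := fun e => Set.subset_insert e S
  rcases he with he | he <;> rcases he' with he' | he'
  · exact key (insert e S) (insert e' S) (hs e) (hs e')
      (.inr ⟨e', by simp [*, hne.symm], by simp, he'⟩)
      (.inr ⟨e, by simp [*], by simp, he⟩)
  · exact key S (insert e (insert e' S)) subset_rfl ((hs e').trans (Set.subset_insert _ _))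
      (.inr ⟨e, heS, by simp, he⟩) (.inl ⟨e', by simp, heS', he'⟩)
  · exact key S (insert e (insert e' S)) subset_rfl ((hs e').trans (Set.subset_insert _ _))
      (.inr ⟨e', heS', by simp, he'⟩) (.inl ⟨e, by simp, heS, he⟩)
  · exact key (insert e S) (insert e' S) (hs e) (hs e') (.inl ⟨e, by simp, by simp [*], he⟩)
      (.inl ⟨e', by simp, by simp [*, hne.symm], he'⟩)

end OneDim

section TwoDim

theorem Comparable.false_of_vanish {x v : V} {p q : List E}
    (hC : Comparable k src tgt x (p ++ q)) (hp : IsRoute src tgt x p v)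
    {n n' : ℕ} (F : E → Matrix (Fin n) (Fin n) k) (F' : E → Matrix (Fin n') (Fin n') k)
    (hF : routeProd F (p ++ q) ≠ 0) (hF' : routeProd F' (p ++ q) ≠ 0)
    (h : ∀ g : V → Matrix (Fin n') (Fin n) k, (∀ e, g (tgt e) * F e = F' e * g (src e)) → g v = 0)
    (h' : ∀ g : V → Matrix (Fin n) (Fin n') k,
      (∀ e, g (tgt e) * F' e = F e * g (src e)) → g v = 0) :
    False := by
  rcases hC n n' F F' hF hF' with ⟨g, hg, hne⟩ | ⟨g, hg, hne⟩
  · exact hne (by rw [routeProd_append, Matrix.mul_assoc, routeProd_mul hg hp, h g hg,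
      Matrix.zero_mul,
      Matrix.mul_zero])
  · exact hne (by rw [routeProd_append, Matrix.mul_assoc, routeProd_mul hg hp, h' g hg,
      Matrix.zero_mul,
      Matrix.mul_zero])

/-- The representation on the plane given by three matrices at the arrows `α`, `β`, `γ`, by
`ν` at the arrow `δ` and by identities on the other arrows of the path `π`. -/
noncomputable def plane (π : List E) (α β γ δ : E) (ν : Matrix (Fin 2) (Fin 2) k) (e : E) :
    Matrix (Fin 2) (Fin 2) k :=
  if e = α then !![1, 0; 0, 0] else if e = β then !![1, 1; 0, 0] else
  if e = γ then !![1, 0; 0, 0] else if e = δ then ν else if e ∈ π then 1 else 0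

theorem routeProd_plane_ne_zero {p₁ p₂ p₃ : List E} {α β γ δ : E} {ν : Matrix (Fin 2) (Fin 2) k}
    (hn : (p₁ ++ α :: p₂ ++ β :: p₃).Nodup) (hγ : γ ∉ p₁ ++ α :: p₂ ++ β :: p₃)
    (hδ : δ ∉ p₁ ++ α :: p₂ ++ β :: p₃) :
    routeProd (plane (p₁ ++ α :: p₂ ++ β :: p₃) α β γ δ ν) (p₁ ++ α :: p₂ ++ β :: p₃) ≠ 0 := by
  have key : ∀ l : List E, l ⊆ p₁ ++ α :: p₂ ++ β :: p₃ → α ∉ l → β ∉ l →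
      routeProd (plane (p₁ ++ α :: p₂ ++ β :: p₃) α β γ δ ν) l = 1 := by
    intro l hl hα hβ
    refine routeProd_eq_one fun e he => ?_
    have hm := hl he
    rw [plane, if_neg fun h : e = α => hα (h ▸ he), if_neg fun h : e = β => hβ (h ▸ he),
      if_neg fun h : e = γ => hγ (h ▸ hm), if_neg fun h : e = δ => hδ (h ▸ hm), if_pos hm]
  have hα : plane (p₁ ++ α :: p₂ ++ β :: p₃) α β γ δ ν α = !![1, 0; 0, 0] := if_pos rfl
  have hβ : plane (p₁ ++ α :: p₂ ++ β :: p₃) α β γ δ ν β = !![1, 1; 0, 0] := by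
    rw [plane, if_neg, if_pos rfl]
    rintro rfl
    simp [List.nodup_append] at hn
  simp only [List.append_assoc, List.cons_append, List.nodup_append, List.nodup_cons,
    List.mem_append, List.mem_cons] at hn
  obtain ⟨-, ⟨h1, -, ⟨h2, h3⟩, h4⟩, h5⟩ := hn
  push Not at h1
  rw [routeProd_append, routeProd_append, routeProd, routeProd,
    key p₁ (fun e he => by simp [he]) (fun h => (h5 _ h _ (.inl rfl)) rfl)
      (fun h => (h5 _ h _ (.inr (.inr (.inl rfl)))) rfl),
    key p₂ (fun e he => by simp [he]) h1.1 (fun h => h4 _ h _ (.inl rfl) rfl),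
    key p₃ (fun e he => by simp [he]) h1.2.2 h2, hα, hβ]
  intro h
  have := congrFun (congrFun h 0) 0
  simp at this

/-- A branch of length two at an interior vertex of the path is impossible. -/
theorem Comparable.false_of_long_branch {x y : V} {p q : List E} {α β γ δ : E}
    (hC : Comparable k src tgt x (p ++ α :: β :: q))
    (hr : IsRoute src tgt x (p ++ α :: β :: q) y) (hn : (p ++ α :: β :: q).Nodup)
    (hγ : γ ∉ p ++ α :: β :: q) (hδ : δ ∉ p ++ α :: β :: q) (hγδ : γ ≠ δ)
    (hγs : src γ = tgt α) (hδs : src δ = tgt γ ∨ tgt δ = tgt γ) : False := by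
  obtain ⟨u, hp, hα, hβ, hq⟩ := isRoute_append.1 hr
  have e1 : p ++ α :: β :: q = (p ++ [α]) ++ (β :: q) := by simp
  have e2 : p ++ α :: β :: q = p ++ α :: [] ++ β :: q := by simp
  have hαβ : α ≠ β := by rintro rfl; simp [List.nodup_append] at hn
  have hmα : α ∈ p ++ α :: β :: q := by simp
  have hmβ : β ∈ p ++ α :: β :: q := by simp
  set π := p ++ α :: β :: q with hπ
  have hγα : γ ≠ α := fun h => hγ (h ▸ hmα)
  have hγβ : γ ≠ β := fun h => hγ (h ▸ hmβ)
  have hδα : δ ≠ α := fun h => hδ (h ▸ hmα)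
  have hδβ : δ ≠ β := fun h => hδ (h ▸ hmβ)
  have hpl : ∀ ν : Matrix (Fin 2) (Fin 2) k, routeProd (plane π α β γ δ ν) π ≠ 0 := fun ν => by
    rw [e2] at hn hγ hδ ⊢
    exact routeProd_plane_ne_zero hn hγ hδ
  have hth : ∀ B : Set E, {e | e ∈ π} ⊆ B → routeProd (thin k B) π ≠ 0 := fun B hB => by
    rw [routeProd_eq_one (F := thin k B) fun e he => if_pos (hB he)]
    exact one_ne_zero
  have key : ∀ (ν : Matrix (Fin 2) (Fin 2) k) (B : Set E), {e | e ∈ π} ⊆ B → γ ∈ B →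
      (∀ g : V → Matrix (Fin 2) (Fin 1) k,
        g (tgt δ) * thin k B δ = ν * g (src δ) → g (tgt γ) = 0) → False := by
    intro ν B hB hγB hν
    have hC' := hC
    rw [e1] at hC'
    refine hC'.false_of_vanish (v := tgt α) (isRoute_append.2 ⟨_, hp, hα, rfl⟩)
      (thin k B) (plane π α β γ δ ν) (e1 ▸ hth B hB) (e1 ▸ hpl ν) ?_ ?_
    · intro g hg
      have h1 := hg α
      have h2 := hg γ
      have h3 := hg δ
      simp only [thin, plane, hB hmα, hγB, if_true, hγα, hγβ, hδα, hδβ, hγδ.symm, if_false,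
        Matrix.mul_one] at h1 h2 h3
      rw [hν g h3, hγs] at h2
      ext i j
      fin_cases i <;> fin_cases j
      · simpa [Matrix.mul_apply] using (congrFun (congrFun h2 0) 0).symm
      · simpa [Matrix.mul_apply] using congrFun (congrFun h1 1) 0
    · intro g hg
      have h1 := hg β
      have h2 := hg γ
      simp only [thin, plane, hB hmβ, hγB, if_true, hαβ.symm, hγα, hγβ, if_false,
        Matrix.one_mul] at h1 h2
      rw [hβ] at h1
      rw [hγs] at h2
      have h3 := congrFun (congrFun h1 0) 0
      have h4 := congrFun (congrFun h1 0) 1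
      have h5 := congrFun (congrFun h2 0) 1
      simp [Matrix.mul_apply] at h3 h4 h5
      ext i j
      fin_cases i; fin_cases j
      · simp [← h3, h4, ← h5]
      · simp [← h5]
  have hsub : {e | e ∈ π} ⊆ insert γ {e | e ∈ π} := Set.subset_insert _ _
  rcases hδs with h | h
  · refine key 1 (insert γ {e | e ∈ π}) hsub (Set.mem_insert _ _) fun g hg => ?_
    rw [thin, if_neg (by simp [hγδ.symm, hδ]), Matrix.mul_zero, Matrix.one_mul, h] at hg
    exact hg.symm
  · refine key 0 (insert δ (insert γ {e | e ∈ π})) (hsub.trans (Set.subset_insert _ _))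
      (by simp) fun g hg => ?_
    rw [thin, if_pos (by simp), Matrix.mul_one, Matrix.zero_mul, h] at hg
    exact hg

/-- A branch at a vertex of the path which has distance at least two from both endpoints
is impossible. -/
theorem Comparable.false_of_central_branch {x y : V} {p q : List E} {α' α β β' γ : E}
    (hC : Comparable k src tgt x (p ++ α' :: α :: β :: β' :: q))
    (hr : IsRoute src tgt x (p ++ α' :: α :: β :: β' :: q) y)
    (hn : (p ++ α' :: α :: β :: β' :: q).Nodup)
    (hγ : γ ∉ p ++ α' :: α :: β :: β' :: q) (hγs : src γ = tgt α) : False := by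
  obtain ⟨u, hp, hα', hα, hβ, hβ', hq⟩ := isRoute_append.1 hr
  have e1 : p ++ α' :: α :: β :: β' :: q = (p ++ [α', α]) ++ (β :: β' :: q) := by simp
  have e2 : p ++ α' :: α :: β :: β' :: q = (p ++ [α']) ++ α :: [] ++ β :: (β' :: q) := by simp
  have e3 : p ++ α' :: α :: β :: β' :: q = p ++ α' :: [α, β] ++ β' :: q := by simp
  have hm : α' ∈ p ++ α' :: α :: β :: β' :: q ∧ α ∈ p ++ α' :: α :: β :: β' :: q ∧
    β ∈ p ++ α' :: α :: β :: β' :: q ∧ β' ∈ p ++ α' :: α :: β :: β' :: q := by simp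
  have hd : α' ≠ α ∧ α' ≠ β ∧ α' ≠ β' ∧ α ≠ β ∧ α ≠ β' ∧ β ≠ β' := by
    simp [List.nodup_append] at hn
    tauto
  set π := p ++ α' :: α :: β :: β' :: q with hπ
  obtain ⟨m1, m2, m3, m4⟩ := hm
  obtain ⟨d1, d2, d3, d4, d5, d6⟩ := hd
  have c1 : γ ≠ α' := fun h => hγ (h ▸ m1)
  have c2 : γ ≠ α := fun h => hγ (h ▸ m2)
  have c3 : γ ≠ β := fun h => hγ (h ▸ m3)
  have c4 : γ ≠ β' := fun h => hγ (h ▸ m4)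
  have hF : routeProd (plane π α β γ γ (0 : Matrix (Fin 2) (Fin 2) k)) π ≠ 0 := by
    rw [e2] at hn hγ ⊢
    exact routeProd_plane_ne_zero hn hγ hγ
  have hF' : routeProd (plane π α' β' γ γ (0 : Matrix (Fin 2) (Fin 2) k)) π ≠ 0 := by
    rw [e3] at hn hγ ⊢
    exact routeProd_plane_ne_zero hn hγ hγ
  have hC' := hC
  rw [e1] at hC'
  refine hC'.false_of_vanish (v := tgt α) (isRoute_append.2 ⟨_, hp, hα', hα, rfl⟩)
    (plane π α β γ γ 0) (plane π α' β' γ γ 0) (e1 ▸ hF) (e1 ▸ hF') ?_ ?_ <;> intro g hg <;>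
    have h1 := hg α' <;> have h2 := hg α <;> have h3 := hg β <;> have h4 := hg β' <;>
    have h5 := hg γ <;>
    simp only [plane, if_true, if_false, d1, d2, d3, d4, d5, d6, d1.symm, d2.symm, d3.symm,
      d4.symm, d5.symm, d6.symm, c1, c2, c3, c4, c1.symm, c2.symm, c3.symm, c4.symm,
      m1, m2, m3, m4, Matrix.mul_one,
      Matrix.one_mul] at h1 h2 h3 h4 h5 <;>
    rw [hα] at h2 <;> rw [hβ] at h3 <;> rw [hγs] at h5 <;> rw [hβ'] at h4 <;>
    have h5 := congrFun (congrFun h5 0) 1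
  · have a1 := congrFun (congrFun h1 1) 0
    have a2 := congrFun (congrFun h2 1) 0
    have b1 := congrFun (congrFun h3 0) 0
    have b2 := congrFun (congrFun h3 0) 1
    have b3 := congrFun (congrFun h3 1) 0
    have b4 := congrFun (congrFun h3 1) 1
    simp [Matrix.mul_apply] at a1 a2 b1 b2 b3 b4 h5
    have z1 : g (tgt α) 1 0 = 0 := a2.trans a1
    ext i j
    fin_cases i <;> fin_cases j
    · exact (b1.symm.trans b2).trans h5.symm
    · exact h5.symm
    · exact z1
    · exact (b4.symm.trans b3).trans z1
  · have a1 := congrFun (congrFun h2 1) 0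
    have a2 := congrFun (congrFun h2 1) 1
    have b1 := congrFun (congrFun h3 0) 0
    have b2 := congrFun (congrFun h3 0) 1
    have b5 := congrFun (congrFun h4 0) 0
    have b6 := congrFun (congrFun h4 0) 1
    simp [Matrix.mul_apply] at a1 a2 b1 b2 b5 b6 h5
    rw [a1, add_zero] at b1
    rw [a2, add_zero] at b2
    ext i j
    fin_cases i <;> fin_cases j
    · exact b1.symm.trans (b5.symm.trans (b6.trans (b2.trans h5.symm)))
    · exact h5.symm
    · exact a1
    · exact a2

end TwoDim

end TreeQuiver

/-! ## Shape of the tree -/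

namespace TreeQuiver

variable {V E k : Type} [Field k] {src tgt : E → V}

theorem IsWalk.closed {c : V → Prop} {a b : V} {l : List (E × Bool)} (h : IsWalk src tgt a l b)
    (hc : ∀ s ∈ l, c (src s.1) ↔ c (tgt s.1)) (ha : c a) :
    c b ∧ ∀ s ∈ l, c (src s.1) ∧ c (tgt s.1) := by
  induction l generalizing a with
  | nil => exact ⟨h ▸ ha, by simp⟩
  | cons s l ih =>
    have hs := hc s List.mem_cons_self
    have ih' := fun a h => ih (a := a) h fun s hs => hc s (List.mem_cons_of_mem _ hs)
    obtain ⟨e, _ | _⟩ := s <;> obtain ⟨rfl, h⟩ := h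
    · obtain ⟨h1, h2⟩ := ih' _ h (hs.2 ha)
      exact ⟨h1, List.forall_mem_cons.2 ⟨⟨hs.2 ha, ha⟩, h2⟩⟩
    · obtain ⟨h1, h2⟩ := ih' _ h (hs.1 ha)
      exact ⟨h1, List.forall_mem_cons.2 ⟨⟨ha, hs.1 ha⟩, h2⟩⟩

theorem IsRoute.closed {c : V → Prop} {a b : V} {l : List E} (h : IsRoute src tgt a l b)
    (hc : ∀ e ∈ l, c (src e) ↔ c (tgt e)) (ha : c a) :
    c b ∧ ∀ e ∈ l, c (src e) ∧ c (tgt e) := by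
  obtain ⟨h1, h2⟩ := h.isWalk.closed (c := c) (by simpa using hc) ha
  exact ⟨h1, by simpa using h2⟩

/-- The set of vertices which are connected to `x` through the arrows in `S`. -/
def comp (src tgt : E → V) (S : Set E) (x : V) : Set V :=
  {u | ∀ c : V → Prop, (∀ δ ∈ S, c (src δ) ↔ c (tgt δ)) → c x → c u}

theorem mem_comp (S : Set E) (x : V) : x ∈ comp src tgt S x := fun _ _ h => h

theorem connBy_comp (S : Set E) (x : V) : ConnBy src tgt S (comp src tgt S x) := by
  intro c hc u hu v hv h
  refine hv c hc (not_not.1 fun hx => ?_)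
  exact hu (fun v => ¬ c v) (fun δ hδ => not_congr (hc δ hδ)) hx h

theorem comp_closed {S : Set E} {x : V} {e : E} (he : e ∈ S) :
    src e ∈ comp src tgt S x ↔ tgt e ∈ comp src tgt S x :=
  ⟨fun h c hc hx => (hc e he).1 (h c hc hx), fun h c hc hx => (hc e he).2 (h c hc hx)⟩

theorem IsTree.exists_touching (hT : IsTree src tgt) {S : Set E} {e₀ : E} (he₀ : e₀ ∉ S) (x : V) :
    ∃ e ∉ S, src e ∈ comp src tgt S x ∨ tgt e ∈ comp src tgt S x := by
  by_contra! h
  refine (h e₀ he₀).1 (hT.conn (· ∈ comp src tgt S x) (fun δ => ?_) _ _ (mem_comp S x))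
  by_cases hδ : δ ∈ S
  · exact comp_closed hδ
  · exact iff_of_false (h δ hδ).1 (h δ hδ).2

/-- A walk with distinct arrows outside the path `π`, starting at a vertex of `π`. -/
structure IsTrail (src tgt : E → V) (x : V) (π p₁ p₂ : List E) (v : V) (l : List (E × Bool))
    (w : V) : Prop where
  eq : π = p₁ ++ p₂
  route : IsRoute src tgt x p₁ v
  walk : IsWalk src tgt v l w
  nodup : (π ++ l.map Prod.fst).Nodup

theorem IsTrail.snoc {x : V} {π p₁ p₂ : List E} {v : V} {l : List (E × Bool)} {w : V}
    (h : IsTrail src tgt x π p₁ p₂ v l w) {e : E} (he : e ∉ π ++ l.map Prod.fst)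
    (hw : src e = w ∨ tgt e = w) :
    ∃ (b : Bool) (w' : V), IsTrail src tgt x π p₁ p₂ v (l ++ [(e, b)]) w' := by
  have hn : ∀ b, (π ++ (l ++ [(e, b)]).map Prod.fst).Nodup := fun b => by
    rw [List.map_append, ← List.append_assoc]
    refine List.nodup_append.2 ⟨h.nodup, by simp, ?_⟩
    rintro a ha _ hb rfl
    simp at hb
    exact he (hb ▸ ha)
  rcases hw with rfl | rfl
  · exact ⟨true, _, h.eq, h.route, isWalk_append.2 ⟨_, h.walk, rfl, rfl⟩, hn _⟩
  · exact ⟨false, _, h.eq, h.route, isWalk_append.2 ⟨_, h.walk, rfl, rfl⟩, hn _⟩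

theorem Comparable.exists_longer_trail (hT : IsTree src tgt) {x y : V} {π : List E}
    (hr : IsRoute src tgt x π y) (hC : Comparable k src tgt x π)
    {p₁ p₂ : List E} {v : V} {l : List (E × Bool)} {w : V}
    (h : IsTrail src tgt x π p₁ p₂ v l w) {e₀ : E} (he₀ : e₀ ∉ π ++ l.map Prod.fst) :
    ∃ (p₁ p₂ : List E) (v : V) (l' : List (E × Bool)) (w : V),
      IsTrail src tgt x π p₁ p₂ v l' w ∧ l'.length = l.length + 1 := by
  obtain ⟨e, heS, he⟩ := hT.exists_touching (S := {e | e ∈ π ++ l.map Prod.fst}) he₀ x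
  rcases l.eq_nil_or_concat with rfl | ⟨l', s, rfl⟩
  · have hπ : π.Nodup := by simpa using h.nodup
    have hs : ∀ u ∈ comp src tgt {e | e ∈ π ++ ([] : List (E × Bool)).map Prod.fst} x,
        ∃ p₁ p₂, π = p₁ ++ p₂ ∧ IsRoute src tgt x p₁ u := by
      intro u hu
      refine hu (fun u => ∃ p₁ p₂, π = p₁ ++ p₂ ∧ IsRoute src tgt x p₁ u)
        (fun δ hδ => iff_of_true ?_ ?_) ⟨[], π, rfl, rfl⟩
      · obtain ⟨q₁, q₂, rfl⟩ := List.append_of_mem (by simpa using hδ : δ ∈ π)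
        obtain ⟨u', hu, hu'⟩ := isRoute_append.1 hr
        exact ⟨q₁, _, rfl, hu'.1 ▸ hu⟩
      · obtain ⟨q₁, q₂, rfl⟩ := List.append_of_mem (by simpa using hδ : δ ∈ π)
        obtain ⟨u', hu, hu'⟩ := isRoute_append.1 hr
        exact ⟨q₁ ++ [δ], q₂, by simp, isRoute_append.2 ⟨_, hu, hu'.1, rfl⟩⟩
    have : ∃ u, (src e = u ∨ tgt e = u) ∧
        u ∈ comp src tgt {e | e ∈ π ++ ([] : List (E × Bool)).map Prod.fst} x := by
      rcases he with he | he
      · exact ⟨_, .inl rfl, he⟩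
      · exact ⟨_, .inr rfl, he⟩
    obtain ⟨u, hu, hu'⟩ := this
    obtain ⟨q₁, q₂, hq, hq'⟩ := hs u hu'
    have ht : IsTrail src tgt x π q₁ q₂ u [] u := ⟨hq, hq', rfl, by simpa using hπ⟩
    obtain ⟨b, w', hb⟩ := ht.snoc heS hu
    exact ⟨q₁, q₂, u, _, w', hb, rfl⟩
  · rw [List.concat_eq_append] at *
    set T := comp src tgt {e | e ∈ π ++ l'.map Prod.fst} x
    have hcl : ∀ e ∈ π ++ l'.map Prod.fst, src e ∈ T ↔ tgt e ∈ T := fun e he => comp_closed he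
    have hx : x ∈ T := mem_comp _ _
    obtain ⟨hy, hπT⟩ := hr.closed (c := (· ∈ T)) (fun e he => hcl e (by simp [he])) hx
    have hv : v ∈ T := (h.route.closed (c := (· ∈ T))
      (fun e he => hcl e (by simp [h.eq, he])) hx).1
    obtain ⟨u, hu, hs⟩ := isWalk_append.1 h.walk
    obtain ⟨hu, hlT⟩ := hu.closed (c := (· ∈ T))
      (fun s hs => hcl s.1 (List.mem_append_right _ (List.mem_map_of_mem hs))) hv
    have hnot : src e ∉ T ∧ tgt e ∉ T := by
      have hsT : src s.1 ∈ T ∨ tgt s.1 ∈ T := by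
        obtain ⟨e, _ | _⟩ := s <;> obtain ⟨rfl, -⟩ := hs
        · exact .inr hu
        · exact .inl hu
      have hsn : s.1 ∉ π ++ l'.map Prod.fst := by
        have := h.nodup
        rw [List.map_append, ← List.append_assoc, List.nodup_append] at this
        exact fun hs => this.2.2 _ hs _ (by simp) rfl
      have heS' : e ≠ s.1 ∧ e ∉ π ++ l'.map Prod.fst := by
        simp at heS ⊢
        tauto
      rw [← not_or]
      exact fun he => hC.false_of_two_arrows (connBy_comp _ _) hx
        (fun e he => List.mem_append_left _ he) heS'.1 heS'.2 hsn he hsT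
    have hsub : ∀ u ∈ comp src tgt {e | e ∈ π ++ (l' ++ [s]).map Prod.fst} x, u ∈ T ∨ u = w := by
      intro t ht
      refine ht (fun u => u ∈ T ∨ u = w) (fun δ hδ => ?_) (.inl hx)
      simp only [List.map_append, List.mem_append, List.mem_map, Set.mem_ofPred_eq,
        List.map_cons, List.map_nil, List.mem_singleton] at hδ
      rcases hδ with hδ | ⟨s', hs', rfl⟩ | rfl
      · exact iff_of_true (.inl (hπT _ hδ).1) (.inl (hπT _ hδ).2)
      · exact iff_of_true (.inl (hlT _ hs').1) (.inl (hlT _ hs').2)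
      · obtain ⟨e, _ | _⟩ := s <;> obtain ⟨rfl, rfl⟩ := hs
        · exact iff_of_true (.inr rfl) (.inl hu)
        · exact iff_of_true (.inl hu) (.inr rfl)
    have hw : src e = w ∨ tgt e = w := by
      rcases he with he | he
      · exact .inl ((hsub _ he).resolve_left hnot.1)
      · exact .inr ((hsub _ he).resolve_left hnot.2)
    obtain ⟨b, w', hb⟩ := h.snoc heS hw
    exact ⟨p₁, p₂, v, _, w', hb, by simp⟩

theorem Comparable.exists_complete_trail [Fintype E] (hT : IsTree src tgt) {x y : V} {π : List E}
    (hr : IsRoute src tgt x π y) (hC : Comparable k src tgt x π) :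
    ∃ (p₁ p₂ : List E) (v : V) (l : List (E × Bool)) (w : V),
      IsTrail src tgt x π p₁ p₂ v l w ∧ ∀ e, e ∈ π ∨ e ∈ l.map Prod.fst := by
  by_contra! hno
  have key : ∀ n : ℕ, ∃ (p₁ p₂ : List E) (v : V) (l : List (E × Bool)) (w : V),
      IsTrail src tgt x π p₁ p₂ v l w ∧ l.length = n := by
    intro n
    induction n with
    | zero =>
      exact ⟨[], π, x, [], x, ⟨rfl, rfl, rfl, by simpa using hT.nodup_of_isRoute hr⟩, rfl⟩
    | succ n ih =>
      obtain ⟨p₁, p₂, v, l, w, h, rfl⟩ := ih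
      obtain ⟨e, he⟩ := hno _ _ _ _ _ h
      exact hC.exists_longer_trail hT hr h (e₀ := e) (by
        rw [List.mem_append]; exact not_or.2 he)
  obtain ⟨p₁, p₂, v, l, w, h, hl⟩ := key (Fintype.card E + 1)
  have := h.nodup.length_le_card
  simp at this
  omega

/-- The quiver is the path `π` extended at its end by a walk. -/
def IsLinear (src tgt : E → V) (y : V) (π : List E) : Prop :=
  ∃ l w, IsWalk src tgt y l w ∧ (π ++ l.map Prod.fst).Nodup ∧ ∀ e, e ∈ π ∨ e ∈ l.map Prod.fst

/-- The quiver is the path `π` with one additional arrow at the end of its first arrow. -/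
def IsFork (src tgt : E → V) (π : List E) : Prop :=
  ∃ α π' s w, π = α :: π' ∧ IsWalk src tgt (tgt α) [s] w ∧ s.1 ∉ π ∧ ∀ e, e ∈ π ∨ e = s.1

theorem Comparable.classification [Fintype E] (hT : IsTree src tgt) {x y : V} {π : List E}
    (hr : IsRoute src tgt x π y) (hC : Comparable k src tgt x π) :
    IsLinear src tgt y π ∨ IsLinear tgt src x π.reverse ∨ IsFork src tgt π ∨
      IsFork tgt src π.reverse := by
  obtain ⟨p₁, p₂, v, l, w, ⟨hπ, hp, hl, hn⟩, hall⟩ := hC.exists_complete_trail hT hr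
  have hlin : l = [] → IsLinear src tgt y π := by
    rintro rfl
    exact ⟨[], y, rfl, hn, hall⟩
  have hop := hC.op hr
  have hrop := isRoute_reverse hr
  subst hπ
  obtain ⟨v', hp', hp₂⟩ := isRoute_append.1 hr
  obtain rfl : v' = v := by
    clear * - hp hp'
    induction p₁ generalizing x with
    | nil => exact hp'.symm.trans hp
    | cons e p ih => exact ih hp.2 hp'.2
  rcases p₁.eq_nil_or_concat with rfl | ⟨p, α, rfl⟩
  · obtain rfl : x = v' := hp
    refine .inr (.inl ⟨_, w, hl.op, ?_, ?_⟩)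
    · simpa [List.nodup_append, Function.comp_def] using hn
    · simpa [Function.comp_def] using hall
  rw [List.concat_eq_append] at *
  obtain ⟨u, hpu, hα⟩ := isRoute_append.1 hp
  obtain ⟨hαs, hαt⟩ : src α = u ∧ tgt α = v' := hα
  subst hαt
  obtain _ | ⟨β, q⟩ := p₂
  · obtain rfl : tgt α = y := hp₂
    exact .inl ⟨l, w, hl, by simpa using hn, by simpa using hall⟩
  have hπn := (List.nodup_append.1 hn).1
  have hdis := (List.nodup_append.1 hn).2.2
  have hln := (List.nodup_append.1 hn).2.1
  have e1 : p ++ [α] ++ β :: q = p ++ α :: β :: q := by simp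
  have e2 : (p ++ [α] ++ β :: q).reverse = q.reverse ++ β :: α :: p.reverse := by simp
  have hβs : src β = tgt α := hp₂.1
  have hmem : ∀ s ∈ l, s.1 ∉ p ++ [α] ++ β :: q := fun s hs hh =>
    hdis _ hh _ (List.mem_map_of_mem hs) rfl
  have hmem' : ∀ s ∈ l, s.1 ∉ (p ++ [α] ++ β :: q).reverse := fun s hs hh =>
    hmem s hs (List.mem_reverse.1 hh)
  have hπn' := List.nodup_reverse.2 hπn
  rw [e2] at hop hrop hmem' hπn' ⊢
  obtain _ | ⟨s, _ | ⟨s', l⟩⟩ := l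
  · exact .inl (hlin rfl)
  · rcases p.eq_nil_or_concat with rfl | ⟨p, α', rfl⟩
    · exact .inr (.inr (.inl ⟨α, β :: q, s, w, rfl, hl, hmem s (by simp), by simpa using hall⟩))
    obtain _ | ⟨β', q⟩ := q
    · refine .inr (.inr (.inr ⟨β, α :: (p.concat α').reverse, (s.1, !s.2), w, rfl, hβs ▸ hl.op,
        hmem' s (by simp), fun e => ?_⟩))
      have := hall e
      simp at this ⊢
      tauto
    · exfalso
      have e3 : p.concat α' ++ [α] ++ β :: β' :: q = p ++ α' :: α :: β :: β' :: q := by simp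
      have e4 : (β' :: q).reverse ++ β :: α :: (p.concat α').reverse =
        q.reverse ++ β' :: β :: α :: α' :: p.reverse := by simp
      rw [e4] at hop hrop hmem' hπn'
      rw [e3] at hC hr hmem hπn
      obtain ⟨e, _ | _⟩ := s
      · exact hop.false_of_central_branch hrop hπn' (hmem' (e, false) (by simp))
          (hl.1.trans hβs.symm)
      · exact hC.false_of_central_branch hr hπn (hmem (e, true) (by simp)) hl.1
  · exfalso
    rw [e1] at hC hr hmem hπn
    have hne : s.1 ≠ s'.1 := by
      rintro h
      simp [h] at hln
    obtain ⟨e, _ | _⟩ := s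
    · obtain ⟨h1, h2⟩ := hl
      refine hop.false_of_long_branch hrop hπn' (hmem' (e, false) (by simp))
        (hmem' s' (by simp)) hne
        (h1.trans hβs.symm) ?_
      obtain ⟨e', _ | _⟩ := s'
      exacts [.inl h2.1, .inr h2.1]
    · obtain ⟨h1, h2⟩ := hl
      refine hC.false_of_long_branch hr hπn (hmem (e, true) (by simp)) (hmem s' (by simp)) hne h1 ?_
      obtain ⟨e', _ | _⟩ := s'
      exacts [.inr h2.1, .inl h2.1]

end TreeQuiver

/-! ## Projective and injective modules over the algebra of a tree -/

namespace QPath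

variable {V E : Type} {src tgt : E → V}

theorem arrows_comp {a b c : V} (p : QPath src tgt a b) (q : QPath src tgt b c) :
    (p.comp q).arrows = p.arrows ++ q.arrows := by
  induction q with
  | nil => simp only [comp, arrows, List.append_nil]
  | cons q α h ih => simp only [comp, arrows, ih, List.append_assoc]

theorem arrows_single (α : E) : (single src tgt α).arrows = [α] := by
  simp only [single, arrows, List.nil_append]

end QPath

namespace QuiverPresentation

open TreeQuiver

variable {k A V E : Type} [Field k] [Ring A] [Algebra k A] [Fintype V] [Fintype E]
  {P : QuiverPresentation k A V E}

/-- Linear statements about elements of the algebra can be checked on paths. -/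
theorem path_induction {C : A → Prop} (x : A)
    (hp : ∀ (a b : V) (p : QPath P.src P.tgt a b), C (P.qprod p)) (h0 : C 0)
    (hadd : ∀ x y, C x → C y → C (x + y)) (hk : ∀ (c : k) x, C x → C (c • x)) : C x := by
  have hx : x ∈ Submodule.span k {x : A | ∃ (a b : V) (p : QPath P.src P.tgt a b),
      P.qprod p = x} := by rw [P.span_qprod]; trivial
  induction hx using Submodule.span_induction with
  | mem x hx => obtain ⟨a, b, p, rfl⟩ := hx; exact hp a b p
  | zero => exact h0
  | add x y _ _ hx hy => exact hadd x y hx hy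
  | smul c x _ hx => exact hk c x hx

theorem qprod_eq_idem (hT : IsTree P.src P.tgt) {v : V} (p : QPath P.src P.tgt v v) :
    P.qprod p = P.idem v := by
  have := QPath.subsingleton_of_isTree hT v v
  rw [Subsingleton.elim p (.nil v), qprod]

theorem exists_idem_mul_idem (hT : IsTree P.src P.tgt) (v : V) (x : A) :
    ∃ c : k, P.idem v * x * P.idem v = c • P.idem v := by
  induction x using P.path_induction with
  | hp a b p =>
    by_cases ha : a = v
    · by_cases hb : b = v
      · subst ha; subst hb
        exact ⟨1, by rw [P.qprod_eq_idem hT, P.idem_idem, P.idem_idem, one_smul]⟩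
      · refine ⟨0, ?_⟩
        rw [← P.idem_mul_qprod p, ← mul_assoc, P.idem_orth v b (Ne.symm hb), zero_mul, zero_mul,
          zero_smul]
    · refine ⟨0, ?_⟩
      rw [← P.qprod_mul_idem p, mul_assoc, mul_assoc, P.idem_orth a v ha, mul_zero, mul_zero,
        zero_smul]
  | h0 => exact ⟨0, by simp⟩
  | hadd x y hx hy =>
    obtain ⟨c, hc⟩ := hx
    obtain ⟨d, hd⟩ := hy
    exact ⟨c + d, by rw [mul_add, add_mul, hc, hd, add_smul]⟩
  | hk c x hx =>
    obtain ⟨d, hd⟩ := hx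
    exact ⟨c * d, by rw [mul_smul_comm, smul_mul_assoc, hd, mul_smul]⟩

theorem idem_mul_mul_arrow (hT : IsTree P.src P.tgt) (α : E) (x : A) :
    P.idem (P.src α) * x * P.arrow α = 0 := by
  induction x using P.path_induction with
  | hp a b p =>
    by_cases ha : a = P.tgt α
    · by_cases hb : b = P.src α
      · subst ha; subst hb
        exact absurd p.isRoute_arrows hT.not_isRoute_src
      · rw [← P.idem_mul_qprod p, ← mul_assoc, P.idem_orth _ b (Ne.symm hb), zero_mul, zero_mul]
    · rw [← P.qprod_mul_idem p, ← P.idem_mul_arrow, mul_assoc, mul_assoc,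
        ← mul_assoc (P.idem a), P.idem_orth a _ ha, zero_mul, mul_zero, mul_zero]
  | h0 => simp
  | hadd x y hx hy => rw [mul_add, add_mul, hx, hy, add_zero]
  | hk c x hx => rw [mul_smul_comm, smul_mul_assoc, hx, smul_zero]

theorem sum_idem_smul {M : Type} [AddCommGroup M] [Module A M] (m : M) :
    ∑ v, P.idem v • m = m := by
  rw [← Finset.sum_smul, P.sum_idem, one_smul]

theorem arrow_smul_idem_smul {M : Type} [AddCommGroup M] [Module A M] (α : E) (m : M) :
    P.arrow α • P.idem (P.src α) • m = P.arrow α • m := by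
  rw [smul_smul, P.arrow_mul_idem]

theorem idem_smul_arrow_smul {M : Type} [AddCommGroup M] [Module A M] (α : E) (m : M) :
    P.idem (P.tgt α) • P.arrow α • m = P.arrow α • m := by
  rw [smul_smul, P.idem_mul_arrow]

theorem idem_smul_arrow_smul_of_ne {M : Type} [AddCommGroup M] [Module A M] {α : E} {v : V}
    (h : v ≠ P.tgt α) (m : M) : P.idem v • P.arrow α • m = 0 := by
  rw [← P.idem_smul_arrow_smul, smul_smul, P.idem_orth _ _ h, zero_smul]

theorem arrow_smul_eq_zero_of_ne {M : Type} [AddCommGroup M] [Module A M] {α : E} {v : V}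
    (h : P.src α ≠ v) {m : M} (hm : P.idem v • m = m) : P.arrow α • m = 0 := by
  rw [← hm, ← P.arrow_smul_idem_smul, smul_smul (P.idem _), P.idem_orth _ _ h, zero_smul, smul_zero]

/-- The element `p` generates `M` as an indecomposable projective module at `a`. -/
structure IsProjGen (P : QuiverPresentation k A V E) (a : V) {M : ModuleCat.{0} A} (p : M)
    (σ : M →ₗ[A] A) : Prop where
  idem_smul : P.idem a • p = p
  map_gen : σ p = P.idem a
  map_smul : ∀ m, σ m • p = m

theorem exists_isProjGen [FiniteDimensional k A] (hT : IsTree P.src P.tgt) {a : V}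
    {M : ModuleCat.{0} A} (h : IsProjAt P a M) :
    ∃ (p : M) (σ : M →ₗ[A] A), IsProjGen P a p σ := by
  have := IsArtinianRing.of_finite k A
  obtain ⟨hproj, hM, S, f, ⟨hS, s₀, hs₀⟩, hf⟩ := h
  set s := P.idem a • s₀
  have hs : P.idem a • s = s := by rw [smul_smul, P.idem_idem]
  obtain ⟨τ, hτ⟩ := Module.projective_lifting_property (LinearMap.toSpanSingleton A S s) f.hom (by
    rw [← LinearMap.range_eq_top]
    refine (eq_bot_or_eq_top _).resolve_left fun hb => hs₀ ?_
    have : s ∈ LinearMap.range (LinearMap.toSpanSingleton A S s) := ⟨1, by simp⟩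
    rwa [hb, Submodule.mem_bot] at this)
  obtain ⟨p₀, hp₀⟩ := hf s
  set p := P.idem a • p₀
  have hp : P.idem a • p = p := by rw [smul_smul, P.idem_idem]
  have hfp : f.hom p = s := by
    change f.hom (P.idem a • p₀) = s
    rw [map_smul, show f.hom p₀ = s from hp₀, hs]
  let g : M →ₗ[A] M := LinearMap.toSpanSingleton A M p ∘ₗ τ
  have hg : ∀ m, g m = τ m • p := fun m => rfl
  have hfg : ∀ m, f.hom (g m) = f.hom m := fun m => by
    rw [hg, map_smul, hfp, ← hτ]
    rfl
  have hbij : Function.Bijective g := by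
    refine (hM.bijective_or_nilpotent g).resolve_right ?_
    rintro ⟨n, hn⟩
    have : ∀ n : ℕ, f.hom ((g ^ n) p) = f.hom p := fun n => by
      induction n with
      | zero => rfl
      | succ n ih => rw [pow_succ', Module.End.mul_apply, hfg, ih]
    have := this n
    rw [hn, hfp] at this
    exact hs₀ (by simpa using this.symm)
  let e := LinearEquiv.ofBijective g hbij
  have he : ∀ m, τ (e.symm m) • p = m := fun m => by
    rw [← hg]
    exact e.apply_symm_apply m
  refine ⟨p, LinearMap.toSpanSingleton A A (P.idem a) ∘ₗ τ ∘ₗ e.symm.toLinearMap, hp, ?_,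
    fun m => ?_⟩
  · have hidem : P.idem a * τ (e.symm p) = τ (e.symm p) := by
      have := congrArg (fun m => τ (e.symm m)) hp
      simpa only [map_smul, smul_eq_mul] using this
    obtain ⟨c, hc⟩ := exists_idem_mul_idem hT a (τ (e.symm p))
    rw [hidem] at hc
    change τ (e.symm p) * P.idem a = P.idem a
    have hp1 : algebraMap k A c • p = p := by
      calc algebraMap k A c • p = (c • P.idem a) • p := by rw [Algebra.smul_def, mul_smul, hp]
        _ = τ (e.symm p) • p := by rw [← hc, mul_smul, hp]
        _ = p := he p
    have : c = 1 := by
      by_contra hc1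
      have h0 : algebraMap k A (c - 1) • p = 0 := by
        rw [map_sub, sub_smul, hp1, map_one, one_smul, sub_self]
      refine hs₀ ?_
      rw [← hfp, ← one_smul A p, ← map_one (algebraMap k A), ← inv_mul_cancel₀ (sub_ne_zero.2 hc1),
        map_mul, mul_smul, h0, smul_zero, map_zero]
    rw [hc, this, one_smul]
  · change (τ (e.symm m) * P.idem a) • p = m
    rw [mul_smul, hp, he]

/-- The element `s` cogenerates `M` as an indecomposable injective module at `b`. -/
structure IsInjCogen (P : QuiverPresentation k A V E) (b : V) {M : ModuleCat.{0} A}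
    (s : M) : Prop where
  ne_zero : s ≠ 0
  idem_smul : P.idem b • s = s
  exists_smul : ∀ w : M, w ≠ 0 → ∃ x : A, x • w = s

theorem exists_isInjCogen [FiniteDimensional k A] {b : V}
    {M : ModuleCat.{0} A} (h : IsInjAt P b M) : ∃ s : M, IsInjCogen P b s := by
  have := IsArtinianRing.of_finite k A
  obtain ⟨hinj, hM, S, f, ⟨hS, s₀, hs₀⟩, hf⟩ := h
  have hf' : Function.Injective f.hom := hf
  have hs : f.hom (P.idem b • s₀) ≠ 0 := fun h => hs₀ (hf' (h.trans (map_zero _).symm))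
  refine ⟨f.hom (P.idem b • s₀), hs, ?_, fun w hw => ?_⟩
  · rw [← map_smul, smul_smul, P.idem_idem]
  set N := Submodule.span A {w}
  by_contra hno
  have hN : Submodule.comap f.hom N = ⊥ := by
    refine (eq_bot_or_eq_top _).resolve_right fun htop => hno ?_
    have : P.idem b • s₀ ∈ Submodule.comap f.hom N := by rw [htop]; trivial
    exact Submodule.mem_span_singleton.1 this
  obtain ⟨h, hh⟩ := hinj.out (N.mkQ ∘ₗ f.hom) (by
    rw [← LinearMap.ker_eq_bot, LinearMap.ker_comp, Submodule.ker_mkQ, hN]) f.hom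
  have hfix : ∀ z, (h ∘ₗ N.mkQ) (f.hom z) = f.hom z := hh
  rcases hM.bijective_or_nilpotent (h ∘ₗ N.mkQ) with hb | ⟨n, hn⟩
  · refine hw (hb.1 ?_)
    rw [map_zero, LinearMap.comp_apply, (Submodule.Quotient.mk_eq_zero N).2
      (Submodule.mem_span_singleton_self w) |> fun h => (h : N.mkQ w = 0), map_zero]
  · refine hs ?_
    have : ∀ n : ℕ, ((h ∘ₗ N.mkQ) ^ n) (f.hom (P.idem b • s₀)) =
        f.hom (P.idem b • s₀) := fun n => by
      induction n with
      | zero => rfl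
      | succ n ih => rw [pow_succ', Module.End.mul_apply, ih, hfix]
    rw [← this n, hn]
    rfl

end QuiverPresentation

/-! ## The radical of a projective module and the socle of an injective module -/

namespace QuiverPresentation

open TreeQuiver

variable {k A V E : Type} [Field k] [Ring A] [Algebra k A] [Fintype V] [Fintype E]
  {P : QuiverPresentation k A V E}

namespace IsProjGen

variable {a : V} {M : ModuleCat.{0} A} {p : M} {σ : M →ₗ[A] A}

theorem idem_smul_smul_arrow_smul (hT : IsTree P.src P.tgt) (h : IsProjGen P a p σ) (α : E)
    (x : A) :
    P.idem a • x • P.arrow α • p = 0 := by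
  by_cases hα : P.src α = a
  · subst hα
    rw [smul_smul, smul_smul, idem_mul_mul_arrow hT, zero_smul]
  · rw [arrow_smul_eq_zero_of_ne hα h.idem_smul, smul_zero, smul_zero]

theorem arrow_smul_mem (hT : IsTree P.src P.tgt) (h : IsProjGen P a p σ) (α : E) :
    P.arrow α • p ∈ radOf A M := by
  refine Submodule.mem_sInf.2 fun N hN => ?_
  by_contra hα
  have htop : N ⊔ Submodule.span A {P.arrow α • p} = ⊤ := by
    refine hN.2 _ (lt_of_le_of_ne le_sup_left fun heq => hα ?_)
    rw [heq]
    exact Submodule.mem_sup_right (Submodule.mem_span_singleton_self _)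
  have hp : p ∈ N ⊔ Submodule.span A {P.arrow α • p} := by rw [htop]; trivial
  obtain ⟨n, hn, z, hz, hnz⟩ := Submodule.mem_sup.1 hp
  obtain ⟨x, rfl⟩ := Submodule.mem_span_singleton.1 hz
  have hpN : p ∈ N := by
    have := congrArg (fun m => P.idem a • m) hnz
    simp only [smul_add, h.idem_smul_smul_arrow_smul hT, add_zero, h.idem_smul] at this
    rw [← this]
    exact N.smul_mem _ hn
  refine hN.1 (eq_top_iff.2 fun m _ => ?_)
  rw [← h.map_smul m]
  exact N.smul_mem _ hpN

theorem radOf_le (h : IsProjGen P a p σ) :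
    radOf A M ≤ Submodule.span A (Set.range fun α => P.arrow α • p) := by
  set N := Submodule.span A (Set.range fun α => P.arrow α • p)
  have hdec : ∀ x : A, ∃ c : k, x • p - algebraMap k A c • p ∈ N := by
    intro x
    induction x using P.path_induction with
    | hp u b q =>
      by_cases hu : u = a
      · subst hu
        by_cases hq : q.length = 0
        · cases q with
          | nil =>
            refine ⟨1, ?_⟩
            rw [qprod, h.idem_smul, map_one, one_smul, sub_self]
            exact N.zero_mem
          | cons => simp [QPath.length] at hq
        · obtain ⟨α, hα, r, rfl⟩ := q.exists_eq_single_comp hq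
          subst hα
          refine ⟨0, ?_⟩
          rw [P.qprod_comp, P.qprod_single, map_zero, zero_smul, sub_zero, mul_smul]
          exact N.smul_mem _ (Submodule.subset_span ⟨α, rfl⟩)
      · refine ⟨0, ?_⟩
        rw [← P.qprod_mul_idem q, ← h.idem_smul, smul_smul, mul_assoc, P.idem_orth u a hu, mul_zero,
          zero_smul, map_zero, zero_smul, sub_zero]
        exact N.zero_mem
    | h0 => exact ⟨0, by simp⟩
    | hadd x y hx hy =>
      obtain ⟨c, hc⟩ := hx
      obtain ⟨d, hd⟩ := hy
      refine ⟨c + d, ?_⟩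
      rw [add_smul, map_add, add_smul, add_sub_add_comm]
      exact N.add_mem hc hd
    | hk c x hx =>
      obtain ⟨d, hd⟩ := hx
      refine ⟨c * d, ?_⟩
      rw [Algebra.smul_def, map_mul, mul_smul, mul_smul, ← smul_sub]
      exact N.smul_mem _ hd
  by_cases htop : N = ⊤
  · rw [htop]; exact le_top
  refine sInf_le ⟨htop, fun N' hN' => ?_⟩
  obtain ⟨hle, m, hm, hmN⟩ := SetLike.lt_iff_le_and_exists.1 hN'
  obtain ⟨c, hc⟩ := hdec (σ m)
  rw [h.map_smul] at hc
  have hc0 : c ≠ 0 := by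
    rintro rfl
    rw [map_zero, zero_smul, sub_zero] at hc
    exact hmN hc
  have hcp : algebraMap k A c • p ∈ N' := by
    have := N'.sub_mem hm (hle hc)
    rwa [sub_sub_cancel] at this
  have hpN : p ∈ N' := by
    have := N'.smul_mem (algebraMap k A c⁻¹) hcp
    rwa [smul_smul, ← map_mul, inv_mul_cancel₀ hc0, map_one, one_smul] at this
  refine eq_top_iff.2 fun m _ => ?_
  rw [← h.map_smul m]
  exact N'.smul_mem _ hpN

theorem idem_smul_radOf (hT : IsTree P.src P.tgt) (h : IsProjGen P a p σ) {m : M}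
    (hm : m ∈ radOf A M) : P.idem a • m = 0 := by
  have key : ∀ x : A, P.idem a • x • m = 0 := by
    have := h.radOf_le hm
    clear hm
    induction this using Submodule.span_induction with
    | mem m hm => obtain ⟨α, rfl⟩ := hm; exact fun x => h.idem_smul_smul_arrow_smul hT α x
    | zero => exact fun x => by rw [smul_zero, smul_zero]
    | add m m' _ _ ih ih' =>
      exact fun x => by rw [smul_add, smul_add, ih, ih', add_zero]
    | smul y m _ ih =>
      exact fun x => by rw [smul_smul x, ih]
  simpa using key 1

theorem exists_arrow_ne_zero (hT : IsTree P.src P.tgt) (h : IsProjGen P a p σ) {N : Type}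
    [AddCommGroup N] [Module A N] {f : radOf A M →ₗ[A] N} (hf : f ≠ 0) :
    ∃ α, P.src α = a ∧ f ⟨P.arrow α • p, h.arrow_smul_mem hT α⟩ ≠ 0 := by
  by_contra! hno
  have hα : ∀ α, f ⟨P.arrow α • p, h.arrow_smul_mem hT α⟩ = 0 := fun α => by
    by_cases hα : P.src α = a
    · exact hno α hα
    · rw [show (⟨P.arrow α • p, h.arrow_smul_mem hT α⟩ : radOf A M) = 0 from
        Subtype.ext (arrow_smul_eq_zero_of_ne hα h.idem_smul), map_zero]
  have hle : radOf A M ≤ (LinearMap.ker f).map (radOf A M).subtype :=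
    h.radOf_le.trans (Submodule.span_le.2 (by
      rintro _ ⟨α, rfl⟩
      exact ⟨⟨P.arrow α • p, h.arrow_smul_mem hT α⟩, hα α, rfl⟩))
  refine hf (LinearMap.ext fun m => ?_)
  obtain ⟨m', hm', hmm⟩ := hle m.2
  rw [← show m' = m from Subtype.ext hmm]
  exact hm'

end IsProjGen

namespace IsInjCogen

variable {b : V} {M : ModuleCat.{0} A} {s : M}

theorem exists_idem_smul_eq (hT : IsTree P.src P.tgt) (h : IsInjCogen P b s) {w : M}
    (hw : P.idem b • w = w) : ∃ c : k, w = algebraMap k A c • s := by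
  by_cases h0 : w = 0
  · exact ⟨0, by simp [h0]⟩
  obtain ⟨x, hx⟩ := h.exists_smul w h0
  obtain ⟨c, hc⟩ := exists_idem_mul_idem hT b x
  have hs : s = algebraMap k A c • w := by
    calc s = (P.idem b * x * P.idem b) • w := by rw [mul_smul, mul_smul, hw, hx, h.idem_smul]
      _ = _ := by rw [hc, Algebra.smul_def, mul_smul, hw]
  have hc0 : c ≠ 0 := by
    rintro rfl
    exact h.ne_zero (by simpa using hs)
  exact ⟨c⁻¹, by rw [hs, smul_smul, ← map_mul, inv_mul_cancel₀ hc0, map_one, one_smul]⟩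

theorem arrow_smul (hT : IsTree P.src P.tgt) (h : IsInjCogen P b s) (α : E) :
    P.arrow α • s = 0 := by
  by_contra h0
  have hα : P.src α = b := by
    by_contra hα
    exact h0 (arrow_smul_eq_zero_of_ne hα h.idem_smul)
  obtain ⟨x, hx⟩ := h.exists_smul _ h0
  refine h.ne_zero ?_
  subst hα
  rw [← h.idem_smul, ← hx, smul_smul, smul_smul, idem_mul_mul_arrow hT, zero_smul]

theorem mem_socOf_iff (hT : IsTree P.src P.tgt) (h : IsInjCogen P b s) {w : M} :
    w ∈ socOf A M ↔ ∃ c : k, w = algebraMap k A c • s := by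
  have hmem : ∀ {N : Submodule A M}, N ≠ ⊥ → s ∈ N := fun hN => by
    obtain ⟨w, hw, hw0⟩ := Submodule.exists_mem_ne_zero_of_ne_bot hN
    obtain ⟨x, rfl⟩ := h.exists_smul w hw0
    exact Submodule.smul_mem _ _ hw
  have hatom : IsAtom (Submodule.span A {s}) := by
    refine ⟨fun h0 => h.ne_zero (by simpa using h0), fun N hN => ?_⟩
    by_contra hb
    exact hN.not_ge (Submodule.span_le.2 (Set.singleton_subset_iff.2 (hmem hb)))
  have heq : socOf A M = Submodule.span A {s} := by
    refine le_antisymm (sSup_le fun N hN => ?_) (le_sSup hatom)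
    have hle : Submodule.span A {s} ≤ N :=
      Submodule.span_le.2 (Set.singleton_subset_iff.2 (hmem hN.1))
    rcases hN.le_iff.1 hle with h0 | h0
    · exact absurd h0 hatom.1
    · rw [h0]
  rw [heq, Submodule.mem_span_singleton]
  constructor
  · rintro ⟨x, rfl⟩
    induction x using P.path_induction with
    | hp u v q =>
      by_cases hq : q.length = 0
      · cases q with
        | nil =>
          by_cases hu : u = b
          · exact ⟨1, by rw [qprod, hu, h.idem_smul, map_one, one_smul]⟩
          · refine ⟨0, ?_⟩
            rw [qprod, ← h.idem_smul, smul_smul, P.idem_orth _ _ hu, zero_smul, map_zero, zero_smul]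
        | cons => simp [QPath.length] at hq
      · obtain ⟨α, hα, r, rfl⟩ := q.exists_eq_single_comp hq
        subst hα
        exact ⟨0, by rw [P.qprod_comp, P.qprod_single, mul_smul, h.arrow_smul hT, smul_zero,
          map_zero, zero_smul]⟩
    | h0 => exact ⟨0, by simp⟩
    | hadd x y hx hy =>
      obtain ⟨c, hc⟩ := hx
      obtain ⟨d, hd⟩ := hy
      exact ⟨c + d, by rw [add_smul, hc, hd, map_add, add_smul]⟩
    | hk c x hx =>
      obtain ⟨d, hd⟩ := hx
      exact ⟨c * d, by rw [Algebra.smul_def, mul_smul, hd, map_mul, mul_smul]⟩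
  · rintro ⟨c, rfl⟩
    exact ⟨_, rfl⟩

theorem arrow_smul_of_mem (hT : IsTree P.src P.tgt) (h : IsInjCogen P b s) {w : M}
    (hw : w ∈ socOf A M) (α : E) : P.arrow α • w = 0 := by
  obtain ⟨c, rfl⟩ := (h.mem_socOf_iff hT).1 hw
  rw [smul_smul, ← Algebra.commutes, mul_smul, h.arrow_smul hT, smul_zero]

theorem exists_path (h : IsInjCogen P b s) {w : M} (hw : w ≠ 0) :
    ∃ (v : V) (q : QPath P.src P.tgt v b), P.qprod q • w ≠ 0 := by
  by_contra! hno
  obtain ⟨x, hx⟩ := h.exists_smul w hw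
  have : ∀ x : A, P.idem b • x • w = 0 := fun x => by
    induction x using P.path_induction with
    | hp u v q =>
      by_cases hv : v = b
      · subst hv; rw [hno, smul_zero]
      · rw [← P.idem_mul_qprod, smul_smul, ← mul_assoc, P.idem_orth _ _ (Ne.symm hv), zero_mul,
          zero_smul]
    | h0 => simp
    | hadd x y hx hy => rw [add_smul, smul_add, hx, hy, add_zero]
    | hk c x hx =>
      rw [Algebra.smul_def, mul_smul, smul_smul, ← Algebra.commutes, mul_smul, hx, smul_zero]
  exact h.ne_zero (by rw [← h.idem_smul, ← hx, this])

theorem exists_arrow_ne_zero (hT : IsTree P.src P.tgt) (h : IsInjCogen P b s) {w : M}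
    (hw : w ∉ socOf A M) : ∃ β, P.arrow β • w ≠ 0 := by
  by_contra! hno
  refine hw ?_
  rw [← P.sum_idem_smul w]
  refine Submodule.sum_mem _ fun v _ => ?_
  by_cases h0 : P.idem v • w = 0
  · rw [h0]; exact zero_mem _
  obtain ⟨u, q, hq⟩ := h.exists_path h0
  by_cases hl : q.length = 0
  · cases q with
    | nil =>
      rw [qprod] at hq
      have hv : v = b := by
        by_contra hv
        exact hq (by rw [smul_smul, P.idem_orth _ _ (Ne.symm hv), zero_smul])
      subst hv
      exact (h.mem_socOf_iff hT).2 (h.exists_idem_smul_eq hT (by rw [smul_smul, P.idem_idem]))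
    | cons => simp [QPath.length] at hl
  · obtain ⟨α, hα, r, rfl⟩ := q.exists_eq_single_comp hl
    subst hα
    refine absurd ?_ hq
    rw [P.qprod_comp, P.qprod_single, mul_smul]
    by_cases hv : v = P.src α
    · rw [hv, arrow_smul_idem_smul, hno, smul_zero]
    · rw [arrow_smul_eq_zero_of_ne (Ne.symm hv) (by rw [smul_smul, P.idem_idem]), smul_zero]

end IsInjCogen

end QuiverPresentation

/-! ## Modules with constant dimension vector -/

namespace TreeQuiver

theorem exists_qpath {V E : Type} {src tgt : E → V} {a b : V} {l : List E}
    (h : IsRoute src tgt a l b) : ∃ q : QPath src tgt a b, q.arrows = l := by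
  induction l generalizing a with
  | nil => obtain rfl : a = b := h; exact ⟨.nil a, by rw [QPath.arrows]⟩
  | cons e l ih =>
    obtain ⟨rfl, h⟩ := h
    obtain ⟨q, rfl⟩ := ih h
    exact ⟨(QPath.single src tgt e).comp q, by rw [QPath.arrows_comp, QPath.arrows_single]; rfl⟩

theorem IsTree.route_unique {V E : Type} {src tgt : E → V} (hT : IsTree src tgt) {a b : V}
    {l l' : List E} (h : IsRoute src tgt a l b) (h' : IsRoute src tgt a l' b) : l = l' := by
  obtain ⟨q, rfl⟩ := exists_qpath h
  obtain ⟨q', rfl⟩ := exists_qpath h'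
  rw [(QPath.subsingleton_of_isTree hT a b).elim q q']

end TreeQuiver

theorem QPath.val_eq_zero {V E R : Type} {src tgt : E → V} [Ring R] {ι : V → R} {f : E → R}
    {e : E} (he : f e = 0) {a b : V} (p : QPath src tgt a b) (h : e ∈ p.arrows) :
    p.val ι f = 0 := by
  induction p with
  | nil => simp [QPath.arrows] at h
  | cons p α hα ih =>
    rw [QPath.arrows, List.mem_append, List.mem_singleton] at h
    rw [QPath.val]
    rcases h with h | rfl
    · rw [ih h, mul_zero]
    · rw [he, zero_mul]

namespace QuiverPresentation

theorem IsRep.algebraMap_apply {k A V : Type} [Field k] [Ring A] [Algebra k A] {n : ℕ}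
    {Φ : A →ₐ[k] Module.End k (V → Fin n → k)} (c : k) (z : V → Fin n → k) :
    Φ (algebraMap k A c) z = c • z := by
  rw [AlgHom.commutes]; rfl

open TreeQuiver

variable {k A V E : Type} [Field k] [Ring A] [Algebra k A] [Fintype V] [Fintype E]
  {P : QuiverPresentation k A V E} {n n' : ℕ}

theorem wprod_nil : P.wprod [] = 1 := rfl

theorem wprod_cons (e : E) (l : List E) : P.wprod (e :: l) = P.wprod l * P.arrow e := by
  simp [wprod]

theorem wprod_append (l l' : List E) : P.wprod (l ++ l') = P.wprod l' * P.wprod l := by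
  simp [wprod]

theorem qprod_eq_wprod {a b : V} (p : QPath P.src P.tgt a b) :
    P.qprod p = P.wprod p.arrows * P.idem a := by
  induction p with
  | nil => simp [qprod, QPath.arrows, wprod]
  | cons p α h ih => simp [qprod, QPath.arrows, wprod_append, wprod_cons, wprod_nil, ih, mul_assoc]

/-- The algebra acts through `Φ` as the representation `F` of the quiver. -/
structure IsRep (P : QuiverPresentation k A V E) (F : E → Matrix (Fin n) (Fin n) k)
    (Φ : A →ₐ[k] Module.End k (V → Fin n → k)) : Prop where
  idem_apply : ∀ v z, Φ (P.idem v) z = Pi.single v (z v)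
  arrow_apply : ∀ e z, Φ (P.arrow e) z = Pi.single (P.tgt e) ((F e).mulVec (z (P.src e)))

theorem exists_isRep (hmono : P.Monomial) {a b : V} {ρ : QPath P.src P.tgt a b}
    (huniq : ∀ (x y : V) (q : QPath P.src P.tgt x y), P.IsZeroRel q →
      x = a ∧ y = b ∧ HEq q ρ) (F : E → Matrix (Fin n) (Fin n) k) {e : E} (he : e ∈ ρ.arrows)
    (hF : F e = 0) : ∃ Φ, IsRep P F Φ := by
  obtain ⟨Φ, h1, h2⟩ := P.exists_algHom hmono huniq (R := Module.End k (V → Fin n → k))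
    (fun v => LinearMap.single k (fun _ => Fin n → k) v ∘ₗ LinearMap.proj v)
    (fun e => LinearMap.single k (fun _ => Fin n → k) (P.tgt e) ∘ₗ Matrix.toLin' (F e) ∘ₗ
      LinearMap.proj (P.src e))
    (fun v => LinearMap.ext fun z => by simp)
    (fun v w hvw => LinearMap.ext fun z => by simp [hvw])
    (LinearMap.ext fun z => by
      simp only [LinearMap.sum_apply, LinearMap.comp_apply, LinearMap.proj_apply,
        LinearMap.single_apply]
      exact Finset.univ_sum_single z)
    (fun α => LinearMap.ext fun z => by simp)
    (fun α => LinearMap.ext fun z => by simp)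
    (QPath.val_eq_zero (e := e) (by simp [hF]) ρ he)
  exact ⟨Φ, fun v z => by rw [h1]; rfl, fun e z => by rw [h2]; rfl⟩

namespace IsRep

variable {F : E → Matrix (Fin n) (Fin n) k} {Φ : A →ₐ[k] Module.End k (V → Fin n → k)}

theorem wprod_apply (h : IsRep P F Φ) {x y : V} {l : List E} (hl : IsRoute P.src P.tgt x l y)
    (u : Fin n → k) : Φ (P.wprod l) (Pi.single x u) = Pi.single y ((routeProd F l).mulVec u) := by
  induction l generalizing x u with
  | nil => obtain rfl : x = y := hl; simp [wprod_nil, routeProd]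
  | cons e l ih =>
    obtain ⟨rfl, hl⟩ := hl
    rw [wprod_cons, map_mul, Module.End.mul_apply, h.arrow_apply, Pi.single_eq_same, ih hl,
      routeProd, Matrix.mulVec_mulVec]

end IsRep

variable {α₀ ω : E} {π : List E} {M N : ModuleCat.{0} A} {p : M} {σ : M →ₗ[A] A} {s : N}

theorem wprod_smul_of_mem_socOf (hT : IsTree P.src P.tgt) (h' : IsInjCogen P (P.tgt ω) s)
    {w : N} (hw : w ∈ socOf A N) : P.wprod (π ++ [ω]) • w = 0 := by
  rw [wprod_append, wprod_cons, wprod_nil, one_mul, mul_smul]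
  exact h'.arrow_smul_of_mem hT (Submodule.smul_mem _ _ hw) ω

theorem exists_lift (hT : IsTree P.src P.tgt) (hπ : IsRoute P.src P.tgt (P.tgt α₀) π (P.src ω))
    (h : IsProjGen P (P.src α₀) p σ) (h' : IsInjCogen P (P.tgt ω) s)
    {f : radOf A M →ₗ[A] N ⧸ socOf A N} (hf : f ≠ 0) :
    ∃ w : N, f ⟨P.arrow α₀ • p, h.arrow_smul_mem hT α₀⟩ = Submodule.Quotient.mk w ∧
      P.wprod (π ++ [ω]) • w ≠ 0 := by
  obtain ⟨α, hα, hfα⟩ := h.exists_arrow_ne_zero hT hf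
  obtain ⟨w₀, hw₀⟩ := Submodule.Quotient.mk_surjective _ (f ⟨_, h.arrow_smul_mem hT α⟩)
  set w := P.idem (P.tgt α) • w₀ with hw
  have hmk : f ⟨P.arrow α • p, h.arrow_smul_mem hT α⟩ = Submodule.Quotient.mk w := by
    rw [hw, Submodule.Quotient.mk_smul, hw₀, ← map_smul]
    congr 1
    exact Subtype.ext (idem_smul_arrow_smul α p).symm
  have hwe : P.idem (P.tgt α) • w = w := by rw [hw, smul_smul, P.idem_idem]
  have hws : w ∉ socOf A N := fun hm => hfα (by rw [hmk, (Submodule.Quotient.mk_eq_zero _).2 hm])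
  obtain ⟨β, hβ⟩ := h'.exists_arrow_ne_zero hT hws
  have hβα : P.src β = P.tgt α := by
    by_contra hne
    exact hβ (arrow_smul_eq_zero_of_ne hne hwe)
  obtain ⟨v, q, hq⟩ := h'.exists_path hβ
  have hv : v = P.tgt β := by
    by_contra hne
    rw [qprod_eq_wprod, mul_smul, idem_smul_arrow_smul_of_ne hne, smul_zero] at hq
    exact hq rfl
  subst hv
  rw [qprod_eq_wprod, mul_smul, idem_smul_arrow_smul] at hq
  have hr : IsRoute P.src P.tgt (P.src α₀) (α :: β :: q.arrows) (P.tgt ω) :=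
    ⟨hα, hβα, q.isRoute_arrows⟩
  have hr' : IsRoute P.src P.tgt (P.src α₀) (α₀ :: (π ++ [ω])) (P.tgt ω) :=
    ⟨rfl, isRoute_append.2 ⟨_, hπ, rfl, rfl⟩⟩
  obtain ⟨rfl, h2⟩ := List.cons.inj (hT.route_unique hr hr')
  exact ⟨w, hmk, by rwa [← h2, wprod_cons, mul_smul]⟩

/-- A morphism from `rad P_a` to a representation with a prescribed value. -/
theorem exists_from_radOf (hT : IsTree P.src P.tgt) (h : IsProjGen P (P.src α₀) p σ)
    {F F' : E → Matrix (Fin n) (Fin n) k} {Φ Φ' : A →ₐ[k] Module.End k (V → Fin n → k)}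
    (hΦ : IsRep P F Φ) (hΦ' : IsRep P F' Φ') (hF : F α₀ = 0) (hF' : F' α₀ = 1)
    (hFF : ∀ e, e ≠ α₀ → F' e = F e) (u : Fin n → k) :
    ∃ g : radOf A M →+ (V → Fin n → k), (∀ x m, g (x • m) = Φ x (g m)) ∧
      g ⟨P.arrow α₀ • p, h.arrow_smul_mem hT α₀⟩ = Pi.single (P.tgt α₀) u := by
  let g : radOf A M →+ (V → Fin n → k) :=
    { toFun := fun m => Φ' (σ m) (Pi.single (P.src α₀) u)
      map_zero' := by simp
      map_add' := fun m m' => by simp }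
  have hg' : ∀ x m, g (x • m) = Φ' x (g m) := fun x m => by
    change Φ' (σ (x • (m : M))) _ = Φ' x (Φ' (σ m) _)
    rw [map_smul, smul_eq_mul, map_mul, Module.End.mul_apply]
  have hg0 : ∀ m, g m (P.src α₀) = 0 := fun m => by
    have h1 : g (P.idem (P.src α₀) • m) = 0 := by
      rw [show P.idem (P.src α₀) • m = 0 from Subtype.ext (h.idem_smul_radOf hT m.2), map_zero]
    rw [hg', hΦ'.idem_apply] at h1
    simpa using congrFun h1 (P.src α₀)
  let := Module.compHom (V → Fin n → k) Φ.toRingHom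
  refine ⟨g, fun x m => P.map_smul_of_commute g (fun c m => ?_) (fun v m => ?_)
    (fun α m => ?_) x m, ?_⟩
  · refine (hg' _ _).trans ?_
    change _ = Φ _ _
    rw [IsRep.algebraMap_apply, IsRep.algebraMap_apply]
  · refine (hg' _ _).trans ?_
    change _ = Φ _ _
    rw [hΦ.idem_apply, hΦ'.idem_apply]
  · refine (hg' _ _).trans ?_
    change _ = Φ _ _
    rw [hΦ.arrow_apply, hΦ'.arrow_apply]
    by_cases hα : α = α₀
    · subst hα; rw [hg0, Matrix.mulVec_zero, Matrix.mulVec_zero]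
    · rw [hFF α hα]
  · change Φ' (σ (P.arrow α₀ • p)) _ = _
    rw [map_smul, h.map_gen, smul_eq_mul, map_mul, Module.End.mul_apply, hΦ'.idem_apply,
      hΦ'.arrow_apply, hF']
    simp

/-- A morphism from a representation to `I_b / soc I_b` with a prescribed behaviour. -/
theorem exists_to_quotient (hT : IsTree P.src P.tgt) [Module.Injective A N]
    (hπ : IsRoute P.src P.tgt (P.tgt α₀) π (P.src ω)) (h' : IsInjCogen P (P.tgt ω) s)
    {F F' : E → Matrix (Fin n) (Fin n) k} {Φ Φ' : A →ₐ[k] Module.End k (V → Fin n → k)}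
    (hΦ : IsRep P F Φ) (hΦ' : IsRep P F' Φ') (hF : F ω = 0) (hF' : F' ω = 1)
    (hFF : ∀ e, e ≠ ω → F' e = F e) (hb : ∀ e, P.src e = P.tgt ω → F e = 0)
    (ξ : (Fin n → k) →ₗ[k] k) :
    ∃ g : (V → Fin n → k) →+ N ⧸ socOf A N, (∀ x z, g (Φ x z) = x • g z) ∧
      ∀ u, ∃ w : N, g (Pi.single (P.tgt α₀) u) = Submodule.Quotient.mk w ∧
        P.wprod (π ++ [ω]) • w = algebraMap k A (ξ ((routeProd F π).mulVec u)) • s := by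
  have hroute : IsRoute P.src P.tgt (P.tgt α₀) (π ++ [ω]) (P.tgt ω) :=
    isRoute_append.2 ⟨_, hπ, rfl, rfl⟩
  have hωπ : ω ∉ π := fun hmem => by
    have := hT.nodup_of_isRoute hroute
    rw [List.nodup_append] at this
    exact this.2.2 _ hmem _ (List.mem_singleton_self _) rfl
  have hne : ∀ e, P.src e = P.tgt ω → F' e = 0 := fun e he => by
    rw [hFF e ?_, hb e he]
    rintro rfl
    exact hT.not_isRoute_src (γ := e) (l := []) he.symm
  let : Module A (V → Fin n → k) := Module.compHom (V → Fin n → k) Φ'.toRingHom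
  have hsm : ∀ (x : A) (z : V → Fin n → k), x • z = Φ' x z := fun _ _ => rfl
  let S : AddSubgroup (V → Fin n → k) :=
    { carrier := {z | ∀ v, v ≠ P.tgt ω → z v = 0}
      zero_mem' := fun v _ => rfl
      add_mem' := fun hx hy v hv => by rw [Pi.add_apply, hx v hv, hy v hv, add_zero]
      neg_mem' := fun hx v hv => by rw [Pi.neg_apply, hx v hv, neg_zero] }
  have harr : ∀ α, ∀ z ∈ S, Φ' (P.arrow α) z = 0 := fun α z hz => by
    rw [hΦ'.arrow_apply]
    by_cases hα : P.src α = P.tgt ω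
    · rw [hne α hα, Matrix.zero_mulVec, Pi.single_zero]
    · rw [hz _ hα, Matrix.mulVec_zero, Pi.single_zero]
  let S' : Submodule A (V → Fin n → k) :=
    { S with
      smul_mem' := fun x z hz => by
        refine P.smul_mem_of_stable S (fun c z hz v hv => ?_) (fun v z hz v' hv' => ?_)
          (fun α z hz => ?_) x z hz
        · rw [hsm, IsRep.algebraMap_apply, Pi.smul_apply, hz v hv, smul_zero]
        · rw [hsm, hΦ'.idem_apply]
          by_cases hvv : v' = v
          · subst hvv; rw [Pi.single_eq_same, hz v' hv']
          · rw [Pi.single_eq_of_ne hvv]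
        · rw [hsm, harr α z hz]; exact S.zero_mem }
  let φ : S' →+ N :=
    { toFun := fun z => algebraMap k A (ξ (z.1 (P.tgt ω))) • s
      map_zero' := by simp
      map_add' := fun z z' => by simp [add_smul] }
  let φ' : S' →ₗ[A] N :=
    { φ with
      map_smul' := fun x z => P.map_smul_of_commute φ
        (fun c z => by
          change algebraMap k A (ξ ((algebraMap k A c • z.1) (P.tgt ω))) • s =
            algebraMap k A c • algebraMap k A (ξ (z.1 (P.tgt ω))) • s
          rw [hsm, IsRep.algebraMap_apply, Pi.smul_apply, map_smul, smul_eq_mul, map_mul, mul_smul])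
        (fun v z => by
          change algebraMap k A (ξ ((P.idem v • z.1) (P.tgt ω))) • s =
            P.idem v • algebraMap k A (ξ (z.1 (P.tgt ω))) • s
          rw [hsm, hΦ'.idem_apply, smul_smul, ← Algebra.commutes, mul_smul]
          by_cases hv : v = P.tgt ω
          · rw [hv, Pi.single_eq_same, h'.idem_smul]
          · rw [Pi.single_eq_of_ne (Ne.symm hv), ← h'.idem_smul, smul_smul (P.idem v),
              P.idem_orth _ _ hv]
            simp)
        (fun α z => by
          change algebraMap k A (ξ ((P.arrow α • z.1) (P.tgt ω))) • s =
            P.arrow α • algebraMap k A (ξ (z.1 (P.tgt ω))) • s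
          rw [hsm, harr α z.1 z.2, smul_smul, ← Algebra.commutes, mul_smul, h'.arrow_smul hT]
          simp) x z }
  obtain ⟨Ψ, hΨ⟩ := Module.Injective.out S'.subtype (Submodule.subtype_injective S') φ'
  have hΨs : ∀ (x : A) z, Ψ (Φ' x z) = x • Ψ z := fun x z => Ψ.map_smul x z
  have hΨb : ∀ u, Ψ (Pi.single (P.tgt ω) u) = algebraMap k A (ξ u) • s := fun u => by
    have := hΨ ⟨Pi.single (P.tgt ω) u, fun v hv => Pi.single_eq_of_ne hv _⟩
    refine this.trans ?_
    change algebraMap k A (ξ ((Pi.single (P.tgt ω) u : V → Fin n → k) (P.tgt ω))) • s = _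
    rw [Pi.single_eq_same]
  let g : (V → Fin n → k) →+ N ⧸ socOf A N :=
    ((socOf A N).mkQ.toAddMonoidHom).comp Ψ.toAddMonoidHom
  have hg : ∀ z, g z = Submodule.Quotient.mk (Ψ z) := fun _ => rfl
  refine ⟨g, ?_, fun u => ⟨Ψ (Pi.single (P.tgt α₀) u), rfl, ?_⟩⟩
  · let : Module A (V → Fin n → k) := Module.compHom (V → Fin n → k) Φ.toRingHom
    intro x z
    refine P.map_smul_of_commute g (fun c z => ?_) (fun v z => ?_) (fun α z => ?_) x z
    · change g (Φ _ z) = _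
      rw [IsRep.algebraMap_apply, ← IsRep.algebraMap_apply (Φ := Φ'), hg, hg, hΨs,
        Submodule.Quotient.mk_smul]
    · change g (Φ _ z) = _
      rw [hΦ.idem_apply, ← hΦ'.idem_apply, hg, hg, hΨs, Submodule.Quotient.mk_smul]
    · change g (Φ _ z) = _
      rw [hΦ.arrow_apply]
      by_cases hα : α = ω
      · subst hα
        rw [hF, Matrix.zero_mulVec, Pi.single_zero, map_zero, hg, ← Submodule.Quotient.mk_smul,
          ← hΨs, hΦ'.arrow_apply, hF', Matrix.one_mulVec, hΨb, eq_comm,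
          Submodule.Quotient.mk_eq_zero, h'.mem_socOf_iff hT]
        exact ⟨_, rfl⟩
      · rw [← hFF α hα, ← hΦ'.arrow_apply, hg, hg, hΨs, Submodule.Quotient.mk_smul]
  · have hF'' : routeProd F' (π ++ [ω]) = routeProd F π := by
      rw [routeProd_append, routeProd, hF', routeProd, one_mul, one_mul]
      clear hroute hπ
      induction π with
      | nil => rfl
      | cons e l ih =>
        rw [List.mem_cons, not_or] at hωπ
        rw [routeProd, routeProd, ih hωπ.2, hFF e (Ne.symm hωπ.1)]
    rw [← hΨs, hΦ'.wprod_apply hroute, hΨb, hF'']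

end QuiverPresentation

namespace QuiverPresentation

open TreeQuiver

variable {k A V E : Type} [Field k] [Ring A] [Algebra k A] [Fintype V] [Fintype E]
  {P : QuiverPresentation k A V E} {n n' : ℕ}
  {α₀ ω : E} {π : List E} {M N : ModuleCat.{0} A} {p : M} {σ : M →ₗ[A] A} {s : N}

/-- The module on which the algebra acts through `Φ`. -/
def repModule (Φ : A →ₐ[k] Module.End k (V → Fin n → k)) : ModuleCat.{0} A :=
  @ModuleCat.of A _ (V → Fin n → k) _ (Module.compHom (V → Fin n → k) Φ.toRingHom)

theorem exists_dual_ne_zero {u : Fin n → k} (hu : u ≠ 0) : ∃ ξ : (Fin n → k) →ₗ[k] k, ξ u ≠ 0 := by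
  obtain ⟨i, hi⟩ := Function.ne_iff.1 hu
  exact ⟨LinearMap.proj i, hi⟩

/-- Every nonzero morphism from `rad P_a` to `I_b / soc I_b` factors through every
representation which vanishes on the outer arrows of the relation but not along its middle. -/
theorem exists_factorization (hT : IsTree P.src P.tgt) [Module.Injective A N]
    (hπ : IsRoute P.src P.tgt (P.tgt α₀) π (P.src ω)) (h : IsProjGen P (P.src α₀) p σ)
    (h' : IsInjCogen P (P.tgt ω) s)
    {F F₁ F₂ : E → Matrix (Fin n) (Fin n) k} {Φ Φ₁ Φ₂ : A →ₐ[k] Module.End k (V → Fin n → k)}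
    (hΦ : IsRep P F Φ) (hΦ₁ : IsRep P F₁ Φ₁) (hΦ₂ : IsRep P F₂ Φ₂) (hα : F α₀ = 0)
    (hα₁ : F₁ α₀ = 1) (hF₁ : ∀ e, e ≠ α₀ → F₁ e = F e) (hω : F ω = 0)
    (hω₂ : F₂ ω = 1) (hF₂ : ∀ e, e ≠ ω → F₂ e = F e)
    (hb : ∀ e, P.src e = P.tgt ω → F e = 0) (hF : routeProd F π ≠ 0)
    {f : radOf A M →ₗ[A] N ⧸ socOf A N} (hf : f ≠ 0) :
    ∃ (g : radOf A M →+ (V → Fin n → k)) (q : (V → Fin n → k) →+ N ⧸ socOf A N),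
      (∀ x m, g (x • m) = Φ x (g m)) ∧ (∀ x z, q (Φ x z) = x • q z) ∧ ∀ m, q (g m) = f m := by
  obtain ⟨u, hu⟩ : ∃ u, (routeProd F π).mulVec u ≠ 0 := by
    by_contra! hno
    exact hF (Matrix.ext_of_mulVec_single fun i => by rw [hno, Matrix.zero_mulVec])
  obtain ⟨ξ, hξ⟩ := exists_dual_ne_zero hu
  obtain ⟨w, hw, hw0⟩ := exists_lift hT hπ h h' hf
  have hwb : P.idem (P.tgt ω) • P.wprod (π ++ [ω]) • w = P.wprod (π ++ [ω]) • w := by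
    rw [wprod_append, wprod_cons, wprod_nil, one_mul, mul_smul, idem_smul_arrow_smul]
  obtain ⟨c, hc⟩ := h'.exists_idem_smul_eq hT hwb
  obtain ⟨g, hg, hgp⟩ := exists_from_radOf hT h hΦ hΦ₁ hα hα₁ hF₁ u
  obtain ⟨q, hq, hqw⟩ := exists_to_quotient hT hπ h' hΦ hΦ₂ hω hω₂ hF₂ hb
    ((c * (ξ ((routeProd F π).mulVec u))⁻¹) • ξ)
  refine ⟨g, q, hg, hq, ?_⟩
  let f' : radOf A M →ₗ[A] N ⧸ socOf A N :=
    { (q.comp g) with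
      map_smul' := fun x m => by
        change q (g (x • m)) = x • q (g m)
        rw [hg, hq] }
  suffices f' = f from fun m => LinearMap.congr_fun this m
  by_contra hne
  obtain ⟨w₁, hw₁, hw₁0⟩ := exists_lift hT hπ h h' (sub_ne_zero.2 hne)
  obtain ⟨w₂, hw₂, hw₂c⟩ := hqw u
  refine hw₁0 ?_
  have h1 : w₂ - w - w₁ ∈ socOf A N := by
    rw [← Submodule.Quotient.mk_eq_zero, Submodule.Quotient.mk_sub, Submodule.Quotient.mk_sub,
      ← hw₁, ← hw₂, ← hw, ← hgp, LinearMap.sub_apply]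
    exact sub_self _
  have h2 := wprod_smul_of_mem_socOf (π := π) hT h' h1
  rw [smul_sub, smul_sub, hw₂c, hc, LinearMap.smul_apply, smul_eq_mul, inv_mul_cancel_right₀ hξ,
    sub_self, zero_sub, neg_eq_zero] at h2
  exact h2

/-- A morphism between representations through which a nonzero morphism from `rad P_a` to
`I_b / soc I_b` factors does not vanish along the relation. -/
theorem exists_matrices (hT : IsTree P.src P.tgt)
    (hπ : IsRoute P.src P.tgt (P.tgt α₀) π (P.src ω)) (h : IsProjGen P (P.src α₀) p σ)
    (h' : IsInjCogen P (P.tgt ω) s)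
    {F : E → Matrix (Fin n) (Fin n) k} {F' : E → Matrix (Fin n') (Fin n') k}
    {Φ : A →ₐ[k] Module.End k (V → Fin n → k)} {Φ' : A →ₐ[k] Module.End k (V → Fin n' → k)}
    (hΦ : IsRep P F Φ) (hΦ' : IsRep P F' Φ')
    {f : radOf A M →ₗ[A] N ⧸ socOf A N} (hf : f ≠ 0)
    (p' : radOf A M →+ (V → Fin n → k)) (g : (V → Fin n → k) →+ (V → Fin n' → k))
    (q : (V → Fin n' → k) →+ N ⧸ socOf A N) (hp : ∀ x m, p' (x • m) = Φ x (p' m))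
    (hg : ∀ x z, g (Φ x z) = Φ' x (g z)) (hq : ∀ x z, q (Φ' x z) = x • q z)
    (hqgp : ∀ m, q (g (p' m)) = f m) :
    ∃ G : V → Matrix (Fin n') (Fin n) k, (∀ e, G (P.tgt e) * F e = F' e * G (P.src e)) ∧
      routeProd F' π * G (P.tgt α₀) ≠ 0 := by
  let g' : (V → Fin n → k) →ₗ[k] (V → Fin n' → k) :=
    { g with
      map_smul' := fun c z => by
        change g (c • z) = c • g z
        rw [← IsRep.algebraMap_apply (Φ := Φ), hg, IsRep.algebraMap_apply] }
  let G : V → Matrix (Fin n') (Fin n) k := fun v => LinearMap.toMatrix'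
    (LinearMap.proj v ∘ₗ g' ∘ₗ LinearMap.single k (fun _ => Fin n → k) v)
  have hG : ∀ v u, (G v).mulVec u = g (Pi.single v u) v := fun v u => by
    rw [← Matrix.toLin'_apply, Matrix.toLin'_toMatrix']; rfl
  have hgs : ∀ v u, g (Pi.single v u) = Pi.single v ((G v).mulVec u) := fun v u => by
    have := hg (P.idem v) (Pi.single v u)
    rw [hΦ.idem_apply, Pi.single_eq_same, hΦ'.idem_apply, ← hG] at this
    exact this
  refine ⟨G, fun e => ?_, fun h0 => ?_⟩
  · refine Matrix.ext_of_mulVec_single fun i => ?_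
    have := hg (P.arrow e) (Pi.single (P.src e) (Pi.single i 1))
    rw [hΦ.arrow_apply, hΦ'.arrow_apply, Pi.single_eq_same, hgs, hgs, Pi.single_eq_same] at this
    rw [← Matrix.mulVec_mulVec, ← Matrix.mulVec_mulVec]
    exact Pi.single_injective _ this
  · obtain ⟨w, hw, hw0⟩ := exists_lift hT hπ h h' hf
    set m₀ : radOf A M := ⟨P.arrow α₀ • p, h.arrow_smul_mem hT α₀⟩
    have hm₀ : p' m₀ = Pi.single (P.tgt α₀) (p' m₀ (P.tgt α₀)) := by
      rw [← hΦ.idem_apply, ← hp]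
      congr 1
      exact Subtype.ext (idem_smul_arrow_smul α₀ p).symm
    have hsoc : P.wprod π • w ∈ socOf A N := by
      rw [← Submodule.Quotient.mk_eq_zero, Submodule.Quotient.mk_smul, ← hw, ← hqgp, ← hq, hm₀, hgs,
        hΦ'.wprod_apply hπ, Matrix.mulVec_mulVec, h0, Matrix.zero_mulVec, Pi.single_zero, map_zero]
    rw [wprod_append, wprod_cons, wprod_nil, one_mul, mul_smul, h'.arrow_smul_of_mem hT hsoc] at hw0
    exact hw0 rfl

/-- A sectional path makes the representations which do not vanish along the relation
comparable. -/
theorem comparable_of_sectionalPath [FiniteDimensional k A] (hT : IsTree P.src P.tgt)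
    (hmono : P.Monomial) {a b : V} {ρ : QPath P.src P.tgt a b}
    (huniq : ∀ (x y : V) (q : QPath P.src P.tgt x y), P.IsZeroRel q →
      x = a ∧ y = b ∧ HEq q ρ) (hρ : ρ.arrows = α₀ :: (π ++ [ω]))
    [Module.Injective A N] (hπ : IsRoute P.src P.tgt (P.tgt α₀) π (P.src ω))
    (h : IsProjGen P (P.src α₀) p σ) (h' : IsInjCogen P (P.tgt ω) s) {R J : ModuleCat.{0} A}
    (hR : IsSummand A R (ModuleCat.of A (radOf A M)))
    (hJ : IsSummand A J (ModuleCat.of A (N ⧸ socOf A N))) {l : ℕ} (hsec : SectionalPath A R J l)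
    (F : E → Matrix (Fin n) (Fin n) k) (F' : E → Matrix (Fin n') (Fin n') k)
    (hα : F α₀ = 0) (hω : F ω = 0) (hb : ∀ e, P.src e = P.tgt ω → F e = 0)
    (hF : routeProd F π ≠ 0) (hα' : F' α₀ = 0) (hω' : F' ω = 0)
    (hb' : ∀ e, P.src e = P.tgt ω → F' e = 0) (hF' : routeProd F' π ≠ 0) :
    (∃ G : V → Matrix (Fin n') (Fin n) k, (∀ e, G (P.tgt e) * F e = F' e * G (P.src e)) ∧
      routeProd F' π * G (P.tgt α₀) ≠ 0) ∨
    ∃ G : V → Matrix (Fin n) (Fin n') k, (∀ e, G (P.tgt e) * F' e = F e * G (P.src e)) ∧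
      routeProd F π * G (P.tgt α₀) ≠ 0 := by
  obtain ⟨iR, pR, hiR⟩ := hR
  obtain ⟨iJ, pJ, hiJ⟩ := hJ
  obtain ⟨f, hf0, hf⟩ := hsec.exists_map k
  have hf' : iR ≫ (pR ≫ f ≫ iJ) ≫ pJ = f := by
    simp only [Category.assoc, hiJ, Category.comp_id]
    rw [← Category.assoc, hiR, Category.id_comp]
  have hf'0 : (pR ≫ f ≫ iJ).hom ≠ 0 := fun h0 => hf0 (by
    rw [← hf', show pR ≫ f ≫ iJ = 0 from ModuleCat.hom_ext h0]; simp)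
  have hαω : α₀ ≠ ω := by
    rintro rfl
    have := hT.nodup_of_isRoute (a := P.src α₀) (l := α₀ :: (π ++ [α₀]))
      ⟨rfl, isRoute_append.2 ⟨_, hπ, rfl, rfl⟩⟩
    simp at this
  have hαρ : α₀ ∈ ρ.arrows := by rw [hρ]; exact List.mem_cons_self
  have hωρ : ω ∈ ρ.arrows := by rw [hρ]; simp
  have key : ∀ {n : ℕ} (F : E → Matrix (Fin n) (Fin n) k), F α₀ = 0 → F ω = 0 →
      (∀ e, P.src e = P.tgt ω → F e = 0) → routeProd F π ≠ 0 →
      ∃ Φ, IsRep P F Φ ∧ ∃ (g : radOf A M →+ (V → Fin n → k))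
        (q : (V → Fin n → k) →+ N ⧸ socOf A N), (∀ x m, g (x • m) = Φ x (g m)) ∧
        (∀ x z, q (Φ x z) = x • q z) ∧ ∀ m, q (g m) = (pR ≫ f ≫ iJ).hom m := by
    intro n F hα hω hb hF
    obtain ⟨Φ, hΦ⟩ := exists_isRep hmono huniq F hαρ hα
    obtain ⟨Φ₁, hΦ₁⟩ := exists_isRep hmono huniq (Function.update F α₀ 1) hωρ
      (by rw [Function.update_of_ne hαω.symm, hω])
    obtain ⟨Φ₂, hΦ₂⟩ := exists_isRep hmono huniq (Function.update F ω 1) hαρ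
      (by rw [Function.update_of_ne hαω, hα])
    exact ⟨Φ, hΦ, exists_factorization hT hπ h h' hΦ hΦ₁ hΦ₂ hα (Function.update_self ..)
      (fun e he => Function.update_of_ne he ..) hω (Function.update_self ..)
      (fun e he => Function.update_of_ne he ..) hb hF hf'0⟩
  obtain ⟨Φ, hΦ, g, q, hg, hq, hqg⟩ := key F hα hω hb hF
  obtain ⟨Φ', hΦ', g', q', hg', hq', hqg'⟩ := key F' hα' hω' hb' hF'
  let gm : ModuleCat.of A (radOf A M) ⟶ repModule Φ :=
    ModuleCat.ofHom (X := radOf A M) (Y := repModule Φ)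
      { toFun := fun m => g m, map_add' := g.map_add, map_smul' := hg }
  let gm' : ModuleCat.of A (radOf A M) ⟶ repModule Φ' :=
    ModuleCat.ofHom (X := radOf A M) (Y := repModule Φ')
      { toFun := fun m => g' m, map_add' := g'.map_add, map_smul' := hg' }
  let qm : repModule Φ ⟶ ModuleCat.of A (N ⧸ socOf A N) :=
    ModuleCat.ofHom (X := repModule Φ) (Y := N ⧸ socOf A N)
      { toFun := fun m => q m, map_add' := q.map_add, map_smul' := hq }
  let qm' : repModule Φ' ⟶ ModuleCat.of A (N ⧸ socOf A N) :=
    ModuleCat.ofHom (X := repModule Φ') (Y := N ⧸ socOf A N)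
      { toFun := fun m => q' m, map_add' := q'.map_add, map_smul' := hq' }
  have e1 : (iR ≫ gm) ≫ (qm ≫ pJ) = f := by
    rw [← hf', ← show gm ≫ qm = pR ≫ f ≫ iJ from ModuleCat.hom_ext (LinearMap.ext hqg)]
    simp only [Category.assoc]
  have e2 : (iR ≫ gm') ≫ (qm' ≫ pJ) = f := by
    rw [← hf', ← show gm' ≫ qm' = pR ≫ f ≫ iJ from ModuleCat.hom_ext (LinearMap.ext hqg')]
    simp only [Category.assoc]
  rcases hf (repModule Φ) (repModule Φ') _ _ _ _ e1 e2 with ⟨p₁, g₁, q₁, h₁⟩ | ⟨p₁, g₁, q₁, h₁⟩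
  · refine .inl (exists_matrices hT hπ h h' hΦ hΦ' hf'0 (pR ≫ p₁).hom.toAddMonoidHom
      g₁.hom.toAddMonoidHom (q₁ ≫ iJ).hom.toAddMonoidHom (fun x m => (pR ≫ p₁).hom.map_smul x m)
      (fun x z => g₁.hom.map_smul x z) (fun x z => (q₁ ≫ iJ).hom.map_smul x z) fun m => ?_)
    rw [← h₁]; rfl
  · refine .inr (exists_matrices hT hπ h h' hΦ' hΦ hf'0 (pR ≫ p₁).hom.toAddMonoidHom
      g₁.hom.toAddMonoidHom (q₁ ≫ iJ).hom.toAddMonoidHom (fun x m => (pR ≫ p₁).hom.map_smul x m)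
      (fun x z => g₁.hom.map_smul x z) (fun x z => (q₁ ≫ iJ).hom.map_smul x z) fun m => ?_)
    rw [← h₁]; rfl

end QuiverPresentation

/-! ## The part of the quiver between the outer arrows of the relation -/

namespace TreeQuiver

variable {V E k : Type} [Field k] {src tgt : E → V} {α₀ ω : E} {π : List E} {C X : V → Prop}

/-- The set `C` of vertices lies between the arrows `α₀` and `ω`, while the vertices in `X` are
those cut off by `α₀`. -/
structure IsCore (src tgt : E → V) (α₀ ω : E) (C X : V → Prop) : Prop where
  not_mem : ∀ v, C v → ¬ X v
  src_fst : X (src α₀)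
  tgt_fst : C (tgt α₀)
  src_snd : C (src ω)
  tgt_snd : ¬ C (tgt ω) ∧ ¬ X (tgt ω)
  core_iff : ∀ e, e ≠ α₀ → e ≠ ω → (C (src e) ↔ C (tgt e))
  upper_iff : ∀ e, e ≠ α₀ → e ≠ ω → (X (src e) ↔ X (tgt e))

theorem IsTree.exists_isCore (hT : IsTree src tgt) (hπ : IsRoute src tgt (tgt α₀) π (src ω)) :
    ∃ C X, IsCore src tgt α₀ ω C X ∧ α₀ ∉ π ∧ ω ∉ π := by
  have hr : IsRoute src tgt (src α₀) (α₀ :: (π ++ [ω])) (tgt ω) :=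
    ⟨rfl, isRoute_append.2 ⟨_, hπ, rfl, rfl⟩⟩
  have hn := hT.nodup_of_isRoute hr
  simp only [List.nodup_cons, List.mem_append, List.mem_singleton, not_or, List.nodup_append] at hn
  obtain ⟨⟨h1, h2⟩, -, -, h3⟩ := hn
  have h3 : ω ∉ π := fun hm => h3 _ hm _ rfl rfl
  obtain ⟨c, hc1, hc2, hc3⟩ := hT.cut α₀
  obtain ⟨d, hd1, hd2, hd3⟩ := hT.cut ω
  have hcω : c (src ω) := (hπ.closed (fun e he => hc3 e fun h => h1 (h ▸ he)) hc2).1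
  have hdα : ¬ d (tgt α₀) := fun h =>
    hd1 (hπ.closed (fun e he => hd3 e fun h => h3 (h ▸ he)) h).1
  refine ⟨fun v => c v ∧ ¬ d v, fun v => ¬ c v, ?_, h1, h3⟩
  exact
    { not_mem := fun v hv => not_not.2 hv.1
      src_fst := hc1
      tgt_fst := ⟨hc2, hdα⟩
      src_snd := ⟨hcω, hd1⟩
      tgt_snd := ⟨fun h => h.2 hd2, not_not.2 ((hc3 ω (Ne.symm h2)).1 hcω)⟩
      core_iff := fun e he he' => and_congr (hc3 e he) (not_congr (hd3 e he'))
      upper_iff := fun e he _ => not_congr (hc3 e he) }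

/-- The arrows between vertices of `C`. -/
abbrev CoreArrow (src tgt : E → V) (C : V → Prop) := {e : E // C (src e) ∧ C (tgt e)}

/-- The source of an arrow between vertices of `C`. -/
def coreSrc (src tgt : E → V) (C : V → Prop) (e : CoreArrow src tgt C) : {v // C v} :=
  ⟨src e.1, e.2.1⟩

/-- The target of an arrow between vertices of `C`. -/
def coreTgt (src tgt : E → V) (C : V → Prop) (e : CoreArrow src tgt C) : {v // C v} :=
  ⟨tgt e.1, e.2.2⟩

namespace IsCore

theorem ne_fst (h : IsCore src tgt α₀ ω C X) {e : E} (he : C (src e)) : e ≠ α₀ := by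
  rintro rfl; exact h.not_mem _ he h.src_fst

theorem ne_snd (h : IsCore src tgt α₀ ω C X) {e : E} (he : C (tgt e)) : e ≠ ω := by
  rintro rfl; exact h.tgt_snd.1 he

theorem isTree (h : IsCore src tgt α₀ ω C X) (hT : IsTree src tgt) :
    IsTree (coreSrc src tgt C) (coreTgt src tgt C) where
  cut γ := by
    obtain ⟨c, h1, h2, h3⟩ := hT.cut γ.1
    exact ⟨fun v => c v.1, h1, h2, fun δ hδ => h3 δ.1 fun hh => hδ (Subtype.ext hh)⟩
  conn S hS v w hv := by
    let S' : V → Prop := fun v => (∃ hv : C v, S ⟨v, hv⟩) ∨ (X v ∧ S ⟨_, h.tgt_fst⟩) ∨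
      (¬ C v ∧ ¬ X v ∧ S ⟨_, h.src_snd⟩)
    have hC : ∀ {v} (hv : C v), S' v ↔ S ⟨v, hv⟩ := fun {v} hv => by
      simp [S', hv, h.not_mem v hv]
    have hX : ∀ {v} (_ : X v), S' v ↔ S ⟨_, h.tgt_fst⟩ := fun {v} hv => by
      have : ¬ C v := fun hc => h.not_mem v hc hv
      simp [S', hv, this]
    have hW : ∀ {v} (_ : ¬ C v) (_ : ¬ X v), S' v ↔ S ⟨_, h.src_snd⟩ := fun {v} hv hv' => by
      simp [S', hv, hv']
    have key : ∀ δ, S' (src δ) ↔ S' (tgt δ) := by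
      intro δ
      by_cases h1 : δ = α₀
      · subst h1; rw [hX h.src_fst, hC h.tgt_fst]
      by_cases h2 : δ = ω
      · subst h2; rw [hW h.tgt_snd.1 h.tgt_snd.2, hC h.src_snd]
      by_cases h3 : C (src δ)
      · rw [hC h3, hC ((h.core_iff δ h1 h2).1 h3)]
        exact hS ⟨δ, h3, (h.core_iff δ h1 h2).1 h3⟩
      · by_cases h4 : X (src δ)
        · rw [hX h4, hX ((h.upper_iff δ h1 h2).1 h4)]
        · rw [hW h3 h4, hW (mt (h.core_iff δ h1 h2).2 h3) (mt (h.upper_iff δ h1 h2).2 h4)]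
    exact (hC w.2).1 (hT.conn S' key v w ((hC v.2).2 hv))

theorem exists_route (h : IsCore src tgt α₀ ω C X) {a b : V} (ha : C a) (hb : C b)
    (hπ : IsRoute src tgt a π b) (h1 : α₀ ∉ π) (h2 : ω ∉ π) :
    ∃ π' : List (CoreArrow src tgt C), π'.map Subtype.val = π ∧
      IsRoute (coreSrc src tgt C) (coreTgt src tgt C) ⟨a, ha⟩ π' ⟨b, hb⟩ := by
  induction π generalizing a with
  | nil => exact ⟨[], rfl, Subtype.ext hπ⟩
  | cons e l ih =>
    rw [List.mem_cons, not_or] at h1 h2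
    obtain ⟨rfl, hl⟩ := hπ
    have ht := (h.core_iff e (Ne.symm h1.1) (Ne.symm h2.1)).1 ha
    obtain ⟨l', rfl, hl'⟩ := ih ht hl h1.2 h2.2
    exact ⟨⟨e, ha, ht⟩ :: l', rfl, rfl, hl'⟩

end IsCore

/-- Extension by zero of a representation of the core. -/
noncomputable def extendCore {n : ℕ} (F : CoreArrow src tgt C → Matrix (Fin n) (Fin n) k) (e : E) :
    Matrix (Fin n) (Fin n) k :=
  if h : C (src e) ∧ C (tgt e) then F ⟨e, h⟩ else 0

theorem extendCore_val {n : ℕ} (F : CoreArrow src tgt C → Matrix (Fin n) (Fin n) k)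
    (e : CoreArrow src tgt C) : extendCore F e.1 = F e := dif_pos e.2

theorem routeProd_extendCore {n : ℕ} (F : CoreArrow src tgt C → Matrix (Fin n) (Fin n) k)
    (l : List (CoreArrow src tgt C)) :
    routeProd (extendCore F) (l.map Subtype.val) = routeProd F l := by
  induction l with
  | nil => rfl
  | cons e l ih => rw [List.map_cons, routeProd, routeProd, ih, extendCore_val]

end TreeQuiver

namespace QuiverPresentation

open TreeQuiver

variable {k A V E : Type} [Field k] [Ring A] [Algebra k A] [Fintype V] [Fintype E]
  {P : QuiverPresentation k A V E}
  {α₀ ω : E} {π : List E} {M N : ModuleCat.{0} A} {p : M} {σ : M →ₗ[A] A} {s : N}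

theorem comparable_core [FiniteDimensional k A] (hT : IsTree P.src P.tgt)
    (hmono : P.Monomial) {a b : V} {ρ : QPath P.src P.tgt a b}
    (huniq : ∀ (x y : V) (q : QPath P.src P.tgt x y), P.IsZeroRel q →
      x = a ∧ y = b ∧ HEq q ρ) (hρ : ρ.arrows = α₀ :: (π ++ [ω]))
    [Module.Injective A N] (hπ : IsRoute P.src P.tgt (P.tgt α₀) π (P.src ω))
    (h : IsProjGen P (P.src α₀) p σ) (h' : IsInjCogen P (P.tgt ω) s) {R J : ModuleCat.{0} A}
    (hR : IsSummand A R (ModuleCat.of A (radOf A M)))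
    (hJ : IsSummand A J (ModuleCat.of A (N ⧸ socOf A N))) {l : ℕ} (hsec : SectionalPath A R J l)
    {C X : V → Prop} (hC : IsCore P.src P.tgt α₀ ω C X) {π' : List (CoreArrow P.src P.tgt C)}
    (hπ' : π'.map Subtype.val = π) :
    Comparable k (coreSrc P.src P.tgt C) (coreTgt P.src P.tgt C) ⟨_, hC.tgt_fst⟩ π' := by
  intro n n' F F' hF hF'
  have h0 : ∀ {n : ℕ} (F : CoreArrow P.src P.tgt C → Matrix (Fin n) (Fin n) k),
      extendCore F α₀ = 0 ∧ extendCore F ω = 0 ∧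
        ∀ e, P.src e = P.tgt ω → extendCore F e = 0 := fun F =>
    ⟨dif_neg fun hh => hC.ne_fst hh.1 rfl, dif_neg fun hh => hC.ne_snd hh.2 rfl,
      fun e he => dif_neg fun hh => hC.tgt_snd.1 (he ▸ hh.1)⟩
  rw [← routeProd_extendCore, hπ'] at hF hF'
  rcases comparable_of_sectionalPath hT hmono huniq hρ hπ h h' hR hJ hsec (extendCore F)
    (extendCore F') (h0 F).1 (h0 F).2.1 (h0 F).2.2 hF (h0 F').1 (h0 F').2.1 (h0 F').2.2 hF' with
    ⟨G, hG, hG'⟩ | ⟨G, hG, hG'⟩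
  · refine .inl ⟨fun v => G v.1, fun e => ?_, ?_⟩
    · rw [← extendCore_val F, ← extendCore_val F']; exact hG e.1
    · rwa [← routeProd_extendCore, hπ']
  · refine .inr ⟨fun v => G v.1, fun e => ?_, ?_⟩
    · rw [← extendCore_val F, ← extendCore_val F']; exact hG e.1
    · rwa [← routeProd_extendCore, hπ']

end QuiverPresentation

/-! ## Complements in modular lattices -/

section Modular

variable {X Y : Type} [Lattice X] [BoundedOrder X] [IsModularLattice X] [ComplementedLattice X]
  [Lattice Y] [BoundedOrder Y] [IsModularLattice Y] [ComplementedLattice Y]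

theorem exists_disjoint_sup_eq {p b : X} (h : p ≤ b) : ∃ d ≤ b, Disjoint p d ∧ p ⊔ d = b := by
  obtain ⟨d, hd⟩ := exists_isCompl p
  refine ⟨d ⊓ b, inf_le_right, hd.disjoint.mono_right inf_le_left, ?_⟩
  rw [← sup_inf_assoc_of_le d h, hd.sup_eq_top, top_inf_eq]

theorem exists_between_disjoint {p w l : X} (h : Disjoint p w) (hw : w ≤ l) :
    ∃ w', w ≤ w' ∧ w' ≤ l ∧ Disjoint p w' ∧ l ≤ (l ⊓ p) ⊔ w' := by
  obtain ⟨d, hd, hd1, hd2⟩ := exists_disjoint_sup_eq (sup_le (inf_le_left : l ⊓ p ≤ l) hw)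
  refine ⟨w ⊔ d, le_sup_left, sup_le hw hd, ?_, by rw [← sup_assoc, hd2]⟩
  have : Disjoint (l ⊓ p) (w ⊔ d) :=
    (h.mono_left inf_le_right).disjoint_sup_right_of_disjoint_sup_left hd1
  rw [disjoint_iff] at this ⊢
  rw [← this, inf_comm l p, inf_assoc, inf_eq_right.2 (sup_le hw hd)]

theorem exists_isCompl_between {p w l : X} (h : Disjoint p w) (hw : w ≤ l) (hl : l ⊔ p = ⊤) :
    ∃ w', w ≤ w' ∧ w' ≤ l ∧ IsCompl p w' := by
  obtain ⟨w', h1, h2, h3, h4⟩ := exists_between_disjoint h hw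
  refine ⟨w', h1, h2, h3, codisjoint_iff.2 (top_le_iff.1 ?_)⟩
  rw [← hl]
  exact sup_le (h4.trans (sup_le (inf_le_right.trans le_sup_left) le_sup_right)) le_sup_left

/-- The element `l` is the join of its parts in `p` and `q`. -/
def Adapted (p q l : X) : Prop := l ≤ (l ⊓ p) ⊔ (l ⊓ q)

theorem exists_isCompl_adapted {p w : X} (h : Disjoint p w) {ls : List X}
    (hls : ls.Pairwise (· ≤ ·)) (hw : ∀ l ∈ ls, w ≤ l) :
    ∃ w', w ≤ w' ∧ IsCompl p w' ∧ ∀ l ∈ ls, Adapted p w' l := by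
  induction ls generalizing w with
  | nil =>
    obtain ⟨w', h1, -, h2⟩ := exists_isCompl_between h le_top (top_sup_eq _)
    exact ⟨w', h1, h2, by simp⟩
  | cons l ls ih =>
    obtain ⟨hl, hls⟩ := List.pairwise_cons.1 hls
    obtain ⟨w₁, h1, h2, h3, h4⟩ := exists_between_disjoint h (hw l List.mem_cons_self)
    obtain ⟨w', h5, h6, h7⟩ := ih h3 hls fun l' hl' => h2.trans (hl l' hl')
    refine ⟨w', h1.trans h5, h6, fun l' hl' => ?_⟩
    rcases List.mem_cons.1 hl' with rfl | hl'
    · exact h4.trans (sup_le_sup_left (le_inf h2 h5) _)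
    · exact h7 l' hl'

theorem exists_isCompl_of_fork (s₁ d b : X) {ls : List X} (hls : ls.Pairwise (· ≤ ·))
    (hb : ∀ l ∈ ls, l ≤ b) :
    ∃ K, IsCompl ((s₁ ⊓ b) ⊔ (d ⊓ b)) K ∧ Adapted ((s₁ ⊓ b) ⊔ (d ⊓ b)) K s₁ ∧
      Adapted ((s₁ ⊓ b) ⊔ (d ⊓ b)) K d ∧ ∀ l ∈ ls, Adapted ((s₁ ⊓ b) ⊔ (d ⊓ b)) K l := by
  set τ := (s₁ ⊓ b) ⊔ (d ⊓ b) with hτ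
  have haτ : s₁ ⊓ b ≤ τ := le_sup_left
  have hdτ : d ⊓ b ≤ τ := le_sup_right
  have hτv : τ ≤ s₁ ⊔ d := sup_le_sup inf_le_left inf_le_left
  have hτb : τ ≤ b := sup_le inf_le_right inf_le_right
  obtain ⟨W, -, hW, hWl⟩ := exists_isCompl_adapted (p := τ) disjoint_bot_right
    (ls := ls.map (· ⊓ (s₁ ⊔ d)) ++ [b ⊓ (s₁ ⊔ d)])
    (by
      rw [List.pairwise_append, List.pairwise_map]
      refine ⟨hls.imp fun h => inf_le_inf_right _ h, List.pairwise_singleton _ _, ?_⟩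
      simp only [List.mem_map, List.mem_singleton]
      rintro _ ⟨l, hl, rfl⟩ _ rfl
      exact inf_le_inf_right _ (hb l hl)) (fun _ _ => bot_le)
  set g := W ⊓ (b ⊓ (s₁ ⊔ d)) with hg
  have hgb : g ≤ b := inf_le_right.trans inf_le_left
  have hgv : g ≤ s₁ ⊔ d := inf_le_right.trans inf_le_right
  have hgτ : g ⊓ τ = ⊥ := disjoint_iff.1 (hW.disjoint.symm.mono_left inf_le_left)
  obtain ⟨A, hA, hA1, hA2⟩ := exists_disjoint_sup_eq (p := s₁ ⊓ d ⊓ b) (b := (g ⊔ d) ⊓ s₁)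
    (le_inf ((inf_le_left.trans inf_le_right).trans le_sup_right) (inf_le_left.trans inf_le_left))
  have hAs : A ≤ s₁ := hA.trans inf_le_right
  have hAb : A ⊓ b = ⊥ := by
    refine le_bot_iff.1 (le_trans (le_inf ?_ inf_le_left) (disjoint_iff.1 hA1).le)
    have h1 : A ⊓ b ≤ (g ⊔ (d ⊓ b)) := by
      rw [← sup_inf_assoc_of_le d hgb]
      exact inf_le_inf_right _ (hA.trans inf_le_left)
    have h2 : A ⊓ b ≤ τ := (inf_le_inf_right _ hAs).trans haτ
    have h3 : A ⊓ b ≤ d ⊓ b := by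
      refine (le_inf h1 h2).trans ?_
      rw [sup_comm, sup_inf_assoc_of_le g hdτ, hgτ, sup_bot_eq]
    exact le_inf (le_inf (inf_le_left.trans hAs) (h3.trans inf_le_left)) inf_le_right
  have hAdisj : Disjoint (s₁ ⊓ b) A := by
    rw [disjoint_iff, ← le_bot_iff, ← hAb]
    exact le_inf inf_le_right (inf_le_left.trans inf_le_right)
  obtain ⟨S, hAS, hSs, hS, hsS⟩ := exists_between_disjoint hAdisj hAs
  have hBb : (g ⊔ A) ⊓ b ≤ g := by
    rw [sup_inf_assoc_of_le A hgb, hAb, sup_bot_eq]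
  have hBdisj : Disjoint (d ⊓ b) ((g ⊔ A) ⊓ d) := by
    rw [disjoint_iff, ← le_bot_iff, ← hgτ]
    exact le_inf ((le_inf (inf_le_right.trans inf_le_left) (inf_le_left.trans inf_le_right)).trans
      hBb) (inf_le_left.trans hdτ)
  obtain ⟨D, hBD, hDd, hD, hdD⟩ := exists_between_disjoint hBdisj inf_le_right
  have hAD : g ≤ A ⊔ d := by
    calc g ≤ (g ⊔ d) ⊓ (s₁ ⊔ d) := le_inf le_sup_left hgv
      _ = ((g ⊔ d) ⊓ s₁) ⊔ d := by
        rw [inf_comm, inf_comm (g ⊔ d), sup_comm, sup_inf_assoc_of_le _ le_sup_right, sup_comm]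
      _ = A ⊔ d := by
        rw [← hA2, sup_comm (s₁ ⊓ d ⊓ b), sup_assoc,
          sup_eq_right.2 (inf_le_left.trans inf_le_right : s₁ ⊓ d ⊓ b ≤ d)]
  have hgK : g ≤ S ⊔ D := by
    calc g ≤ (A ⊔ d) ⊓ (g ⊔ A) := le_inf hAD le_sup_left
      _ = A ⊔ (d ⊓ (g ⊔ A)) := sup_inf_assoc_of_le d le_sup_right
      _ ≤ S ⊔ D := sup_le_sup hAS (by rw [inf_comm]; exact hBD)
  have hI : d ⊓ s₁ ≤ (S ⊓ D) ⊔ (d ⊓ b) := by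
    have h1 : d ⊓ s₁ ≤ (s₁ ⊓ d ⊓ b) ⊔ (A ⊓ (d ⊓ s₁)) := by
      rw [← sup_inf_assoc_of_le A (by rw [inf_comm d]; exact inf_le_left), hA2]
      exact le_inf (le_inf (inf_le_left.trans le_sup_right) inf_le_right) le_rfl
    refine h1.trans (sup_le ?_ ?_)
    · exact (le_inf (inf_le_left.trans inf_le_right) inf_le_right).trans le_sup_right
    · refine (le_inf (inf_le_left.trans hAS) (le_trans ?_ hBD)).trans le_sup_left
      exact le_inf (inf_le_left.trans le_sup_right) (inf_le_right.trans inf_le_left)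
  have hSτ : S ⊓ τ = ⊥ := by
    have h1 : S ⊓ τ ≤ s₁ ⊓ b := le_inf (inf_le_left.trans hSs) (inf_le_right.trans hτb)
    exact le_bot_iff.1 ((le_inf h1 inf_le_left).trans (disjoint_iff.1 hS).le)
  have hDI : D ⊓ (S ⊔ τ) ≤ S := by
    have h1 : S ⊔ τ ≤ (d ⊓ b) ⊔ s₁ :=
      sup_le (hSs.trans le_sup_right) (sup_le (inf_le_left.trans le_sup_right) le_sup_left)
    have h2 : D ⊓ (S ⊔ τ) ≤ (S ⊓ D) ⊔ (d ⊓ b) := by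
      refine (le_inf (inf_le_right.trans h1) (inf_le_left.trans hDd)).trans ?_
      rw [sup_inf_assoc_of_le s₁ (inf_le_left : d ⊓ b ≤ d), inf_comm s₁]
      exact sup_le le_sup_right hI
    refine (le_inf h2 inf_le_left).trans ?_
    rw [sup_inf_assoc_of_le _ (inf_le_right : S ⊓ D ≤ D), disjoint_iff.1 hD, sup_bot_eq]
    exact inf_le_left
  have hτK : Disjoint τ (S ⊔ D) := by
    rw [disjoint_iff, ← le_bot_iff, ← hSτ]
    refine le_inf ?_ inf_le_left
    calc τ ⊓ (S ⊔ D) ≤ (S ⊔ D) ⊓ (S ⊔ τ) := le_inf inf_le_right (inf_le_left.trans le_sup_right)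
      _ = S ⊔ (D ⊓ (S ⊔ τ)) := sup_inf_assoc_of_le D le_sup_left
      _ ≤ S := sup_le le_rfl hDI
  obtain ⟨V₁, -, hV, hVl⟩ := exists_isCompl_adapted (p := s₁ ⊔ d) disjoint_bot_right hls
    (fun _ _ => bot_le)
  have hs₁ : s₁ ≤ (s₁ ⊓ τ) ⊔ S :=
    hsS.trans (sup_le_sup_right (le_inf inf_le_left (inf_le_right.trans haτ)) _)
  have hd : d ≤ (d ⊓ τ) ⊔ D :=
    hdD.trans (sup_le_sup_right (le_inf inf_le_left (inf_le_right.trans hdτ)) _)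
  refine ⟨S ⊔ D ⊔ V₁, ⟨?_, ?_⟩, ?_, ?_, fun l hl => ?_⟩
  · exact hτK.disjoint_sup_right_of_disjoint_sup_left
      (hV.disjoint.mono_left (sup_le hτv (sup_le_sup hSs hDd)))
  · rw [codisjoint_iff, ← top_le_iff, ← hV.sup_eq_top]
    refine sup_le (sup_le (hs₁.trans ?_) (hd.trans ?_)) (le_sup_right.trans le_sup_right)
    · exact sup_le (inf_le_right.trans le_sup_left)
        ((le_sup_left.trans le_sup_left).trans le_sup_right)
    · exact sup_le (inf_le_right.trans le_sup_left)
        ((le_sup_right.trans le_sup_left).trans le_sup_right)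
  · exact hs₁.trans (sup_le_sup_left (le_inf hSs (le_sup_left.trans le_sup_left)) _)
  · exact hd.trans (sup_le_sup_left (le_inf hDd (le_sup_right.trans le_sup_left)) _)
  · refine (hVl l hl).trans (sup_le ?_ ((inf_le_inf_left _ le_sup_right).trans le_sup_right))
    refine (hWl (l ⊓ (s₁ ⊔ d)) (List.mem_append_left _ (List.mem_map_of_mem hl))).trans
      (sup_le_sup (inf_le_inf_right _ inf_le_left) ?_)
    refine le_inf (inf_le_left.trans inf_le_left) (le_trans ?_ (hgK.trans le_sup_left))
    exact le_inf inf_le_right (inf_le_left.trans (inf_le_inf_right _ (hb l hl)))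

end Modular

section Image

variable {X Y : Type} [Lattice X] [BoundedOrder X] [Lattice Y] [BoundedOrder Y]

/-- The image and preimage operations of a linear map, axiomatized on lattices. -/
structure IsImage (m : X → Y) (c : Y → X) : Prop where
  gc : GaloisConnection m c
  mc : ∀ u, m (c u) = u ⊓ m ⊤
  cm : ∀ u, c (m u) = u ⊔ c ⊥

namespace IsImage

variable {m : X → Y} {c : Y → X}

theorem sup_eq_top (h : IsImage m c) {t : X} {K : Y} (hK : m ⊤ ≤ m t ⊔ (K ⊓ m ⊤)) :
    c K ⊔ t = ⊤ := by
  have h1 : c (m (c K ⊔ t)) = c K ⊔ t := by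
    rw [h.cm, sup_eq_left.2 ((h.gc.monotone_u bot_le).trans le_sup_left)]
  rw [← h1, ← top_le_iff, ← h.gc, h.gc.l_sup, h.mc, sup_comm]
  exact hK

theorem inf_eq_bot (h : IsImage m c) {t : Y} {K : X} (hK : c t ⊓ (K ⊔ c ⊥) ≤ c ⊥) :
    m K ⊓ t = ⊥ := by
  have h1 : m (c (m K ⊓ t)) = m K ⊓ t := by
    rw [h.mc, inf_eq_left.2 (inf_le_left.trans (h.gc.monotone_l le_top))]
  rw [← h1, ← le_bot_iff, h.gc, h.gc.u_inf, h.cm, inf_comm]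
  exact hK

theorem sup_eq_top_of_isCompl [IsModularLattice Y] (h : IsImage m c) {t : X} {K : Y}
    (hK : IsCompl (m t) K) :
    c K ⊔ t = ⊤ := by
  refine h.sup_eq_top ?_
  rw [← sup_inf_assoc_of_le K (h.gc.monotone_l le_top), hK.sup_eq_top, top_inf_eq]

theorem inf_eq_bot_of_isCompl [IsModularLattice X] (h : IsImage m c) {t : Y} {K : X}
    (hK : IsCompl (c t) K) :
    m K ⊓ t = ⊥ := by
  refine h.inf_eq_bot ?_
  rw [inf_comm, sup_comm, sup_inf_assoc_of_le K (h.gc.monotone_u bot_le), inf_comm,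
    hK.inf_eq_bot, sup_bot_eq]

theorem exists_isCompl_comap [IsModularLattice X] [ComplementedLattice X] (h : IsImage m c)
    {t K : Y} (hK : Adapted t K (m ⊤)) :
    ∃ K' : X, IsCompl (c t) K' ∧ m K' ≤ K := by
  obtain ⟨K', -, h1, h2⟩ := exists_isCompl_between (p := c t) (l := c K) disjoint_bot_right bot_le
    (h.sup_eq_top (by rw [h.mc, inf_comm t, inf_comm K]; exact hK))
  exact ⟨K', h2, (h.gc _ _).2 h1⟩

theorem exists_isCompl_map [IsModularLattice X] [IsModularLattice Y] [ComplementedLattice Y]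
    (h : IsImage m c) {t K : X} (htK : IsCompl t K)
    (hK : Adapted t K (c ⊥)) {ls : List Y} (hls : ls.Pairwise (· ≤ ·))
    (hl : ∀ l ∈ ls, Adapted t K (c l)) :
    ∃ K' : Y, IsCompl (m t) K' ∧ m K ≤ K' ∧ ∀ l ∈ ls, Adapted (m t) K' l := by
  have hdisj : Disjoint (m t) (m K) := by
    rw [disjoint_iff, inf_comm]
    refine h.inf_eq_bot ?_
    rw [h.cm]
    set D := c ⊥
    have h1 : t ⊔ D ≤ t ⊔ (D ⊓ K) :=
      sup_le le_sup_left (hK.trans (sup_le (inf_le_right.trans le_sup_left) le_sup_right))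
    have h2 : K ⊔ D ≤ (D ⊓ t) ⊔ K :=
      sup_le le_sup_right (hK.trans (sup_le le_sup_left (inf_le_right.trans le_sup_right)))
    calc (t ⊔ D) ⊓ (K ⊔ D) ≤ ((D ⊓ t) ⊔ K) ⊓ (t ⊔ (D ⊓ K)) :=
          le_inf (inf_le_right.trans h2) (inf_le_left.trans h1)
      _ = (D ⊓ t) ⊔ (K ⊓ (t ⊔ (D ⊓ K))) :=
          sup_inf_assoc_of_le K (inf_le_right.trans le_sup_left)
      _ = (D ⊓ t) ⊔ (D ⊓ K) := by
          rw [inf_comm K, sup_comm t, sup_inf_assoc_of_le t (inf_le_right : D ⊓ K ≤ K),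
            htK.inf_eq_bot, sup_bot_eq]
      _ ≤ D := sup_le inf_le_left inf_le_left
  obtain ⟨W, -, hW, hWl⟩ := exists_isCompl_adapted (p := m ⊤) disjoint_bot_right hls
    (fun _ _ => bot_le)
  have hm : m ⊤ = m t ⊔ m K := by rw [← h.gc.l_sup, htK.sup_eq_top]
  refine ⟨m K ⊔ W, ⟨?_, ?_⟩, le_sup_left, fun l hl' => ?_⟩
  · exact hdisj.disjoint_sup_right_of_disjoint_sup_left (by rw [← hm]; exact hW.disjoint)
  · rw [codisjoint_iff, ← sup_assoc, ← hm, hW.sup_eq_top]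
  · have h1 : l ⊓ m ⊤ ≤ (l ⊓ m t) ⊔ (l ⊓ m K) := by
      rw [← h.mc]
      refine (h.gc.monotone_l (hl l hl')).trans ?_
      rw [h.gc.l_sup]
      refine sup_le_sup ?_ ?_ <;>
        exact le_inf ((h.gc.monotone_l inf_le_left).trans (h.gc.l_u_le l))
          (h.gc.monotone_l inf_le_right)
    refine (hWl l hl').trans (sup_le (h1.trans (sup_le_sup_left ?_ _)) (le_trans ?_ le_sup_right))
    · exact inf_le_inf_left _ le_sup_left
    · exact inf_le_inf_left _ le_sup_right

end IsImage

end Image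

/-! ## Compatible systems of modular lattices on a quiver -/

namespace TreeQuiver

variable {V E : Type} {src tgt : E → V}

/-- Modular complemented lattices at the vertices, with image and preimage operations along the
arrows. -/
structure LatSys (src tgt : E → V) where
  L : V → Type
  [lat : ∀ v, Lattice (L v)]
  [bdd : ∀ v, BoundedOrder (L v)]
  [isModular : ∀ v, IsModularLattice (L v)]
  [compl : ∀ v, ComplementedLattice (L v)]
  m : ∀ e, L (src e) → L (tgt e)
  c : ∀ e, L (tgt e) → L (src e)
  img : ∀ e, IsImage (m e) (c e)

namespace LatSys

attribute [instance] LatSys.lat LatSys.bdd LatSys.isModular LatSys.compl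

/-- The dual system. -/
def op (S : LatSys src tgt) : LatSys tgt src where
  L v := (S.L v)ᵒᵈ
  m e u := OrderDual.toDual (S.c e (OrderDual.ofDual u))
  c e u := OrderDual.toDual (S.m e (OrderDual.ofDual u))
  img e := ⟨(S.img e).gc.dual, (S.img e).cm, (S.img e).mc⟩

/-- A morphism of lattice systems is given by adjoint pairs. -/
structure Hom (S S' : LatSys src tgt) where
  map : ∀ v, S.L v → S'.L v
  adj : ∀ v, S'.L v → S.L v
  gc : ∀ v, GaloisConnection (map v) (adj v)
  map_m : ∀ e u, map _ (S.m e u) ≤ S'.m e (map _ u)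
  map_c : ∀ e u, map _ (S.c e u) ≤ S'.c e (map _ u)

/-- The dual morphism. -/
def Hom.op {S S' : LatSys src tgt} (f : Hom S S') : Hom S'.op S.op where
  map v u := OrderDual.toDual (f.adj v (OrderDual.ofDual u))
  adj v u := OrderDual.toDual (f.map v (OrderDual.ofDual u))
  gc v := (f.gc v).dual
  map_m e _ := (f.gc _).le_u ((f.map_c e _).trans
    ((S'.img e).gc.monotone_u ((f.gc _).l_u_le _)))
  map_c e _ := (f.gc _).le_u ((f.map_m e _).trans
    ((S'.img e).gc.monotone_l ((f.gc _).l_u_le _)))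

/-- Extend a family of elements along an arm by images and preimages. -/
noncomputable def arm (S : LatSys src tgt) : List (E × Bool) → (∀ v, S.L v) → ∀ v, S.L v
  | [], t => t
  | (e, true) :: l, t => S.arm l (Function.update t (tgt e) (S.m e (t (src e))))
  | (e, false) :: l, t => S.arm l (Function.update t (src e) (S.c e (t (tgt e))))

theorem Hom.map_update_le {S S' : LatSys src tgt} (f : Hom S S') {t : ∀ v, S.L v}
    {t' : ∀ v, S'.L v} (h : ∀ v, f.map v (t v) ≤ t' v) {w : V} {a : S.L w} {a' : S'.L w}
    (ha : f.map w a ≤ a') (v : V) :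
    f.map v (Function.update t w a v) ≤ Function.update t' w a' v := by
  by_cases hv : v = w
  · subst hv
    simpa using ha
  · simpa [hv] using h v

theorem Hom.map_arm_le {S S' : LatSys src tgt} (f : Hom S S') (l : List (E × Bool))
    {t : ∀ v, S.L v} {t' : ∀ v, S'.L v} (h : ∀ v, f.map v (t v) ≤ t' v) (v : V) :
    f.map v (S.arm l t v) ≤ S'.arm l t' v := by
  induction l generalizing t t' with
  | nil => exact h v
  | cons s l ih =>
    obtain ⟨e, _ | _⟩ := s
    · exact ih (f.map_update_le h ((f.map_c _ _).trans ((S'.img e).gc.monotone_u (h _))))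
    · exact ih (f.map_update_le h ((f.map_m _ _).trans ((S'.img e).gc.monotone_l (h _))))

variable (S : LatSys src tgt)

theorem arm_eq {T : Set V} {v : V} {l : List (E × Bool)} (hl : IsArm src tgt T v l)
    (t : ∀ v, S.L v) {u : V} (hu : u ∈ T) : S.arm l t u = t u := by
  induction l generalizing T v t with
  | nil => rfl
  | cons s l ih =>
    obtain ⟨e, _ | _⟩ := s
    · obtain ⟨rfl, h2, h3⟩ := hl
      exact (ih h3 _ (Set.mem_insert_of_mem _ hu)).trans
        (Function.update_of_ne (ne_of_mem_of_not_mem hu h2) _ _)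
    · obtain ⟨rfl, h2, h3⟩ := hl
      exact (ih h3 _ (Set.mem_insert_of_mem _ hu)).trans
        (Function.update_of_ne (ne_of_mem_of_not_mem hu h2) _ _)

theorem arm_spec {T : Set V} {v : V} {l : List (E × Bool)} (hl : IsArm src tgt T v l)
    (hv : v ∈ T) (t : ∀ v, S.L v) : ∀ s ∈ l,
      (s.2 = true → S.arm l t (tgt s.1) = S.m s.1 (S.arm l t (src s.1))) ∧
      (s.2 = false → S.arm l t (src s.1) = S.c s.1 (S.arm l t (tgt s.1))) := by
  induction l generalizing T v t with
  | nil => simp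
  | cons s l ih =>
    obtain ⟨e, _ | _⟩ := s <;> obtain ⟨rfl, h2, h3⟩ := hl <;> intro s hs <;>
      rcases List.mem_cons.1 hs with rfl | hs
    · refine ⟨by simp, fun _ => ?_⟩
      simp only [arm]
      rw [S.arm_eq h3 _ (Set.mem_insert _ _), S.arm_eq h3 _ (Set.mem_insert_of_mem _ hv),
        Function.update_self, Function.update_of_ne (ne_of_mem_of_not_mem hv h2)]
    · exact ih h3 (Set.mem_insert _ _) _ s hs
    · refine ⟨fun _ => ?_, by simp⟩
      simp only [arm]
      rw [S.arm_eq h3 _ (Set.mem_insert _ _), S.arm_eq h3 _ (Set.mem_insert_of_mem _ hv),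
        Function.update_self, Function.update_of_ne (ne_of_mem_of_not_mem hv h2)]
    · exact ih h3 (Set.mem_insert _ _) _ s hs

theorem arm_compat {T : Set V} {v : V} {l : List (E × Bool)} (hl : IsArm src tgt T v l)
    (hv : v ∈ T) (t : ∀ v, S.L v) {s : E × Bool} (hs : s ∈ l) :
    S.m s.1 (S.arm l t (src s.1)) ≤ S.arm l t (tgt s.1) := by
  have h := S.arm_spec hl hv t s hs
  cases h2 : s.2
  · rw [h.2 h2]
    exact (S.img _).gc.l_u_le _
  · exact (h.1 h2).ge

theorem isCompl_update {t K : ∀ v, S.L v} (h : ∀ u, IsCompl (t u) (K u)) {w : V} {a b : S.L w}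
    (hab : IsCompl a b) (u : V) :
    IsCompl (Function.update t w a u) (Function.update K w b u) := by
  by_cases hu : u = w
  · subst hu
    simpa using hab
  · simpa [hu] using h u

theorem exists_isCompl_arm {T : Set V} {v : V} {l : List (E × Bool)} (hl : IsArm src tgt T v l)
    (hv : v ∈ T) (t : ∀ v, S.L v) :
    ∃ A B : S.L v, A ≤ B ∧ Disjoint (t v) A ∧ B ⊔ t v = ⊤ ∧
      ∀ K : ∀ v, S.L v, (∀ u, IsCompl (t u) (K u)) → A ≤ K v → K v ≤ B →
        ∃ K' : ∀ v, S.L v, (∀ u ∈ T, K' u = K u) ∧ (∀ u, IsCompl (S.arm l t u) (K' u)) ∧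
          ∀ s ∈ l, S.m s.1 (K' (src s.1)) ≤ K' (tgt s.1) := by
  induction l generalizing T v t with
  | nil =>
    exact ⟨⊥, ⊤, bot_le, disjoint_bot_right, top_sup_eq _, fun K hK _ _ =>
      ⟨K, fun _ _ => rfl, hK, by simp⟩⟩
  | cons s l ih =>
    obtain ⟨e, _ | _⟩ := s <;> obtain ⟨rfl, h2, h3⟩ := hl
    · obtain ⟨A, B, hAB, hA, hB, hK⟩ := ih h3 (Set.mem_insert _ _)
        (Function.update t (src e) (S.c e (t (tgt e))))
      obtain ⟨Ku, hK1, hK2, hK3⟩ := exists_isCompl_between hA hAB hB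
      rw [Function.update_self] at hK3
      refine ⟨S.m e Ku, ⊤, le_top, (disjoint_iff.2 ((S.img e).inf_eq_bot_of_isCompl hK3)).symm,
        top_sup_eq _, fun K hKt hA' _ => ?_⟩
      obtain ⟨K', h4, h5, h6⟩ := hK (Function.update K (src e) Ku) (S.isCompl_update hKt hK3)
        (by rwa [Function.update_self]) (by rwa [Function.update_self])
      have h7 : ∀ u ∈ T, K' u = K u := fun u hu => (h4 u (Set.mem_insert_of_mem _ hu)).trans
        (Function.update_of_ne (ne_of_mem_of_not_mem hu h2) _ _)
      refine ⟨K', h7, h5, fun s hs => ?_⟩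
      rcases List.mem_cons.1 hs with rfl | hs
      · rw [h7 _ hv, h4 _ (Set.mem_insert _ _), Function.update_self]
        exact hA'
      · exact h6 s hs
    · obtain ⟨A, B, hAB, hA, hB, hK⟩ := ih h3 (Set.mem_insert _ _)
        (Function.update t (tgt e) (S.m e (t (src e))))
      obtain ⟨Ku, hK1, hK2, hK3⟩ := exists_isCompl_between hA hAB hB
      rw [Function.update_self] at hK3
      refine ⟨⊥, S.c e Ku, bot_le, disjoint_bot_right, (S.img e).sup_eq_top_of_isCompl hK3,
        fun K hKt _ hB' => ?_⟩
      obtain ⟨K', h4, h5, h6⟩ := hK (Function.update K (tgt e) Ku) (S.isCompl_update hKt hK3)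
        (by rwa [Function.update_self]) (by rwa [Function.update_self])
      have h7 : ∀ u ∈ T, K' u = K u := fun u hu => (h4 u (Set.mem_insert_of_mem _ hu)).trans
        (Function.update_of_ne (ne_of_mem_of_not_mem hu h2) _ _)
      refine ⟨K', h7, h5, fun s hs => ?_⟩
      rcases List.mem_cons.1 hs with rfl | hs
      · rw [h7 _ hv, h4 _ (Set.mem_insert _ _), Function.update_self, (S.img e).gc]
        exact hB'
      · exact h6 s hs

theorem exists_isCompl_route {T : Set V} {v : V} {l : List E}
    (hl : IsArm src tgt T v (l.map (·, true))) (hv : v ∈ T) :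
    ∃ Ls : List (S.L v), Ls.Pairwise (· ≤ ·) ∧
      (∀ Z : ∀ u, S.L u, (∀ e ∈ l, S.c e (Z (tgt e)) ≤ Z (src e)) → ∀ a ∈ Ls, a ≤ Z v) ∧
      ∀ t K : ∀ v, S.L v, (∀ u, IsCompl (t u) (K u)) → (∀ a ∈ Ls, Adapted (t v) (K v) a) →
        ∃ K' : ∀ v, S.L v, (∀ u ∈ T, K' u = K u) ∧
          (∀ u, IsCompl (S.arm (l.map (·, true)) t u) (K' u)) ∧
          ∀ e ∈ l, S.m e (K' (src e)) ≤ K' (tgt e) := by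
  induction l generalizing T v with
  | nil =>
    exact ⟨[], List.Pairwise.nil, by simp, fun t K hK _ => ⟨K, fun _ _ => rfl, hK, by simp⟩⟩
  | cons e l ih =>
    obtain ⟨rfl, h2, h3⟩ := hl
    obtain ⟨Ls, hLs, hZ, hK⟩ := ih h3 (Set.mem_insert _ _)
    refine ⟨S.c e ⊥ :: Ls.map (S.c e), ?_, fun Z h => ?_, fun t K htK ha => ?_⟩
    · rw [List.pairwise_cons, List.pairwise_map]
      refine ⟨fun a ha => ?_, hLs.imp fun h => (S.img e).gc.monotone_u h⟩
      obtain ⟨b, -, rfl⟩ := List.mem_map.1 ha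
      exact (S.img e).gc.monotone_u bot_le
    · have h1 := h e List.mem_cons_self
      intro a ha
      rcases List.mem_cons.1 ha with rfl | ha
      · exact ((S.img e).gc.monotone_u bot_le).trans h1
      · obtain ⟨b, hb, rfl⟩ := List.mem_map.1 ha
        exact ((S.img e).gc.monotone_u
          (hZ Z (fun e he => h e (List.mem_cons_of_mem _ he)) b hb)).trans h1
    · obtain ⟨Ku, hK1, hK2, hK3⟩ := (S.img e).exists_isCompl_map (htK (src e))
        (ha _ List.mem_cons_self) hLs fun a ha' =>
          ha _ (List.mem_cons_of_mem _ (List.mem_map_of_mem ha'))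
      obtain ⟨K', h4, h5, h6⟩ := hK (Function.update t (tgt e) (S.m e (t (src e))))
        (Function.update K (tgt e) Ku) (S.isCompl_update htK hK1)
        (by simpa only [Function.update_self] using hK3)
      have h7 : ∀ u ∈ T, K' u = K u := fun u hu => (h4 u (Set.mem_insert_of_mem _ hu)).trans
        (Function.update_of_ne (ne_of_mem_of_not_mem hu h2) _ _)
      refine ⟨K', h7, h5, fun e' he' => ?_⟩
      rcases List.mem_cons.1 he' with rfl | he'
      · rw [h7 _ hv, h4 _ (Set.mem_insert _ _), Function.update_self]
        exact hK2
      · exact h6 e' he'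

/-- The kernel or image of the operation of one arrow, at its near end. -/
noncomputable def near : E × Bool → ∀ v, S.L v
  | (e, true) => S.arm [(e, false)] fun _ => ⊥
  | (e, false) => S.arm [(e, true)] fun _ => ⊤

theorem Hom.map_near_le {S S' : LatSys src tgt} (f : Hom S S') (s : E × Bool) (v : V) :
    f.map v (S.near s v) ≤ S'.near s v := by
  obtain ⟨e, _ | _⟩ := s
  · exact f.map_arm_le _ (fun _ => le_top) v
  · exact f.map_arm_le _ (fun w => (f.gc w).l_bot.le) v

theorem exists_isCompl_single {T : Set V} {v : V} {s : E × Bool} (hs : IsArm src tgt T v [s])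
    (hv : v ∈ T) {t K : ∀ v, S.L v} (htK : ∀ u, IsCompl (t u) (K u))
    (ha : Adapted (t v) (K v) (S.near s v)) :
    ∃ K' : ∀ v, S.L v, (∀ u ∈ T, K' u = K u) ∧ (∀ u, IsCompl (S.arm [s] t u) (K' u)) ∧
      S.m s.1 (K' (src s.1)) ≤ K' (tgt s.1) := by
  obtain ⟨e, _ | _⟩ := s <;> obtain ⟨rfl, h2, -⟩ := hs
  · have h3 : S.near (e, false) (tgt e) = S.m e ⊤ := by simp [near, arm]
    rw [h3] at ha
    obtain ⟨Ku, h4, h5⟩ := (S.img e).exists_isCompl_comap ha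
    refine ⟨Function.update K (src e) Ku, fun u hu =>
      Function.update_of_ne (ne_of_mem_of_not_mem hu h2) _ _, S.isCompl_update htK h4, ?_⟩
    simpa [Function.update_of_ne (ne_of_mem_of_not_mem hv h2 : tgt e ≠ src e)] using h5
  · have h3 : S.near (e, true) (src e) = S.c e ⊥ := by simp [near, arm]
    rw [h3] at ha
    obtain ⟨Ku, h4, h5, -⟩ := (S.img e).exists_isCompl_map (htK _) ha List.Pairwise.nil (by simp)
    refine ⟨Function.update K (tgt e) Ku, fun u hu =>
      Function.update_of_ne (ne_of_mem_of_not_mem hu h2) _ _, S.isCompl_update htK h4, ?_⟩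
    simpa [Function.update_of_ne (ne_of_mem_of_not_mem hv h2 : src e ≠ tgt e)] using h5

end LatSys

end TreeQuiver

/-! ## Natural direct summands -/

namespace TreeQuiver

variable {V E : Type} {src tgt : E → V}

/-- Between an element `d` at `x` and an element `ℓ` at `y` with `d` pushed into `ℓ` along `π`,
there is a compatible family, natural in the lattice system, that admits a compatible complement. -/
def Splits (src tgt : E → V) (x y : V) (π : List E) : Prop :=
  ∃ t : ∀ S : LatSys src tgt, S.L x → S.L y → ∀ v, S.L v,
    (∀ (S S' : LatSys src tgt) (f : LatSys.Hom S S') d d' l l', f.map x d ≤ d' → f.map y l ≤ l' →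
      ∀ v, f.map v (t S d l v) ≤ t S' d' l' v) ∧
    ∀ (S : LatSys src tgt) d l,
      (∃ z : ∀ v, S.L v, d ≤ z x ∧ z y ≤ l ∧ ∀ e ∈ π, S.m e (z (src e)) ≤ z (tgt e)) →
      d ≤ t S d l x ∧ t S d l y ≤ l ∧ (∀ e, S.m e (t S d l (src e)) ≤ t S d l (tgt e)) ∧
        ∃ K : ∀ v, S.L v, (∀ v, IsCompl (t S d l v) (K v)) ∧
          ∀ e, S.m e (K (src e)) ≤ K (tgt e)

theorem Splits.of_op {x y : V} {π : List E} (h : Splits tgt src y x π.reverse) :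
    Splits src tgt x y π := by
  obtain ⟨t, ht, hs⟩ := h
  refine ⟨fun S d l v => OrderDual.ofDual (t S.op (OrderDual.toDual l) (OrderDual.toDual d) v),
    fun S S' f d d' l l' hd hl v => ?_, fun S d l hz => ?_⟩
  · exact (f.gc v).l_le (ht S'.op S.op f.op (OrderDual.toDual l') (OrderDual.toDual l)
      (OrderDual.toDual d') (OrderDual.toDual d) ((f.gc _).le_u hl) ((f.gc _).le_u hd) v)
  · obtain ⟨z, h1, h2, h3⟩ := hz
    obtain ⟨h4, h5, h6, K, h7, h8⟩ := hs S.op (OrderDual.toDual l) (OrderDual.toDual d)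
      ⟨fun v => OrderDual.toDual (z v), h2, h1, fun e he =>
        (S.img e).gc.le_u (h3 e (List.mem_reverse.1 he))⟩
    exact ⟨h5, h4, fun e => (S.img e).gc.l_le (h6 e), fun v => OrderDual.ofDual (K v),
      fun v => ⟨(h7 v).2.dual, (h7 v).1.dual⟩, fun e => (S.img e).gc.l_le (h8 e)⟩

theorem IsRoute.le_of_le (S : LatSys src tgt) {f g : ∀ v, S.L v} {v w : V} {l : List E}
    (hl : IsRoute src tgt v l w)
    (h : ∀ e ∈ l, f (src e) ≤ g (src e) → f (tgt e) ≤ g (tgt e)) (hv : f v ≤ g v) :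
    f w ≤ g w := by
  induction l generalizing v with
  | nil =>
    obtain rfl := hl
    exact hv
  | cons e l ih =>
    obtain ⟨rfl, hl⟩ := hl
    exact ih hl (fun e he => h e (List.mem_cons_of_mem _ he)) (h e List.mem_cons_self hv)

theorem IsRoute.ge_of_ge (S : LatSys src tgt) {f g : ∀ v, S.L v} {v w : V} {l : List E}
    (hl : IsRoute src tgt v l w)
    (h : ∀ e ∈ l, f (tgt e) ≤ g (tgt e) → f (src e) ≤ g (src e)) (hw : f w ≤ g w) :
    f v ≤ g v := by
  induction l generalizing v with
  | nil =>
    obtain rfl := hl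
    exact hw
  | cons e l ih =>
    obtain ⟨rfl, hl⟩ := hl
    exact h e List.mem_cons_self (ih hl fun e he => h e (List.mem_cons_of_mem _ he))

theorem IsLinear.splits (hT : IsTree src tgt) {x y : V} {π : List E}
    (hπ : IsRoute src tgt x π y) (h : IsLinear src tgt y π) : Splits src tgt x y π := by
  obtain ⟨l, w, hl, hn, hall⟩ := h
  have hA : IsArm src tgt {x} x (π.map (·, true) ++ l) :=
    hT.isArm (isWalk_append.2 ⟨y, hπ.isWalk, hl⟩) (by simpa [Function.comp_def] using hn)
      (S := ∅) (by simp)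
      (connBy_singleton _ _) rfl
  have hmem : ∀ e, ∃ s ∈ π.map (·, true) ++ l, s.1 = e := by
    intro e
    rcases hall e with he | he
    · exact ⟨(e, true), by simp [he], rfl⟩
    · obtain ⟨s, hs, rfl⟩ := List.mem_map.1 he
      exact ⟨s, List.mem_append_right _ hs, rfl⟩
  refine ⟨fun S d _ => S.arm (π.map (·, true) ++ l) (Function.update (fun _ => ⊥) x d),
    fun S S' f d d' _ _ hd _ => f.map_arm_le _ (f.map_update_le
      (fun v => (f.gc v).l_bot.le) hd), ?_⟩
  rintro S d ℓ ⟨z, hz1, hz2, hz3⟩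
  have hx : S.arm (π.map (·, true) ++ l) (Function.update (fun _ => ⊥) x d) x = d := by
    rw [S.arm_eq hA _ rfl, Function.update_self]
  refine ⟨hx.ge, ?_, fun e => ?_, ?_⟩
  · refine le_trans (IsRoute.le_of_le S hπ (fun e he h => ?_) (hx.trans_le hz1)) hz2
    have h1 := (S.arm_spec hA rfl (Function.update (fun _ => ⊥) x d) (e, true)
      (by simp [he])).1 rfl
    simp only at h1
    rw [h1]
    exact ((S.img e).gc.monotone_l h).trans (hz3 e he)
  · obtain ⟨s, hs, rfl⟩ := hmem e
    exact S.arm_compat hA rfl _ hs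
  · obtain ⟨A, B, hAB, hAd, hB, hK⟩ := S.exists_isCompl_arm hA rfl
      (Function.update (fun _ => ⊥) x d)
    obtain ⟨Kx, h1, h2, h3⟩ := exists_isCompl_between hAd hAB hB
    rw [Function.update_self] at h3
    obtain ⟨K', -, h4, h5⟩ := hK (Function.update (fun _ => ⊤) x Kx)
      (S.isCompl_update (fun _ => isCompl_bot_top) h3) (by rwa [Function.update_self])
      (by rwa [Function.update_self])
    refine ⟨K', h4, fun e => ?_⟩
    obtain ⟨s, hs, rfl⟩ := hmem e
    exact h5 s hs

theorem comp_mono {S S' : Set E} (h : S ⊆ S') (x : V) : comp src tgt S x ⊆ comp src tgt S' x :=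
  fun _ hu c hc => hu c fun δ hδ => hc δ (h hδ)

namespace LatSys

variable {S S' : LatSys src tgt} {π : List E} {v y : V}

/-- The bound on the values along a route imposed by `l` at its end. -/
noncomputable def bound (S : LatSys src tgt) (π : List E) {y : V} (l : S.L y) (v : V) : S.L v :=
  S.arm (π.reverse.map fun e => (e, false)) (Function.update (fun _ => ⊤) y l) v

theorem Hom.map_bound_le (f : Hom S S') {l : S.L y} {l' : S'.L y} (hl : f.map y l ≤ l') (v : V) :
    f.map v (S.bound π l v) ≤ S'.bound π l' v :=
  f.map_arm_le _ (f.map_update_le (fun _ => le_top) hl) v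

theorem bound_spec (hT : IsTree src tgt) (hπ : IsRoute src tgt v π y) (l : S.L y) :
    S.bound π l y = l ∧ ∀ e ∈ π, S.bound π l (src e) = S.c e (S.bound π l (tgt e)) := by
  have hA : IsArm src tgt {y} y (π.reverse.map fun e => (e, false)) := by
    refine hT.isArm (w := v) ?_ ?_ (S := ∅) (by simp) (connBy_singleton _ _) rfl
    · simpa [Function.comp_def] using (isRoute_reverse hπ).isWalk.op
    · simpa [Function.comp_def] using hT.nodup_of_isRoute hπ
  refine ⟨(S.arm_eq hA _ rfl).trans (Function.update_self _ _ _), fun e he => ?_⟩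
  exact (S.arm_spec hA rfl (Function.update (fun _ => ⊤) y l) (e, false) (by simp [he])).2 rfl

/-- The largest element at the branch vertex `v` of a fork reached from the two short branches
within the bound. -/
noncomputable def branch (S : LatSys src tgt) (s s' : E × Bool) (π : List E) (v : V) {y : V}
    (l : S.L y) : S.L v :=
  (S.near s v ⊓ S.bound π l v) ⊔ (S.near s' v ⊓ S.bound π l v)

theorem Hom.map_branch_le (f : Hom S S') {s s' : E × Bool} {l : S.L y} {l' : S'.L y}
    (hl : f.map y l ≤ l') : f.map v (S.branch s s' π v l) ≤ S'.branch s s' π v l' := by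
  rw [branch, (f.gc v).l_sup]
  have h := (f.gc v).monotone_l
  exact sup_le_sup
    (le_inf ((h inf_le_left).trans (f.map_near_le _ _)) ((h inf_le_right).trans
      (f.map_bound_le hl _)))
    (le_inf ((h inf_le_left).trans (f.map_near_le _ _)) ((h inf_le_right).trans
      (f.map_bound_le hl _)))

end LatSys

theorem IsFork.splits (hT : IsTree src tgt) {x y : V} {π : List E}
    (hπ : IsRoute src tgt x π y) (h : IsFork src tgt π) : Splits src tgt x y π := by
  have hπn := hT.nodup_of_isRoute hπ
  obtain ⟨α, π, s, w, rfl, hs, hsπ, hall⟩ := h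
  obtain ⟨rfl, hπ⟩ := hπ
  obtain ⟨hα, hπn⟩ := List.nodup_cons.1 hπn
  obtain ⟨hsα, hsπ⟩ := not_or.1 (List.mem_cons.not.1 hsπ)
  set v := tgt α with hv
  have hA₁ : IsArm src tgt {v} v [(α, false)] :=
    hT.isArm (show IsWalk src tgt v [(α, false)] (src α) from ⟨rfl, rfl⟩) (by simp)
      (S := ∅) (by simp) (connBy_singleton _ _) rfl
  have hA₂ : IsArm src tgt (comp src tgt {α} v) v [s] :=
    hT.isArm hs (by simp) (by simpa using hsα) (connBy_comp _ _) (mem_comp _ _)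
  have hA₃ : IsArm src tgt (comp src tgt {α, s.1} v) v (π.map (·, true)) := by
    refine hT.isArm hπ.isWalk (by simpa [Function.comp_def] using hπn) ?_ (connBy_comp _ _)
      (mem_comp _ _)
    simp only [List.mem_map, Set.mem_insert_iff, Set.mem_singleton_iff]
    rintro _ ⟨e, he, rfl⟩ (rfl | rfl)
    · exact hα he
    · exact hsπ he
  have hv₂ : v ∈ comp src tgt {α} v := mem_comp _ _
  have hv₃ : v ∈ comp src tgt {α, s.1} v := mem_comp _ _
  have hα₂ : src α ∈ comp src tgt {α} v := (comp_closed (Set.mem_singleton α)).2 hv₂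
  have h23 : comp src tgt {α} v ⊆ comp src tgt {α, s.1} v := comp_mono (by simp) v
  have hs₃ : src s.1 ∈ comp src tgt {α, s.1} v ∧ tgt s.1 ∈ comp src tgt {α, s.1} v := by
    have h1 := comp_closed (src := src) (tgt := tgt) (x := v)
      (Set.mem_insert_of_mem α (Set.mem_singleton s.1))
    obtain ⟨e, _ | _⟩ := s
    · have h2 : tgt e = v := hs.1
      exact ⟨h1.2 (by rwa [h2]), by rwa [h2]⟩
    · have h2 : src e = v := hs.1
      exact ⟨by rwa [h2], h1.1 (by rwa [h2])⟩
  let t₁ : ∀ S : LatSys src tgt, S.L y → ∀ u, S.L u := fun S l =>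
    S.arm [(α, false)] (Function.update (fun _ => ⊥) v (S.branch (α, false) s π v l))
  let t : ∀ S : LatSys src tgt, S.L y → ∀ u, S.L u := fun S l =>
    S.arm (π.map (·, true)) (S.arm [s] (t₁ S l))
  refine ⟨fun S _ => t S, fun S S' f _ _ l l' _ hl u => f.map_arm_le _ (f.map_arm_le _
    (f.map_arm_le _ (f.map_update_le (fun w => (f.gc w).l_bot.le) (f.map_branch_le hl)))) u, ?_⟩
  rintro S d ℓ ⟨z, hz1, hz2, hz3⟩
  obtain ⟨hb, hbe⟩ := LatSys.bound_spec hT hπ ℓ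
  have ht₂ : ∀ u ∈ comp src tgt {α, s.1} v, t S ℓ u = S.arm [s] (t₁ S ℓ) u :=
    fun u hu => S.arm_eq hA₃ _ hu
  have ht₁ : ∀ u ∈ comp src tgt {α} v, t S ℓ u = t₁ S ℓ u :=
    fun u hu => (ht₂ u (h23 hu)).trans (S.arm_eq hA₂ _ hu)
  have htv : t S ℓ v = S.branch (α, false) s π v ℓ :=
    (ht₁ v hv₂).trans ((S.arm_eq hA₁ _ rfl).trans (Function.update_self _ _ _))
  have htα : t S ℓ (src α) = S.c α (t S ℓ v) := by
    rw [ht₁ _ hα₂, ht₁ _ hv₂]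
    exact (S.arm_spec hA₁ rfl (Function.update (fun _ => ⊥) v (S.branch (α, false) s π v ℓ))
      (α, false) (by simp)).2 rfl
  refine ⟨?_, ?_, fun e => ?_, ?_⟩
  · show d ≤ t S ℓ (src α)
    rw [htα, htv, ← (S.img α).gc]
    refine le_trans (le_inf ?_ ?_) le_sup_left
    · have : S.near (α, false) v = S.m α ⊤ :=
        Function.update_self (β := S.L) (tgt α) (S.m α ⊤) fun _ => ⊤
      rw [this]
      exact (S.img α).gc.monotone_l le_top
    · refine ((S.img α).gc.monotone_l hz1).trans ((hz3 α List.mem_cons_self).trans ?_)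
      refine IsRoute.ge_of_ge S hπ (fun e he h => ?_) (hz2.trans hb.ge)
      rw [hbe e he, ← (S.img e).gc]
      exact (hz3 e (List.mem_cons_of_mem _ he)).trans h
  · refine (IsRoute.le_of_le S hπ (g := S.bound π ℓ) (fun e he h => ?_) ?_).trans hb.le
    · have h1 := (S.arm_spec hA₃ hv₃ (S.arm [s] (t₁ S ℓ)) (e, true) (by simp [he])).1 rfl
      refine h1.trans_le ?_
      rw [(S.img e).gc, ← hbe e he]
      exact h
    · exact htv.trans_le (sup_le inf_le_right inf_le_right)
  · show S.m e (t S ℓ (src e)) ≤ t S ℓ (tgt e)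
    rcases hall e with he | rfl
    · rcases List.mem_cons.1 he with rfl | he
      · rw [htα]
        exact (S.img _).gc.l_u_le _
      · exact S.arm_compat hA₃ hv₃ _ (s := (e, true)) (by simp [he])
    · rw [ht₂ _ hs₃.1, ht₂ _ hs₃.2]
      exact S.arm_compat hA₂ hv₂ _ (by simp)
  · obtain ⟨Ls, hLs, hLb, hLK⟩ := S.exists_isCompl_route hA₃ hv₃
    obtain ⟨Kv, h1, h2, h3, h4⟩ := exists_isCompl_of_fork (S.near (α, false) v) (S.near s v)
      (S.bound π ℓ v) hLs (hLb _ fun e he => (hbe e he).ge)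
    obtain ⟨K₁, h5, h6, h7⟩ := S.exists_isCompl_single hA₁ rfl
      (t := Function.update (fun _ => ⊥) v (S.branch (α, false) s π v ℓ))
      (K := Function.update (fun _ => ⊤) v Kv)
      (S.isCompl_update (fun _ => isCompl_bot_top) h1) (by simpa [LatSys.branch] using h2)
    have hK₁ : K₁ v = Kv := (h5 v rfl).trans (Function.update_self _ _ _)
    obtain ⟨K₂, h8, h9, h10⟩ := S.exists_isCompl_single hA₂ hv₂ (t := t₁ S ℓ) h6
      (by rw [← ht₁ v hv₂, htv, hK₁]; exact h3)
    have hK₂ : K₂ v = Kv := (h8 v hv₂).trans hK₁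
    obtain ⟨K₃, h11, h12, h13⟩ := hLK (S.arm [s] (t₁ S ℓ)) K₂ h9
      (by rw [← ht₂ v hv₃, htv, hK₂]; exact h4)
    refine ⟨K₃, h12, fun e => ?_⟩
    rcases hall e with he | rfl
    · rcases List.mem_cons.1 he with rfl | he
      · rw [h11 _ (h23 hα₂), h11 _ (h23 hv₂), h8 _ hα₂, h8 _ hv₂]
        exact h7
      · exact h13 e he
    · rw [h11 _ hs₃.1, h11 _ hs₃.2]
      exact h10

theorem Comparable.splits {k : Type} [Field k] [Fintype E] (hT : IsTree src tgt) {x y : V}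
    {π : List E} (hπ : IsRoute src tgt x π y) (h : Comparable k src tgt x π) :
    Splits src tgt x y π := by
  have hπ' := isRoute_reverse hπ
  rcases h.classification hT hπ with h | h | h | h
  · exact h.splits hT hπ
  · exact (h.splits hT.op hπ').of_op
  · exact h.splits hT hπ
  · exact (h.splits hT.op hπ').of_op

end TreeQuiver

/-! ## Fibres of a module -/

namespace QuiverPresentation

open TreeQuiver

variable {k A V E : Type} [Field k] [Ring A] [Algebra k A] [Fintype V] [Fintype E]
  (P : QuiverPresentation k A V E)

section Fibre

variable (M : Type) [AddCommGroup M] [Module k M] [Module A M] [IsScalarTower k A M]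

/-- The fibre of a module at a vertex. -/
def fib (v : V) : Submodule k M where
  carrier := {m | P.idem v • m = m}
  add_mem' h h' := by rw [Set.mem_ofPred_eq, smul_add, h, h']
  zero_mem' := smul_zero _
  smul_mem' c m h := by rw [Set.mem_ofPred_eq, smul_algebra_smul_comm, h]

/-- The action of an arrow on fibres. -/
def act (e : E) : P.fib M (P.src e) →ₗ[k] P.fib M (P.tgt e) where
  toFun m := ⟨P.arrow e • (m : M), P.idem_smul_arrow_smul e _⟩
  map_add' _ _ := Subtype.ext (smul_add _ _ _)
  map_smul' _ _ := Subtype.ext (smul_algebra_smul_comm _ _ _)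

/-- The projection onto a fibre. -/
def toFib (v : V) : M →ₗ[k] P.fib M v where
  toFun m := ⟨P.idem v • m, by
    show P.idem v • P.idem v • m = P.idem v • m
    rw [smul_smul, P.idem_idem]⟩
  map_add' _ _ := Subtype.ext (smul_add _ _ _)
  map_smul' _ _ := Subtype.ext (smul_algebra_smul_comm _ _ _)

variable {M}

theorem toFib_coe {v : V} (m : P.fib M v) : P.toFib M v m = m := Subtype.ext m.2

theorem toFib_coe_of_ne {v w : V} (h : v ≠ w) (m : P.fib M v) : P.toFib M w m = 0 := by
  refine Subtype.ext ?_
  show P.idem w • (m : M) = 0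
  rw [← m.2, smul_smul, P.idem_orth _ _ h.symm, zero_smul]

theorem sum_toFib (m : M) : ∑ v, (P.toFib M v m : M) = m := P.sum_idem_smul m

/-- The submodule with given fibres. -/
def glue (t : ∀ v, Submodule k (P.fib M v))
    (ht : ∀ e, (t (P.src e)).map (P.act M e) ≤ t (P.tgt e)) : Submodule A M where
  carrier := {m | ∀ v, P.toFib M v m ∈ t v}
  add_mem' h h' v := by rw [map_add]; exact (t v).add_mem (h v) (h' v)
  zero_mem' v := by rw [map_zero]; exact (t v).zero_mem
  smul_mem' x m hm := by
    refine P.smul_mem_of_stable (M := M)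
      { carrier := {m | ∀ v, P.toFib M v m ∈ t v}
        add_mem' := fun h h' v => by rw [map_add]; exact (t v).add_mem (h v) (h' v)
        zero_mem' := fun v => by rw [map_zero]; exact (t v).zero_mem
        neg_mem' := fun h v => by rw [map_neg]; exact (t v).neg_mem (h v) } ?_ ?_ ?_ x m hm
    · intro c m hm v
      rw [algebraMap_smul, map_smul]
      exact (t v).smul_mem _ (hm v)
    · intro w m hm v
      show P.toFib M v (P.toFib M w m) ∈ t v
      by_cases h : w = v
      · subst h
        rw [P.toFib_coe]
        exact hm w
      · rw [P.toFib_coe_of_ne h]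
        exact (t v).zero_mem
    · intro e m hm v
      have h1 : P.arrow e • m = (P.act M e (P.toFib M _ m) : M) :=
        (P.arrow_smul_idem_smul e m).symm
      rw [h1]
      by_cases h : P.tgt e = v
      · subst h
        rw [P.toFib_coe]
        exact ht e (Submodule.mem_map_of_mem (hm _))
      · rw [P.toFib_coe_of_ne h]
        exact (t v).zero_mem

theorem coe_mem_glue {t : ∀ v, Submodule k (P.fib M v)}
    {ht : ∀ e, (t (P.src e)).map (P.act M e) ≤ t (P.tgt e)} {v : V} {m : P.fib M v} :
    (m : M) ∈ P.glue t ht ↔ m ∈ t v := by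
  refine ⟨fun h => by simpa only [toFib_coe] using h v, fun h w => ?_⟩
  by_cases hw : v = w
  · subst hw
    rwa [P.toFib_coe]
  · rw [P.toFib_coe_of_ne hw]
    exact (t w).zero_mem

theorem isCompl_glue {t K : ∀ v, Submodule k (P.fib M v)}
    (ht : ∀ e, (t (P.src e)).map (P.act M e) ≤ t (P.tgt e))
    (hK : ∀ e, (K (P.src e)).map (P.act M e) ≤ K (P.tgt e)) (h : ∀ v, IsCompl (t v) (K v)) :
    IsCompl (P.glue t ht) (P.glue K hK) := by
  constructor
  · rw [Submodule.disjoint_def]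
    intro m h1 h2
    rw [← P.sum_toFib m]
    refine Finset.sum_eq_zero fun v _ => ?_
    rw [Submodule.disjoint_def.1 (h v).disjoint _ (h1 v) (h2 v), Submodule.coe_zero]
  · rw [codisjoint_iff, eq_top_iff]
    intro m _
    rw [← P.sum_toFib m]
    refine Submodule.sum_mem _ fun v _ => ?_
    obtain ⟨x, hx, y, hy, hxy⟩ := Submodule.mem_sup.1
      ((h v).sup_eq_top.ge (Submodule.mem_top (x := P.toFib M v m)))
    rw [← hxy, Submodule.coe_add]
    exact Submodule.add_mem_sup (P.coe_mem_glue.2 hx) (P.coe_mem_glue.2 hy)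

theorem isImage_map_comap {X Y : Type} [AddCommGroup X] [Module k X] [AddCommGroup Y]
    [Module k Y] (f : X →ₗ[k] Y) : IsImage (Submodule.map f) (Submodule.comap f) where
  gc := Submodule.gc_map_comap f
  mc u := by rw [Submodule.map_comap_eq, Submodule.map_top, inf_comm]
  cm u := by rw [Submodule.comap_map_eq]; rfl

/-- The fibres at the vertices of a subquiver form a system of lattices. -/
def latSys (M : Type) [AddCommGroup M] [Module k M] [Module A M] [IsScalarTower k A M]
    (C : V → Prop) : LatSys (coreSrc P.src P.tgt C) (coreTgt P.src P.tgt C) where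
  L v := Submodule k (P.fib M v.1)
  m e := Submodule.map (P.act M e.1)
  c e := Submodule.comap (P.act M e.1)
  img e := isImage_map_comap (P.act M e.1)

variable {N : Type} [AddCommGroup N] [Module k N] [Module A N] [IsScalarTower k A N]

/-- The action of a linear map on fibres. -/
def fibMap (f : M →ₗ[A] N) (v : V) : P.fib M v →ₗ[k] P.fib N v :=
  (f.restrictScalars k).restrict fun m hm => by
    show P.idem v • f m = f m
    rw [← map_smul, show P.idem v • m = m from hm]

/-- A linear map induces a morphism of lattice systems. -/
def latSysHom (f : M →ₗ[A] N) (C : V → Prop) : LatSys.Hom (P.latSys M C) (P.latSys N C) where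
  map v := Submodule.map (P.fibMap f v.1)
  adj v := Submodule.comap (P.fibMap f v.1)
  gc _ := Submodule.gc_map_comap _
  map_m e u := by
    rintro _ ⟨_, ⟨m, hm, rfl⟩, rfl⟩
    exact ⟨P.fibMap f _ m, Submodule.mem_map_of_mem hm, Subtype.ext (map_smul f _ _).symm⟩
  map_c e u := by
    rintro _ ⟨m, hm, rfl⟩
    refine ⟨P.act M e.1 m, hm, Subtype.ext (map_smul f _ _)⟩

end Fibre

end QuiverPresentation

/-! ## The natural direct summand separating the two vertices -/

namespace QuiverPresentation

open TreeQuiver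
open scoped ModuleCat

variable {k A V E : Type} [Field k] [Ring A] [Algebra k A] [Fintype V] [Fintype E]
  (P : QuiverPresentation k A V E) {α₀ ω : E} {C X : V → Prop}

section Extend

variable {M : Type} [AddCommGroup M] [Module k M] [Module A M] [IsScalarTower k A M]

/-- Extend a family of subspaces at the vertices in `C` to all vertices. -/
noncomputable def extendFib (u : ∀ v, Submodule k (P.fib M v))
    (t : ∀ v : {v // C v}, Submodule k (P.fib M v.1)) (v : V) : Submodule k (P.fib M v) :=
  if h : C v then t ⟨v, h⟩ else u v

theorem extendFib_of_mem {u : ∀ v, Submodule k (P.fib M v)}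
    {t : ∀ v : {v // C v}, Submodule k (P.fib M v.1)} {v : V} (h : C v) :
    P.extendFib u t v = t ⟨v, h⟩ := dif_pos h

theorem extendFib_of_not_mem {u : ∀ v, Submodule k (P.fib M v)}
    {t : ∀ v : {v // C v}, Submodule k (P.fib M v.1)} {v : V} (h : ¬ C v) :
    P.extendFib u t v = u v := dif_neg h

theorem map_extendFib_le (hC : IsCore P.src P.tgt α₀ ω C X) {u : ∀ v, Submodule k (P.fib M v)}
    {t : ∀ v : {v // C v}, Submodule k (P.fib M v.1)}
    (h1 : (u (P.src α₀)).map (P.act M α₀) ≤ t ⟨_, hC.tgt_fst⟩)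
    (h2 : (t ⟨_, hC.src_snd⟩).map (P.act M ω) ≤ u (P.tgt ω))
    (h3 : ∀ e : CoreArrow P.src P.tgt C, (t (coreSrc _ _ C e)).map (P.act M e.1) ≤
      t (coreTgt _ _ C e))
    (h4 : ∀ e, (X (P.src e) ↔ X (P.tgt e)) → (u (P.src e)).map (P.act M e) ≤ u (P.tgt e))
    (e : E) : (P.extendFib u t (P.src e)).map (P.act M e) ≤ P.extendFib u t (P.tgt e) := by
  by_cases h : e = α₀
  · subst h
    rwa [P.extendFib_of_mem hC.tgt_fst,
      P.extendFib_of_not_mem fun hc => hC.not_mem _ hc hC.src_fst]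
  by_cases h' : e = ω
  · subst h'
    rwa [P.extendFib_of_mem hC.src_snd, P.extendFib_of_not_mem hC.tgt_snd.1]
  by_cases hc : C (P.src e)
  · have hc' := (hC.core_iff e h h').1 hc
    rw [P.extendFib_of_mem hc, P.extendFib_of_mem hc']
    exact h3 ⟨e, hc, hc'⟩
  · rw [P.extendFib_of_not_mem hc,
      P.extendFib_of_not_mem fun hc' => hc ((hC.core_iff e h h').2 hc')]
    exact h4 e (hC.upper_iff e h h')

end Extend

/-- The vectors annihilated by the route to `b`. -/
def annih (M : Type) [AddCommGroup M] [Module k M] [Module A M] [IsScalarTower k A M] (b v : V) :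
    Submodule k (P.fib M v) where
  carrier := {m | ∀ l, IsRoute P.src P.tgt v l b → P.wprod l • (m : M) = 0}
  add_mem' h h' l hl := by rw [Submodule.coe_add, smul_add, h l hl, h' l hl, add_zero]
  zero_mem' _ _ := smul_zero _
  smul_mem' c m h l hl := by
    rw [Submodule.coe_smul, smul_algebra_smul_comm, h l hl, smul_zero]

theorem map_annih_le (M : Type) [AddCommGroup M] [Module k M] [Module A M] [IsScalarTower k A M]
    (b : V) (e : E) : (P.annih M b (P.src e)).map (P.act M e) ≤ P.annih M b (P.tgt e) := by
  rintro _ ⟨m, hm, rfl⟩ l hl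
  have := hm (e :: l) ⟨rfl, hl⟩
  rwa [wprod_cons, mul_smul] at this

theorem exists_natural_core (hT : IsTree P.src P.tgt) (hC : IsCore P.src P.tgt α₀ ω C X)
    {π : List E} (hπ : IsRoute P.src P.tgt (P.tgt α₀) π (P.src ω))
    {π' : List (CoreArrow P.src P.tgt C)}
    (hs : Splits (coreSrc P.src P.tgt C) (coreTgt P.src P.tgt C) ⟨_, hC.tgt_fst⟩
      ⟨_, hC.src_snd⟩ π')
    (h0 : P.wprod (α₀ :: (π ++ [ω])) * P.idem (P.src α₀) = 0) :
    ∃ t : ∀ (M : ModuleCat.{0} A) (v : {v // C v}), Submodule k (P.fib M v.1),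
      (∀ (M N : ModuleCat.{0} A) (f : M ⟶ N) v, (t M v).map (P.fibMap f.hom v.1) ≤ t N v) ∧
      ∀ M : ModuleCat.{0} A, (⊤ : Submodule k _).map (P.act M α₀) ≤ t M ⟨_, hC.tgt_fst⟩ ∧
        (t M ⟨_, hC.src_snd⟩).map (P.act M ω) ≤ ⊥ ∧
        (∀ e, (t M (coreSrc _ _ C e)).map (P.act M e.1) ≤ t M (coreTgt _ _ C e)) ∧
        ∃ K : ∀ v : {v // C v}, Submodule k (P.fib M v.1), (∀ v, IsCompl (t M v) (K v)) ∧
          ∀ e, (K (coreSrc _ _ C e)).map (P.act M e.1) ≤ K (coreTgt _ _ C e) := by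
  obtain ⟨t, ht, hs⟩ := hs
  let d (M : ModuleCat.{0} A) : (P.latSys M C).L ⟨_, hC.tgt_fst⟩ :=
    (⊤ : Submodule k _).map (P.act M α₀)
  let l (M : ModuleCat.{0} A) : (P.latSys M C).L ⟨_, hC.src_snd⟩ :=
    (⊥ : Submodule k _).comap (P.act M ω)
  refine ⟨fun M => t (P.latSys M C) (d M) (l M), fun M N f v => ?_, fun M => ?_⟩
  · refine ht (P.latSys M C) (P.latSys N C) (P.latSysHom f.hom C) (d M) (d N) (l M) (l N) ?_ ?_ v
    · rintro _ ⟨_, ⟨m, -, rfl⟩, rfl⟩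
      exact ⟨P.fibMap f.hom _ m, trivial, Subtype.ext (map_smul f.hom _ _).symm⟩
    · rintro _ ⟨m, hm, rfl⟩
      have hm : P.arrow ω • (m : M) = 0 := congrArg Subtype.val hm
      refine Subtype.ext ?_
      show P.arrow ω • f.hom (m : M) = 0
      rw [← map_smul, hm, map_zero]
  · have hd : d M ≤ P.annih M (P.tgt ω) (P.tgt α₀) := by
      rintro _ ⟨m, -, rfl⟩ l hl
      have hω : IsRoute P.src P.tgt (P.src ω) [ω] (P.tgt ω) := ⟨rfl, rfl⟩
      have hl : α₀ :: l = α₀ :: (π ++ [ω]) :=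
        congrArg _ (hT.route_unique hl (isRoute_append.2 ⟨_, hπ, hω⟩))
      show P.wprod l • P.arrow α₀ • (m : M) = 0
      have hm : P.idem (P.src α₀) • (m : M) = m := m.2
      rw [smul_smul, ← wprod_cons, hl, ← hm, smul_smul, h0, zero_smul]
    have hl : P.annih M (P.tgt ω) (P.src ω) ≤ l M := by
      intro m hm
      have hm := hm [ω] ⟨rfl, rfl⟩
      rw [wprod_cons, wprod_nil, one_mul] at hm
      exact Subtype.ext hm
    obtain ⟨h1, h2, h3, K, h4, h5⟩ := hs (P.latSys M C) (d M) (l M)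
      ⟨fun v => P.annih M (P.tgt ω) v.1, hd, hl, fun e _ => P.map_annih_le M _ e.1⟩
    exact ⟨h1, Submodule.map_le_iff_le_comap.2 h2, h3, K, h4, h5⟩

theorem exists_natural_fib (hT : IsTree P.src P.tgt) (hC : IsCore P.src P.tgt α₀ ω C X)
    {π : List E} (hπ : IsRoute P.src P.tgt (P.tgt α₀) π (P.src ω))
    {π' : List (CoreArrow P.src P.tgt C)}
    (hs : Splits (coreSrc P.src P.tgt C) (coreTgt P.src P.tgt C) ⟨_, hC.tgt_fst⟩
      ⟨_, hC.src_snd⟩ π')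
    (h0 : P.wprod (α₀ :: (π ++ [ω])) * P.idem (P.src α₀) = 0) :
    ∃ t : ∀ (M : ModuleCat.{0} A) v, Submodule k (P.fib M v),
      (∀ (M N : ModuleCat.{0} A) (f : M ⟶ N) v, (t M v).map (P.fibMap f.hom v) ≤ t N v) ∧
      (∀ M, FinIndec A M → (∀ v, t M v = ⊤) ∨ ∀ v, t M v = ⊥) ∧
      ∀ M, t M (P.src α₀) = ⊤ ∧ t M (P.tgt ω) = ⊥ := by
  obtain ⟨t, ht, hs⟩ := P.exists_natural_core hT hC hπ hs h0
  let u (M : ModuleCat.{0} A) (v : V) : Submodule k (P.fib M v) := if X v then ⊤ else ⊥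
  let u' (M : ModuleCat.{0} A) (v : V) : Submodule k (P.fib M v) := if X v then ⊥ else ⊤
  have hX : ¬ C (P.src α₀) := fun hc => hC.not_mem _ hc hC.src_fst
  have hu1 (M : ModuleCat.{0} A) : u M (P.src α₀) = ⊤ := if_pos hC.src_fst
  have hu2 (M : ModuleCat.{0} A) : u M (P.tgt ω) = ⊥ := if_neg hC.tgt_snd.2
  have hu1' (M : ModuleCat.{0} A) : u' M (P.src α₀) = ⊥ := if_pos hC.src_fst
  have hu2' (M : ModuleCat.{0} A) : u' M (P.tgt ω) = ⊤ := if_neg hC.tgt_snd.2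
  refine ⟨fun M v => P.extendFib (u M) (t M) v, fun M N f v => ?_, fun M hM => ?_,
    fun M => ⟨?_, ?_⟩⟩
  · show (P.extendFib (u M) (t M) v).map _ ≤ P.extendFib (u N) (t N) v
    by_cases h : C v
    · rw [P.extendFib_of_mem h, P.extendFib_of_mem h]
      exact ht M N f ⟨v, h⟩
    · rw [P.extendFib_of_not_mem h, P.extendFib_of_not_mem h]
      by_cases hx : X v
      · simp only [u, if_pos hx, le_top]
      · simp only [u, if_neg hx, Submodule.map_bot, le_refl]
  · obtain ⟨h1, h2, h3, K, h4, h5⟩ := hs M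
    have hst := P.map_extendFib_le hC (u := u M) (by rwa [hu1]) (by rwa [hu2]) h3 fun e he => by
      by_cases hx : X (P.src e)
      · simp only [u, if_pos (he.1 hx), le_top]
      · simp only [u, if_neg hx, Submodule.map_bot, bot_le]
    have hst' := P.map_extendFib_le hC (u := u' M) (by rw [hu1', Submodule.map_bot]; exact bot_le)
      (by rw [hu2']; exact le_top) h5 fun e he => by
      by_cases hx : X (P.src e)
      · simp only [u', if_pos hx, Submodule.map_bot, bot_le]
      · simp only [u', if_neg fun hh => hx (he.2 hh), le_top]
    have hc := P.isCompl_glue hst hst' fun v => by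
      by_cases h : C v
      · rw [P.extendFib_of_mem h, P.extendFib_of_mem h]
        exact h4 ⟨v, h⟩
      · rw [P.extendFib_of_not_mem h, P.extendFib_of_not_mem h]
        by_cases hx : X v
        · simp only [u, u', if_pos hx, isCompl_top_bot]
        · simp only [u, u', if_neg hx, isCompl_bot_top]
    rcases hM.eq_bot_or_eq_top hc with h | h
    · refine .inl fun v => eq_top_iff.2 fun m _ => (P.coe_mem_glue (ht := hst)).1 ?_
      rw [h]
      trivial
    · refine .inr fun v => eq_bot_iff.2 fun m hm => Subtype.ext ?_
      have hm := (P.coe_mem_glue (ht := hst)).2 hm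
      rw [h] at hm
      exact hm
  · exact (P.extendFib_of_not_mem hX).trans (hu1 M)
  · exact (P.extendFib_of_not_mem hC.tgt_snd.1).trans (hu2 M)

theorem eq_top_of_reach {t : ∀ (M : ModuleCat.{0} A) v, Submodule k (P.fib M v)}
    (h1 : ∀ (M N : ModuleCat.{0} A) (f : M ⟶ N) v, (t M v).map (P.fibMap f.hom v) ≤ t N v)
    (h2 : ∀ M, FinIndec A M → (∀ v, t M v = ⊤) ∨ ∀ v, t M v = ⊥) {M N : ModuleCat.{0} A}
    (h : Reach A M N) (hM : ∀ v, t M v = ⊤) : ∀ v, t N v = ⊤ := by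
  induction h with
  | refl => exact hM
  | cons _ hX hf _ ih =>
    obtain ⟨f, hf⟩ := hf
    refine ih ((h2 _ hX).resolve_right fun hb => hf ?_)
    ext m
    rw [← P.sum_toFib (k := k) m, map_sum]
    refine Finset.sum_eq_zero fun v _ => ?_
    have hv := h1 _ _ f v (Submodule.mem_map_of_mem
      ((hM v).ge (Submodule.mem_top (x := P.toFib _ v m))))
    rw [hb v] at hv
    exact congrArg Subtype.val hv

theorem not_reach_of_splits (hT : IsTree P.src P.tgt) (hC : IsCore P.src P.tgt α₀ ω C X)
    {π : List E} (hπ : IsRoute P.src P.tgt (P.tgt α₀) π (P.src ω))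
    {π' : List (CoreArrow P.src P.tgt C)}
    (hs : Splits (coreSrc P.src P.tgt C) (coreTgt P.src P.tgt C) ⟨_, hC.tgt_fst⟩
      ⟨_, hC.src_snd⟩ π')
    (h0 : P.wprod (α₀ :: (π ++ [ω])) * P.idem (P.src α₀) = 0) {M N : ModuleCat.{0} A}
    (hM : FinIndec A M) {p : M} (hp : P.idem (P.src α₀) • p = p) (hp0 : p ≠ 0) {s : N}
    (hsN : P.idem (P.tgt ω) • s = s) (hs0 : s ≠ 0) {L : ModuleCat.{0} A} (h1 : Reach A M L)
    (h2 : Reach A L N) : False := by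
  obtain ⟨t, ht, ht2, ht3⟩ := P.exists_natural_fib hT hC hπ hs h0
  have hD := P.eq_top_of_reach ht ht2 h2 (P.eq_top_of_reach ht ht2 h1
    ((ht2 _ hM).resolve_right fun hb => hp0 ?_)) (P.tgt ω)
  · have hm : (⟨s, hsN⟩ : P.fib N (P.tgt ω)) ∈ t N (P.tgt ω) := by
      rw [hD]; trivial
    rw [(ht3 N).2] at hm
    exact hs0 (congrArg Subtype.val hm)
  · have hm : (⟨p, hp⟩ : P.fib M (P.src α₀)) ∈ t M (P.src α₀) := by
      rw [(ht3 M).1]; trivial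
    rw [hb] at hm
    exact congrArg Subtype.val hm

end QuiverPresentation

theorem QPath.length_arrows {V E : Type} {src tgt : E → V} {a b : V} (p : QPath src tgt a b) :
    p.arrows.length = p.length := by
  induction p with
  | nil => simp only [arrows, length, List.length_nil]
  | cons p α h ih => simp only [arrows, length, List.length_append, ih, List.length_singleton]

theorem List.exists_eq_cons_append_singleton {α : Type} {l : List α} (h : 2 ≤ l.length) :
    ∃ a m b, l = a :: (m ++ [b]) := by
  obtain _ | ⟨a, l⟩ := l
  · simp at h
  · obtain ⟨m, b, rfl⟩ := l.eq_nil_or_concat.resolve_left (by rintro rfl; simp at h)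
    exact ⟨a, m, b, by rw [List.concat_eq_append]⟩

/-- Proposition: let `A` be a representation-finite tree algebra with exactly one
zero-relation from `a` to `b`. If there is a sectional path in `Γ_A` from a direct
summand of `rad P_a` to a direct summand of `I_b / soc I_b`, then no indecomposable
module is simultaneously a successor of `P_a` and a predecessor of `I_b`. -/
theorem no_module_between_proj_inj_of_sectional (k A : Type) [Field k] [IsAlgClosed k] [Ring A] [Algebra k A]
    [FiniteDimensional k A] (V E : Type) [Fintype V] [Fintype E]
    (P : QuiverPresentation k A V E) (hadm : P.Admissible) (hmin : P.Minimal)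
    (hrf : RepFinite A) (htree : P.IsTreeQuiver) (hmono : P.Monomial)
    (a b : V) (ρ : QPath P.src P.tgt a b) (hρ : P.IsZeroRel ρ)
    (huniq : ∀ (x y : V) (q : QPath P.src P.tgt x y), P.IsZeroRel q →
      x = a ∧ y = b ∧ HEq q ρ)
    (Pa Ib : ModuleCat.{0} A) (hPa : IsProjAt P a Pa) (hIb : IsInjAt P b Ib)
    (R J : ModuleCat.{0} A)
    (hR : IsSummand A R (ModuleCat.of A (radOf A Pa)))
    (hJ : IsSummand A J (ModuleCat.of A (Ib ⧸ socOf A Ib)))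
    (n : ℕ) (hsec : SectionalPath A R J n) :
    ¬ ∃ M : ModuleCat.{0} A, FinIndec A M ∧ Reach A Pa M ∧ Reach A M Ib := by
  rintro ⟨M, -, hPM, hMI⟩
  have hT := htree.isTree
  obtain ⟨α₀, π, ω, hρ'⟩ := List.exists_eq_cons_append_singleton (ρ.length_arrows ▸ hρ.2.1)
  have hr := ρ.isRoute_arrows
  rw [hρ'] at hr
  obtain ⟨rfl, hr⟩ := hr
  obtain ⟨y, hπ, rfl, rfl⟩ := TreeQuiver.isRoute_append.1 hr
  obtain ⟨C, X, hC, h1, h2⟩ := hT.exists_isCore hπ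
  obtain ⟨π', hπ', hr'⟩ := hC.exists_route hC.tgt_fst hC.src_snd hπ h1 h2
  obtain ⟨p, σ, hp⟩ := P.exists_isProjGen hT hPa
  obtain ⟨s, hs⟩ := P.exists_isInjCogen hIb
  have := hIb.1
  have hcomp := P.comparable_core hT hmono huniq hρ' hπ hp hs hR hJ hsec hC hπ'
  have h0 := hρ.1
  rw [P.qprod_eq_wprod, hρ'] at h0
  have hp0 : p ≠ 0 := by
    rintro rfl
    obtain ⟨x, hx⟩ := @exists_ne _ hPa.2.1.2.1 (0 : Pa)
    exact hx (by rw [← hp.map_smul x, smul_zero])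
  exact P.not_reach_of_splits hT hC hπ (hcomp.splits (hC.isTree hT) hr') h0 hPa.2.1 hp.idem_smul hp0
    hs.idem_smul hs.ne_zero hPM hMI
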